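/- arXiv:1903.08266 — 4 statements merged into one kernel-verified Lean document; each statement's English description precedes it below -/
import Mathlib

section
/- For sets without a proper arithmetic progression of length 3 in (ℤ/4ℤ)^n the following exact values hold: r_3(ℤ_4^1) = 2, r_3(ℤ_4^2) = 6, r_3(ℤ_4^3) = 16, r_3(ℤ_4^4) = 42, and r_3(ℤ_4^5) = 124. -/
/-- `S ⊆ (ℤ/mℤ)^n` contains no proper `k`-term arithmetic progression,
i.e. no progression `x, x+d, …, x+(k-1)d` with pairwise distinct terms. -/
def ProgFree (m k : ℕ) {n : ℕ} (S : Finset (Fin n → ZMod m)) : Prop :=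
  ¬ ∃ x d : Fin n → ZMod m,
      (Function.Injective fun i : Fin k => x + (i : ℕ) • d) ∧
      ∀ i : Fin k, x + (i : ℕ) • d ∈ S

/-- `rAP k m n` is the maximal size of a subset of `(ℤ/mℤ)^n` without a proper
`k`-term arithmetic progression. -/
noncomputable def rAP (k m n : ℕ) : ℕ :=
  sSup {c : ℕ | ∃ S : Finset (Fin n → ZMod m), ProgFree m k S ∧ S.card = c}

set_option linter.unusedSectionVars false
set_option linter.unusedSimpArgs false

namespace AP

open Finset Module

section Basics

variable {E : Type} [AddCommGroup E] [Module (ZMod 2) E]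

theorem h2 (x : E) : x + x = 0 := ZModModule.add_self x

theorem add_eq_zero2 {x y : E} : x + y = 0 ↔ x = y := by
  constructor
  · intro h; grind [h2 x, h2 y]
  · rintro rfl; exact h2 x

/-- Support set `T` and fibres `A a`: validity means no proper progression. -/
def Valid (T : Finset E) (A : E → Finset E) : Prop :=
  ∀ a ∈ T, ∀ x ∈ A a, ∀ z ∈ A a, x ≠ z → a + x + z ∉ T

theorem zmod2_cases (i : ZMod 2) : i = 0 ∨ i = 1 := by
  revert i; decide

variable [Fintype E] [DecidableEq E]

theorem clique {T : Finset E} {A : E → Finset E} (hV : Valid T A) {a : E} (ha : a ∈ T)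
    (B : Finset E) (hB : ∀ b ∈ B, ∀ c ∈ B, b ≠ c → a + b + c ∈ T) :
    (A a).card * B.card ≤ Fintype.card E := by
  rw [← Finset.card_product]
  apply Finset.card_le_card_of_injOn (t := univ) (fun p => p.1 + p.2) (by simp)
  rintro ⟨x, b⟩ hx ⟨y, c⟩ hy h
  simp only [coe_product, Set.mem_prod, mem_coe] at hx hy h
  by_cases hxy : x = y
  · subst hxy; simp at h; simp [h]
  · exfalso
    have h1 := hV a ha x hx.1 y hy.1 hxy
    have h3 : x + y = b + c := by grind [h2 x, h2 y, h2 b, h2 c]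
    have hbc : b ≠ c := by
      rintro rfl
      apply hxy
      grind [h2 x, h2 y, h2 b]
    have := hB b hx.2 c hy.2 hbc
    apply h1
    rw [add_assoc, h3, ← add_assoc]; exact this

theorem w_le_half {T : Finset E} {A : E → Finset E} (hV : Valid T A) {a : E} (ha : a ∈ T)
    (ht : 2 ≤ T.card) : (A a).card * 2 ≤ Fintype.card E := by
  obtain ⟨b, hb, hab⟩ := Finset.exists_mem_ne (s := T) (by omega) a
  have := clique hV ha {a, b} (by
    intro x hx y hy hxy
    simp only [mem_insert, mem_singleton] at hx hy
    have ea := h2 a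
    rcases hx with hx | hx <;> rcases hy with hy | hy <;> grind)
  rwa [Finset.card_pair hab.symm] at this

theorem w_le_univ {T : Finset E} {A : E → Finset E} (hV : Valid T A) {a : E} (ha : a ∈ T)
    (ht : T = univ) : (A a).card ≤ 1 := by
  rw [Finset.card_le_one]
  intro x hx y hy
  by_contra h
  exact hV a ha x hx y hy h (by simp [ht])

/-- plane through `a` inside `T` -/
def Plane (T : Finset E) (a : E) : Prop :=
  ∃ u v : E, u ≠ 0 ∧ v ≠ 0 ∧ u ≠ v ∧ a + u ∈ T ∧ a + v ∈ T ∧ a + u + v ∈ T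

theorem w_le_plane {T : Finset E} {A : E → Finset E} (hV : Valid T A) {a : E} (ha : a ∈ T)
    (hp : Plane T a) : (A a).card * 4 ≤ Fintype.card E := by
  obtain ⟨u, v, hu, hv, huv, h1, h3, h4⟩ := hp
  have := clique hV ha {0, u, v, u + v} (by
    intro x hx y hy hxy
    simp only [mem_insert, mem_singleton] at hx hy
    have eu := h2 u
    have ev := h2 v
    rcases hx with hx | hx | hx | hx <;> rcases hy with hy | hy | hy | hy <;> grind)
  have hc : ({0, u, v, u + v} : Finset E).card = 4 := by
    rw [card_insert_of_notMem, card_insert_of_notMem, card_insert_of_notMem, card_singleton]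
    · simp [hu]
    · simp only [mem_insert, mem_singleton]
      rintro (h | h)
      · exact huv h
      · exact hv (by simpa using h)
    · simp only [mem_insert, mem_singleton]
      rintro (h | h | h)
      · exact hu h.symm
      · exact hv h.symm
      · exact huv (add_eq_zero2.1 h.symm)
  rwa [hc] at this

theorem w_le_sub {T : Finset E} {A : E → Finset E} (hV : Valid T A) {a : E} (ha : a ∈ T)
    (V : Submodule (ZMod 2) E) (h : ∀ v ∈ V, a + v ∈ T) :
    (A a).card * Nat.card V ≤ Fintype.card E := by
  classical
  have := clique hV ha (univ.filter (· ∈ V)) (by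
    intro x hx y hy _
    rw [add_assoc]
    exact h _ (V.add_mem (by simpa using hx) (by simpa using hy)))
  have hc : (univ.filter (· ∈ V)).card = Nat.card V := by
    rw [Nat.card_eq_fintype_card, Fintype.card_subtype]
  rwa [hc] at this

theorem card_E {n : ℕ} (hn : finrank (ZMod 2) E = n) : Fintype.card E = 2 ^ n := by
  have := Module.natCard_eq_pow_finrank (K := ZMod 2) (V := E)
  rw [← Nat.card_eq_fintype_card, this, hn]; simp

theorem card_sub {n : ℕ} (V : Submodule (ZMod 2) E) (hn : finrank (ZMod 2) V = n) :
    Nat.card V = 2 ^ n := by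
  have := Module.natCard_eq_pow_finrank (K := ZMod 2) (V := V)
  rw [this, hn]; simp

theorem finrank_ker {n : ℕ} (hn : finrank (ZMod 2) E = n + 1) (φ : E →ₗ[ZMod 2] ZMod 2)
    (hφ : φ ≠ 0) : finrank (ZMod 2) (LinearMap.ker φ) = n := by
  have h1 := LinearMap.finrank_range_add_finrank_ker φ
  have h3 : finrank (ZMod 2) (LinearMap.range φ) = 1 := by
    rw [LinearMap.range_eq_top.2 (LinearMap.surjective hφ)]; simp
  omega

/-- restriction to a coset of a hyperplane -/
theorem half {T : Finset E} {A : E → Finset E} (hV : Valid T A) (φ : E →ₗ[ZMod 2] ZMod 2)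
    (hφ : φ ≠ 0) (c : E) (B : ℕ)
    (hB : ∀ (T' : Finset (LinearMap.ker φ)) (A' : LinearMap.ker φ → Finset (LinearMap.ker φ)),
      Valid T' A' → T'.card = (T.filter (fun b => φ b = φ c)).card →
      ∑ a ∈ T', (A' a).card ≤ B) :
    ∑ a ∈ T.filter (fun b => φ b = φ c), (A a).card ≤ 2 * B := by
  classical
  obtain ⟨e, he⟩ : ∃ e, φ e = 1 := LinearMap.surjective hφ 1
  set K := LinearMap.ker φ with hK
  let ι : K → E := fun h => (h : E) + c
  have hι : Function.Injective ι := fun x y h => by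
    apply Subtype.ext; simpa [ι] using h
  let T' : Finset K := univ.filter (fun h => ι h ∈ T)
  have hTimg : T'.image ι = T.filter (fun b => φ b = φ c) := by
    ext b
    simp only [T', mem_image, mem_filter, mem_univ, true_and, ι]
    constructor
    · rintro ⟨h, hT, rfl⟩
      refine ⟨hT, ?_⟩
      have : φ (h : E) = 0 := h.2
      simp [this]
    · rintro ⟨hT, hb⟩
      refine ⟨⟨b + c, ?_⟩, ?_, ?_⟩
      · rw [hK, LinearMap.mem_ker, map_add, hb, h2]
      · simpa [add_assoc, h2] using hT
      · simp [add_assoc, h2]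
  let A0 : E → K → Finset K := fun s h => univ.filter (fun u => (u : E) + s ∈ A (ι h))
  have hval : ∀ s, Valid T' (A0 s) := by
    intro s a ha x hx z hz hxz
    simp only [T', A0, mem_filter, mem_univ, true_and] at ha hx hz ⊢
    have := hV _ ha _ hx _ hz (by simpa using hxz)
    have e1 : ι a + (x + s) + (z + s) = ι (a + x + z) := by
      simp only [ι, Submodule.coe_add]
      grind [h2 s]
    rwa [e1] at this
  have hcard : T'.card = (T.filter (fun b => φ b = φ c)).card := by
    rw [← hTimg, card_image_of_injective _ hι]
  have hw : ∀ h : K, (A (ι h)).card = (A0 0 h).card + (A0 e h).card := by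
    intro h
    have s1 : (A0 0 h).card = ((A (ι h)).filter (fun u => φ u = 0)).card := by
      apply Finset.card_bij (fun (u : K) _ => (u : E))
      · intro u hu
        have : φ (u : E) = 0 := u.2
        simpa [A0, this] using hu
      · intro u _ v _ h; exact Subtype.ext h
      · intro b hb
        simp only [mem_filter] at hb
        exact ⟨⟨b, hb.2⟩, by simpa [A0] using hb.1, rfl⟩
    have s2 : (A0 e h).card = ((A (ι h)).filter (fun u => ¬ φ u = 0)).card := by
      apply Finset.card_bij (fun (u : K) _ => (u : E) + e)
      · intro u hu
        have : φ (u : E) = 0 := u.2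
        simpa [A0, this, he] using hu
      · intro u _ v _ h; exact Subtype.ext (by simpa using h)
      · intro b hb
        simp only [mem_filter] at hb
        have hb1 : φ b = 1 := (zmod2_cases _).resolve_left hb.2
        refine ⟨⟨b + e, ?_⟩, ?_, ?_⟩
        · rw [hK, LinearMap.mem_ker, map_add, hb1, he]; decide
        · simpa [A0, add_assoc, h2] using hb.1
        · simp [add_assoc, h2]
    rw [s1, s2, Finset.card_filter_add_card_filter_not]
  rw [← hTimg, sum_image (fun x _ y _ h => hι h), Finset.sum_congr rfl (fun h _ => hw h),
    Finset.sum_add_distrib]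
  have b1 := hB T' (A0 0) (hval 0) hcard
  have b2 := hB T' (A0 e) (hval e) hcard
  omega

theorem sum_const_le {T : Finset E} {A : E → Finset E} {k : ℕ} (h : ∀ a ∈ T, (A a).card ≤ k) :
    ∑ a ∈ T, (A a).card ≤ T.card * k := by
  have := Finset.sum_le_card_nsmul T (fun a => (A a).card) k h
  simpa using this

/-- coloop case -/
theorem coloop_bound {n : ℕ} (hn : finrank (ZMod 2) E = n + 1)
    {T : Finset E} {A : E → Finset E} (hV : Valid T A) {a : E} (ha : a ∈ T)
    (ht : 2 ≤ T.card)
    (φ : E →ₗ[ZMod 2] ZMod 2) (hφ : ∀ b ∈ T, b ≠ a → φ (b + a) = 1) (B : ℕ)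
    (hB : ∀ (F : Type) [AddCommGroup F] [Module (ZMod 2) F] [Fintype F] [DecidableEq F],
      finrank (ZMod 2) F = n → ∀ (T' : Finset F) (A' : F → Finset F),
      Valid T' A' → ∑ a ∈ T', (A' a).card ≤ B) :
    ∑ b ∈ T, (A b).card ≤ 2 ^ n + 2 * B := by
  obtain ⟨b, hb, hab⟩ := Finset.exists_mem_ne (s := T) (by omega) a
  have hφ0 : φ ≠ 0 := by
    rintro rfl
    simpa using hφ b hb hab
  have hT : T.filter (fun x => φ x = φ b) = T.erase a := by
    ext x
    simp only [mem_filter, mem_erase]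
    have e1 := hφ b hb hab
    rw [map_add] at e1
    constructor
    · rintro ⟨hx, h⟩
      refine ⟨?_, hx⟩
      rintro rfl
      rw [h, h2] at e1
      exact absurd e1 (by decide)
    · rintro ⟨hx, h⟩
      refine ⟨h, ?_⟩
      have e3 := hφ x h hx
      rw [map_add] at e3
      exact add_right_cancel (e3.trans e1.symm)
  classical
  have h1 := half hV φ hφ0 b B (fun T' A' h _ => by
    have : Fintype (LinearMap.ker φ) := Fintype.ofFinite _
    exact hB _ (finrank_ker hn φ hφ0) T' A' h)
  rw [hT] at h1
  have h3 := w_le_half hV ha ht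
  rw [card_E hn] at h3
  rw [← Finset.add_sum_erase T _ ha]
  have : 2 ^ (n + 1) = 2 ^ n * 2 := pow_succ 2 n
  omega

end Basics


section Structure

variable {E : Type} [AddCommGroup E] [Module (ZMod 2) E] [Fintype E] [DecidableEq E]

theorem not_plane_card {T : Finset E} {a : E} (ha : a ∈ T) (hp : ¬ Plane T a) :
    2 * T.card ≤ 2 + Fintype.card E := by
  by_cases ht : T.card ≤ 1
  · omega
  obtain ⟨b, hb, hab⟩ := Finset.exists_mem_ne (s := T) (by omega) a
  have hd : Disjoint (T.erase a) ((T.erase a).image (· + (b + a))) := by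
    rw [Finset.disjoint_left]
    intro c hc hc'
    obtain ⟨d, hd, rfl⟩ := mem_image.1 hc'
    simp only [mem_erase] at hc hd
    apply hp
    refine ⟨d + b + a + a, d + a, ?_, ?_, ?_, ?_, ?_, ?_⟩
    · grind [h2 a, h2 d, h2 b]
    · grind [h2 a, h2 d, h2 b]
    · grind [h2 a, h2 d, h2 b]
    · grind [h2 a, h2 d, h2 b]
    · grind [h2 a, h2 d, h2 b]
    · grind [h2 a, h2 d, h2 b]
  have h1 := Finset.card_le_univ ((T.erase a) ∪ ((T.erase a).image (· + (b + a))))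
  rw [card_union_of_disjoint hd, card_image_of_injective _ (add_left_injective _),
    card_erase_of_mem ha] at h1
  omega

/-- a five point circuit with `a` inside `T` -/
def Frame (T : Finset E) (a : E) : Prop :=
  ∃ (W : Submodule (ZMod 2) E) (P : Finset E), finrank (ZMod 2) W = 4 ∧ P.card = 5 ∧ 0 ∉ P ∧
    ∑ p ∈ P, p = 0 ∧ (∀ p ∈ P, p ∈ W) ∧ ∀ p ∈ P, a + p ∈ T

theorem tricho (hn : finrank (ZMod 2) E ≤ 5) {T : Finset E} {a : E} (ha : a ∈ T)
    (hp : ¬ Plane T a) :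
    (∃ φ : E →ₗ[ZMod 2] ZMod 2, ∀ b ∈ T, b ≠ a → φ (b + a) = 1) ∨ Frame T a := by
  classical
  by_contra hcon
  push Not at hcon
  obtain ⟨hφ, hF⟩ := hcon
  obtain ⟨s, hsX, hspan, hli⟩ := exists_linearIndependent (ZMod 2) {u : E | u ≠ 0 ∧ a + u ∈ T}
  have hli' : LinearIndepOn (ZMod 2) id s := hli
  let bas := Basis.extend hli'
  let φ : E →ₗ[ZMod 2] ZMod 2 := bas.constr (ZMod 2) (fun _ => (1 : ZMod 2))
  have hφ1 : ∀ u ∈ s, φ u = 1 := by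
    intro u hu
    have hm : u ∈ hli'.extend (Set.subset_univ s) := hli'.subset_extend _ hu
    have := bas.constr_basis (ZMod 2) (fun _ => (1 : ZMod 2)) ⟨u, hm⟩
    rwa [Basis.extend_apply_self] at this
  obtain ⟨b, hb, hba, hφb⟩ := hφ φ
  have hφb0 : φ (b + a) = 0 := (zmod2_cases _).resolve_right hφb
  have hv : b + a ∈ Submodule.span (ZMod 2) s := by
    rw [hspan]
    apply Submodule.subset_span
    refine ⟨fun h => hba (add_eq_zero2.1 h), ?_⟩
    have : a + (b + a) = b := by grind [h2 a]
    rwa [this]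
  rw [Submodule.mem_span_iff_exists_finset_subset] at hv
  obtain ⟨f, t, hts, -, hsum⟩ := hv
  set I := t.filter (fun u => f u = 1) with hI
  have hIs : ∀ u ∈ I, u ∈ s := fun u hu => hts (by simpa using (mem_filter.1 hu).1)
  have hIsum : ∑ u ∈ I, u = b + a := by
    rw [← hsum, hI, Finset.sum_filter]
    apply Finset.sum_congr rfl
    intro u _
    rcases zmod2_cases (f u) with h | h <;> simp [h]
  have hIcard : (I.card : ZMod 2) = 0 := by
    rw [← hφb0, ← hIsum, map_sum, Finset.sum_congr rfl (fun u hu => hφ1 u (hIs u hu))]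
    simp
  have hIli : LinearIndependent (ZMod 2) (fun x : I => (x : E)) :=
    hli'.mono (fun u hu => hIs u hu)
  have hI5 : I.card ≤ 5 := by
    have := hIli.fintype_card_le_finrank
    simp at this; omega
  have heven : Even I.card := (ZMod.natCast_eq_zero_iff_even).1 hIcard
  have hcases : I.card = 0 ∨ I.card = 2 ∨ I.card = 4 := by
    obtain ⟨k, hk⟩ := heven; omega
  have hab : a + (b + a) = b := by grind [h2 a]
  have hva0 : b + a ≠ 0 := fun h => hba (add_eq_zero2.1 h)
  rcases hcases with h | h | h
  · rw [Finset.card_eq_zero] at h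
    rw [h] at hIsum; simp at hIsum
    exact hva0 hIsum.symm
  · obtain ⟨u, v, huv, hIe⟩ := Finset.card_eq_two.1 h
    rw [hIe, Finset.sum_pair huv] at hIsum
    have hu := hsX (hIs u (by simp [hIe]))
    have hv := hsX (hIs v (by simp [hIe]))
    apply hp
    refine ⟨u, v, hu.1, hv.1, huv, hu.2, hv.2, ?_⟩
    rw [add_assoc, hIsum, hab]; exact hb
  · apply hF
    have hnot : b + a ∉ I := by
      intro hm
      have := hφ1 _ (hIs _ hm)
      rw [hφb0] at this; exact absurd this (by decide)
    refine ⟨Submodule.span (ZMod 2) (I : Set E), insert (b + a) I, ?_, ?_, ?_, ?_, ?_, ?_⟩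
    · rw [finrank_span_finset_eq_card hIli, h]
    · rw [card_insert_of_notMem hnot, h]
    · intro hm
      rcases mem_insert.1 hm with h' | h'
      · exact hva0 h'.symm
      · exact (hsX (hIs _ h')).1 rfl
    · rw [sum_insert hnot, hIsum, h2]
    · intro p hp'
      rcases mem_insert.1 hp' with rfl | h'
      · rw [← hIsum]
        exact Submodule.sum_mem _ (fun u hu => Submodule.subset_span (by simpa using hu))
      · exact Submodule.subset_span (by simpa using h')
    · intro p hp'
      rcases mem_insert.1 hp' with rfl | h'
      · rwa [hab]
      · exact (hsX (hIs _ h')).2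

def Sidon (X : Finset E) : Prop :=
  ∀ x ∈ X, ∀ y ∈ X, ∀ z ∈ X, ∀ w ∈ X, x ≠ y → x + y = z + w → (z = x ∧ w = y) ∨ (z = y ∧ w = x)

theorem span3 (d e f : E) (h1 : d ≠ 0) (h2' : e ≠ 0) (h3 : d ≠ e) (h4 : f ≠ 0) (h5 : f ≠ d)
    (h6 : f ≠ e) (h7 : f ≠ d + e) :
    ∃ V : Submodule (ZMod 2) E, finrank (ZMod 2) V = 3 ∧ ∀ v ∈ V, v = 0 ∨ v = d ∨ v = e ∨
      v = d + e ∨ v = f ∨ v = f + d ∨ v = f + e ∨ v = f + d + e := by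
  refine ⟨Submodule.span (ZMod 2) (Set.range ![d, e, f]), ?_, ?_⟩
  · rw [finrank_span_eq_card]
    · simp
    · rw [Fintype.linearIndependent_iff]
      intro g hg
      replace hg : g 0 • d + g 1 • e + g 2 • f = 0 := by
        simpa [Fin.sum_univ_three] using hg
      have e0 := zmod2_cases (g 0)
      have e1 := zmod2_cases (g 1)
      have e2 := zmod2_cases (g 2)
      have hh : g 0 = 0 ∧ g 1 = 0 ∧ g 2 = 0 := by
        rcases e0 with a0 | a0 <;> rcases e1 with a1 | a1 <;> rcases e2 with a2 | a2 <;>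
          rw [a0, a1, a2] at hg ⊢ <;> simp only [zero_smul, one_smul, zero_add, add_zero] at hg <;>
          first
          | simp; done
          | (exfalso; grind [h2 d, h2 e, h2 f])
      intro i; fin_cases i
      · exact hh.1
      · exact hh.2.1
      · exact hh.2.2
  · intro v hv
    rw [Submodule.mem_span_range_iff_exists_fun] at hv
    obtain ⟨c, hc⟩ := hv
    replace hc : c 0 • d + c 1 • e + c 2 • f = v := by
      simpa [Fin.sum_univ_three] using hc
    have e0 := zmod2_cases (c 0)
    have e1 := zmod2_cases (c 1)
    have e2 := zmod2_cases (c 2)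
    rcases e0 with a0 | a0 <;> rcases e1 with a1 | a1 <;> rcases e2 with a2 | a2 <;>
      rw [a0, a1, a2] at hc <;> simp only [zero_smul, one_smul, zero_add, add_zero] at hc <;>
      grind

theorem fact2 {X : Finset E} (hX : 5 ≤ X.card) (hS : ¬ Sidon X) :
    ∃ V : Submodule (ZMod 2) E, finrank (ZMod 2) V = 3 ∧ ∀ v ∈ V, v ≠ 0 →
      ∃ x ∈ X, ∃ y ∈ X, x ≠ y ∧ x + y = v := by
  unfold Sidon at hS
  push Not at hS
  obtain ⟨x, hx, y, hy, z, hz, w, hw, hxy, hs, hne1, hne2⟩ := hS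
  have hzx : z ≠ x := by
    intro h; apply hne1 h; subst h; exact (add_left_cancel hs).symm
  have hzy : z ≠ y := by
    intro h; apply hne2 h; subst h; rw [add_comm] at hs; exact (add_left_cancel hs).symm
  have hwy : w ≠ y := by
    intro h; subst h; exact hzx (add_right_cancel hs).symm
  have hwx : w ≠ x := by
    intro h; subst h; rw [add_comm] at hs; exact hzy (add_right_cancel hs).symm
  have hzw : z ≠ w := by
    intro h; subst h; rw [h2] at hs; exact hxy (add_eq_zero2.1 hs)
  obtain ⟨t, ht, hnot⟩ : ∃ t ∈ X, t ∉ ({x, y, z, w} : Finset E) := by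
    apply Finset.exists_mem_notMem_of_card_lt_card
    exact lt_of_le_of_lt Finset.card_le_four (by omega)
  simp only [mem_insert, mem_singleton, not_or] at hnot
  obtain ⟨n1, n2, n3, n4⟩ := hnot
  have ex := h2 x
  have ey := h2 y
  have ez := h2 z
  have ew := h2 w
  have et := h2 t
  obtain ⟨V, hV, hVm⟩ := span3 (x + y) (x + z) (x + t) (by grind) (by grind) (by grind) (by grind)
    (by grind) (by grind) (by grind)
  refine ⟨V, hV, fun v hv hv0 => ?_⟩
  rcases hVm v hv with h | h | h | h | h | h | h | h
  · exact absurd h hv0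
  · exact ⟨x, hx, y, hy, hxy, h.symm⟩
  · exact ⟨x, hx, z, hz, hzx.symm, h.symm⟩
  · exact ⟨y, hy, z, hz, hzy.symm, by grind⟩
  · exact ⟨x, hx, t, ht, Ne.symm n1, h.symm⟩
  · exact ⟨y, hy, t, ht, Ne.symm n2, by grind⟩
  · exact ⟨z, hz, t, ht, Ne.symm n3, by grind⟩
  · exact ⟨w, hw, t, ht, Ne.symm n4, by grind⟩

theorem sidon_count {X Y : Finset E} (hS : Sidon X)
    (hY : ∀ x ∈ X, ∀ y ∈ X, x ≠ y → x + y ∈ Y) : X.card * X.card - X.card ≤ 2 * Y.card := by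
  rw [← Finset.offDiag_card]
  have h1 : (X.offDiag.image (fun p => p.1 + p.2)).card ≤ Y.card := by
    apply Finset.card_le_card
    intro v hv
    obtain ⟨⟨x, y⟩, hp, rfl⟩ := mem_image.1 hv
    rw [mem_offDiag] at hp
    exact hY x hp.1 y hp.2.1 hp.2.2
  have h3 := Finset.card_le_mul_card_image (f := fun p : E × E => p.1 + p.2) X.offDiag 2 (by
    intro v hv
    obtain ⟨⟨x, y⟩, hp, rfl⟩ := mem_image.1 hv
    rw [mem_offDiag] at hp
    calc _ ≤ ({(x, y), (y, x)} : Finset (E × E)).card := by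
          apply Finset.card_le_card
          rintro ⟨z, w⟩ hq
          rw [mem_filter, mem_offDiag] at hq
          rcases hS x hp.1 y hp.2.1 z hq.1.1 w hq.1.2.1 hp.2.2 hq.2.symm with h | h <;>
            simp [h.1, h.2]
      _ ≤ 2 := Finset.card_le_two)
  omega

/-- separating a hyperplane of a subspace -/
theorem sep_of_lt {V W : Submodule (ZMod 2) E} {k : ℕ} (hVW : V ≤ W)
    (hV : finrank (ZMod 2) V = k) (hW : finrank (ZMod 2) W = k + 1) :
    ∃ ψ : E →ₗ[ZMod 2] ZMod 2, ∀ w ∈ W, (ψ w = 0 ↔ w ∈ V) := by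
  have hne : ¬ W ≤ V := fun h => by
    have := Submodule.finrank_mono h; omega
  obtain ⟨w, hw, hwV⟩ := SetLike.not_le_iff_exists.1 hne
  obtain ⟨ψ, hψw, hψV⟩ := Submodule.exists_le_ker_of_notMem hwV
  refine ⟨ψ, ?_⟩
  have hle : V ≤ W ⊓ LinearMap.ker ψ := le_inf hVW hψV
  have hlt : W ⊓ LinearMap.ker ψ < W := by
    refine lt_of_le_of_ne inf_le_left (fun h => hψw ?_)
    rw [← h] at hw
    exact hw.2
  have h1 := Submodule.finrank_lt_finrank_of_lt hlt
  have heq : V = W ⊓ LinearMap.ker ψ := by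
    apply Submodule.eq_of_le_of_finrank_le hle; omega
  intro u hu
  constructor
  · intro h; rw [heq]; exact ⟨hu, h⟩
  · intro h; exact hψV h

theorem clebsch {W : Submodule (ZMod 2) E} {P X : Finset E} (hW : finrank (ZMod 2) W = 4)
    (hP : P.card = 5) (h0 : 0 ∉ P) (hsum : ∑ p ∈ P, p = 0) (hPW : ∀ p ∈ P, p ∈ W)
    (hX : ∀ x ∈ X, ∀ y ∈ X, x ≠ y → x + y ∈ W ∧ x + y ∉ P) : X.card ≤ 5 := by
  classical
  by_contra hc
  by_cases hS : Sidon X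
  · have hcW : (univ.filter (· ∈ W)).card = 16 := by
      have := card_sub W hW
      rw [Nat.card_eq_fintype_card, Fintype.card_subtype] at this
      exact this
    have hsub : insert 0 P ⊆ univ.filter (· ∈ W) := by
      intro p hp
      rcases mem_insert.1 hp with rfl | h
      · simp
      · simp [hPW p h]
    have := sidon_count (Y := univ.filter (· ∈ W) \ insert 0 P) hS (by
      intro x hx y hy hxy
      have h1 := hX x hx y hy hxy
      simp only [mem_sdiff, mem_filter, mem_univ, true_and, mem_insert, not_or]
      exact ⟨h1.1, fun h => hxy (add_eq_zero2.1 h), h1.2⟩)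
    rw [card_sdiff_of_subset hsub, hcW, card_insert_of_notMem h0, hP] at this
    have h6 : 6 ≤ X.card := by omega
    have : X.card * X.card ≥ 6 * X.card := Nat.mul_le_mul_right _ h6
    omega
  · obtain ⟨V, hV, hVm⟩ := fact2 (by omega) hS
    have hle : V ≤ W := by
      intro v hv
      by_cases hv0 : v = 0
      · simp [hv0]
      · obtain ⟨x, hx, y, hy, hxy, rfl⟩ := hVm v hv hv0
        exact (hX x hx y hy hxy).1
    obtain ⟨ψ, hψ⟩ := sep_of_lt hle hV hW
    have hψP : ∀ p ∈ P, ψ p = 1 := by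
      intro p hp
      refine (zmod2_cases _).resolve_left (fun h => ?_)
      have hpV := (hψ p (hPW p hp)).1 h
      obtain ⟨x, hx, y, hy, hxy, rfl⟩ := hVm p hpV (fun h => h0 (h ▸ hp))
      exact (hX x hx y hy hxy).2 hp
    have := congrArg ψ hsum
    rw [map_sum, Finset.sum_congr rfl hψP] at this
    simp [hP] at this
    exact absurd this (by decide)

def Good (T : Finset E) (a : E) : Prop :=
  ∃ V : Submodule (ZMod 2) E, finrank (ZMod 2) V = 3 ∧ ∀ v ∈ V, v ≠ 0 → a + v ∉ T

theorem not_good_sidon {T : Finset E} {A : E → Finset E} (hV : Valid T A) {a : E} (ha : a ∈ T)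
    (hg : ¬ Good T a) (h5 : 5 ≤ (A a).card) : Sidon (A a) := by
  by_contra hS
  obtain ⟨V, hV3, hVm⟩ := fact2 h5 hS
  refine hg ⟨V, hV3, fun v hv hv0 => ?_⟩
  obtain ⟨x, hx, y, hy, hxy, rfl⟩ := hVm v hv hv0
  rw [← add_assoc]
  exact hV a ha x hx y hy hxy

theorem not_good_count {T : Finset E} {A : E → Finset E} (hV : Valid T A) {a : E} (ha : a ∈ T)
    (hS : Sidon (A a)) :
    (A a).card * (A a).card - (A a).card ≤ 2 * (Fintype.card E - T.card) := by
  have := sidon_count (Y := (univ \ T).image (a + ·)) hS (by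
    intro x hx y hy hxy
    rw [mem_image]
    refine ⟨a + x + y, by simpa using hV a ha x hx y hy hxy, ?_⟩
    grind [h2 a])
  rwa [card_image_of_injective _ (add_right_injective a), card_sdiff_of_subset (subset_univ _),
    Finset.card_univ] at this

/-- a point lying on a frame and on no plane -/
theorem frame_w {T : Finset E} {A : E → Finset E} (hV : Valid T A) {a : E} (ha : a ∈ T)
    {W : Submodule (ZMod 2) E} {P : Finset E} (hW : finrank (ZMod 2) W = 4)
    (hP : P.card = 5) (h0 : 0 ∉ P) (hsum : ∑ p ∈ P, p = 0) (hPW : ∀ p ∈ P, p ∈ W)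
    (hPT : ∀ p ∈ P, a + p ∈ T) (X : Finset E) (hXA : X ⊆ A a)
    (hX : ∀ x ∈ X, ∀ y ∈ X, x + y ∈ W) : X.card ≤ 5 := by
  refine clebsch hW hP h0 hsum hPW (fun x hx y hy hxy => ⟨hX x hx y hy, fun h => ?_⟩)
  have := hV a ha x (hXA hx) y (hXA hy) hxy
  rw [add_assoc] at this
  exact this (hPT _ h)

theorem frame_t {T : Finset E} {a : E}
    (hp : ¬ Plane T a)
    {W : Submodule (ZMod 2) E} {P : Finset E} (hW : finrank (ZMod 2) W = 4)
    (hP : P.card = 5) (h0 : 0 ∉ P) (hsum : ∑ p ∈ P, p = 0) (hPW : ∀ p ∈ P, p ∈ W)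
    (hPT : ∀ p ∈ P, a + p ∈ T) (X : Finset E) (hXT : X ⊆ T.erase a)
    (hX : ∀ x ∈ X, ∀ y ∈ X, x + y ∈ W) : X.card ≤ 5 := by
  refine clebsch hW hP h0 hsum hPW (fun x hx y hy hxy => ⟨hX x hx y hy, fun h => ?_⟩)
  apply hp
  have hx' := mem_erase.1 (hXT hx)
  have hy' := mem_erase.1 (hXT hy)
  have h3 := hPT _ h
  have ea := h2 a
  have ex := h2 x
  have ey := h2 y
  exact ⟨x + a, y + a, by grind, by grind, by grind, by grind, by grind, by grind⟩

end Structure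


section Small

variable {E : Type} [AddCommGroup E] [Module (ZMod 2) E] [Fintype E] [DecidableEq E]

theorem bound_le_one {T : Finset E} (A : E → Finset E) (ht : T.card ≤ 1) :
    ∑ a ∈ T, (A a).card ≤ Fintype.card E := by
  have h := sum_const_le (T := T) (A := A) (k := Fintype.card E) (fun a _ => Finset.card_le_univ _)
  exact h.trans (by nlinarith [Fintype.card E |>.zero_le])

theorem bound_univ {T : Finset E} {A : E → Finset E} (hV : Valid T A)
    (ht : T.card = Fintype.card E) : ∑ a ∈ T, (A a).card ≤ Fintype.card E := by
  have hu : T = univ := Finset.card_eq_iff_eq_univ T |>.1 ht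
  have h := sum_const_le (T := T) (A := A) (k := 1) (fun a ha => w_le_univ hV ha hu)
  omega

theorem bound1 (hn : finrank (ZMod 2) E = 1) (T : Finset E) (A : E → Finset E) (hV : Valid T A) :
    ∑ a ∈ T, (A a).card ≤ 2 := by
  have hE := card_E hn
  have htE := Finset.card_le_univ T
  rcases Nat.lt_or_ge T.card 2 with ht | ht
  · have := bound_le_one A (T := T) (by omega)
    omega
  · have := bound_univ hV (by omega)
    omega

theorem bound2 (hn : finrank (ZMod 2) E = 2) (T : Finset E) (A : E → Finset E) (hV : Valid T A) :
    ∑ a ∈ T, (A a).card ≤ 6 := by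
  have hE := card_E hn
  have htE := Finset.card_le_univ T
  rcases Nat.lt_or_ge T.card 2 with ht | ht
  · have := bound_le_one A (T := T) (by omega)
    omega
  · by_cases h4 : T.card = 4
    · have := bound_univ hV (by omega)
      omega
    · have := sum_const_le (T := T) (A := A) (k := 2)
        (fun a ha => by have := w_le_half hV ha ht; omega)
      omega

theorem bound3 (hn : finrank (ZMod 2) E = 3) (T : Finset E) (A : E → Finset E) (hV : Valid T A) :
    ∑ a ∈ T, (A a).card ≤ 16 := by
  have hE := card_E hn
  have htE := Finset.card_le_univ T
  rcases Nat.lt_or_ge T.card 2 with ht | ht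
  · have := bound_le_one A (T := T) (by omega)
    omega
  rcases Nat.lt_or_ge T.card 5 with ht5 | ht5
  · have := sum_const_le (T := T) (A := A) (k := 4)
      (fun a ha => by have := w_le_half hV ha ht; omega)
    omega
  by_cases hp : ∀ a ∈ T, Plane T a
  · have := sum_const_le (T := T) (A := A) (k := 2)
      (fun a ha => by have := w_le_plane hV ha (hp a ha); omega)
    omega
  · push Not at hp
    obtain ⟨a, ha, hpa⟩ := hp
    rcases tricho (by omega) ha hpa with ⟨φ, hφ⟩ | ⟨W, P, hW, -⟩
    · have := coloop_bound (n := 2) hn hV ha ht φ hφ 6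
        (fun F _ _ _ _ hF T' A' hv => bound2 hF T' A' hv)
      omega
    · have := Submodule.finrank_le W
      omega

theorem w3_count {T : Finset E} {A : E → Finset E} (hV : Valid T A) :
    (T.filter (fun a => 3 ≤ (A a).card)).card ≤ (Fintype.card E - T.card).choose 3 := by
  have h1 : T.filter (fun a => 3 ≤ (A a).card) ⊆
      (powersetCard 3 (univ \ T)).image (fun s => ∑ x ∈ s, x) := by
    intro a ha
    rw [mem_filter] at ha
    obtain ⟨s, hs, hs3⟩ := Finset.exists_subset_card_eq ha.2
    obtain ⟨x, y, z, hxy, hxz, hyz, rfl⟩ := Finset.card_eq_three.1 hs3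
    have hx : x ∈ A a := hs (by simp)
    have hy : y ∈ A a := hs (by simp)
    have hz : z ∈ A a := hs (by simp)
    have n1 : a + x + y ≠ a + x + z := fun h => hyz (by simpa using h)
    have n2 : a + x + y ≠ a + y + z := fun h => hxz (by grind)
    have n3 : a + x + z ≠ a + y + z := fun h => hxy (by simpa using h)
    rw [mem_image]
    refine ⟨{a + x + y, a + x + z, a + y + z}, ?_, ?_⟩
    · rw [mem_powersetCard]
      refine ⟨?_, Finset.card_eq_three.2 ⟨_, _, _, n1, n2, n3, rfl⟩⟩
      intro u hu
      simp only [mem_insert, mem_singleton] at hu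
      simp only [mem_sdiff, mem_univ, true_and]
      rcases hu with rfl | rfl | rfl
      · exact hV a ha.1 x hx y hy hxy
      · exact hV a ha.1 x hx z hz hxz
      · exact hV a ha.1 y hy z hz hyz
    · rw [sum_insert (by simp [n1, n2]), sum_insert (by simp [n3]), sum_singleton]
      grind [h2 a, h2 x, h2 y, h2 z]
  have h3 := (Finset.card_le_card h1).trans Finset.card_image_le
  rwa [card_powersetCard, card_sdiff_of_subset (subset_univ _), Finset.card_univ] at h3

theorem sum_two_level {T : Finset E} {A : E → Finset E} (p q : ℕ) (Q : E → Prop) [DecidablePred Q]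
    (h1 : ∀ a ∈ T, (A a).card ≤ p + q) (h3 : ∀ a ∈ T, ¬ Q a → (A a).card ≤ p) :
    ∑ a ∈ T, (A a).card ≤ p * T.card + q * (T.filter Q).card := by
  calc ∑ a ∈ T, (A a).card ≤ ∑ a ∈ T, (p + if Q a then q else 0) := by
        apply Finset.sum_le_sum
        intro a ha
        split_ifs with h
        · exact h1 a ha
        · exact h3 a ha h
    _ = _ := by
        rw [Finset.sum_add_distrib, ← Finset.sum_filter]
        simp [mul_comm]

theorem bound4_aux (hn : finrank (ZMod 2) E = 4) (T : Finset E) (A : E → Finset E)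
    (hV : Valid T A) (ht : 11 ≤ T.card) :
    ∑ a ∈ T, (A a).card ≤ 2 * T.card + 2 * (16 - T.card).choose 3 := by
  have hE := card_E hn
  have h1 := w3_count hV
  have h3 := sum_two_level (T := T) (A := A) 2 2 (fun a => 3 ≤ (A a).card) (by
    intro a ha
    by_cases hp : Plane T a
    · have := w_le_plane hV ha hp; omega
    · have := not_plane_card ha hp; omega) (by intro a _ h; omega)
  rw [hE] at h1
  norm_num at h1
  omega

theorem bound4_big (hn : finrank (ZMod 2) E = 4) (T : Finset E) (A : E → Finset E)
    (hV : Valid T A) (ht : 12 ≤ T.card) : ∑ a ∈ T, (A a).card ≤ 32 := by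
  have hE := card_E hn
  have htE := Finset.card_le_univ T
  rw [hE] at htE
  have h := bound4_aux hn T A hV (by omega)
  generalize T.card = t at *
  norm_num at htE
  interval_cases t <;> simp [Nat.choose] at h <;> omega

theorem bound4 (hn : finrank (ZMod 2) E = 4) (T : Finset E) (A : E → Finset E) (hV : Valid T A) :
    ∑ a ∈ T, (A a).card ≤ 42 := by
  have hE := card_E hn
  have htE := Finset.card_le_univ T
  rcases Nat.lt_or_ge T.card 2 with ht | ht
  · have := bound_le_one A (T := T) (by omega)
    omega
  rcases Nat.lt_or_ge T.card 6 with ht5 | ht5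
  · have := sum_const_le (T := T) (A := A) (k := 8)
      (fun a ha => by have := w_le_half hV ha ht; omega)
    omega
  rcases Nat.lt_or_ge T.card 11 with ht10 | ht10
  · by_cases hcol : ∃ a ∈ T, ∃ φ : E →ₗ[ZMod 2] ZMod 2, ∀ b ∈ T, b ≠ a → φ (b + a) = 1
    · obtain ⟨a, ha, φ, hφ⟩ := hcol
      have := coloop_bound (n := 3) hn hV ha ht φ hφ 16
        (fun F _ _ _ _ hF T' A' hv => bound3 hF T' A' hv)
      omega
    by_cases hp : ∀ a ∈ T, Plane T a
    · have := sum_const_le (T := T) (A := A) (k := 4)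
        (fun a ha => by have := w_le_plane hV ha (hp a ha); omega)
      omega
    · have hw : ∀ a ∈ T, (A a).card ≤ 5 := by
        intro a ha
        by_cases hpa : Plane T a
        · have := w_le_plane hV ha hpa; omega
        · rcases tricho (by omega) ha hpa with h | ⟨W, P, hW, hP, h0, hs, hPW, hPT⟩
          · exact absurd ⟨a, ha, h⟩ hcol
          · have hWt : W = ⊤ := Submodule.eq_top_of_finrank_eq (by omega)
            exact frame_w hV ha hW hP h0 hs hPW hPT (A a) subset_rfl (by simp [hWt])
      push Not at hp
      obtain ⟨a, ha, hpa⟩ := hp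
      rcases tricho (by omega) ha hpa with h | ⟨W, P, hW, hP, h0, hs, hPW, hPT⟩
      · exact absurd ⟨a, ha, h⟩ hcol
      · have hWt : W = ⊤ := Submodule.eq_top_of_finrank_eq (by omega)
        have := frame_t hpa hW hP h0 hs hPW hPT (T.erase a) subset_rfl (by simp [hWt])
        rw [card_erase_of_mem ha] at this
        have := sum_const_le hw
        omega
  · rcases Nat.lt_or_ge T.card 12 with h | h
    · have h1 := bound4_aux hn T A hV ht10
      have h11 : T.card = 11 := by omega
      rw [h11] at h1
      simp [Nat.choose] at h1
      omega
    · have := bound4_big hn T A hV h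
      omega

end Small


section LemmaA

open scoped Classical

variable {E : Type} [AddCommGroup E] [Module (ZMod 2) E] [Fintype E]

noncomputable def ind (p : Prop) : ZMod 2 := if p then 1 else 0

structure Cfg (C G : Finset E) (V : E → Submodule (ZMod 2) E) : Prop where
  fr5 : finrank (ZMod 2) E = 5
  disj : ∀ a ∈ G, a ∉ C
  fr : ∀ a ∈ G, finrank (ZMod 2) (V a) = 3
  cov : ∀ a ∈ G, ∀ v ∈ V a, v ≠ 0 → a + v ∈ C
  card : G.card = C.card

theorem inf_ne_bot (h5 : finrank (ZMod 2) E = 5) (U V : Submodule (ZMod 2) E)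
    (hU : finrank (ZMod 2) U = 3) (hV : finrank (ZMod 2) V = 3) :
    1 ≤ finrank (ZMod 2) (U ⊓ V : Submodule (ZMod 2) E) ∧ ∃ d ∈ U, d ∈ V ∧ d ≠ 0 := by
  have h1 := Submodule.finrank_sup_add_finrank_inf_eq U V
  have h3 := Submodule.finrank_le (U ⊔ V)
  have h4 : 1 ≤ finrank (ZMod 2) (U ⊓ V : Submodule (ZMod 2) E) := by omega
  refine ⟨h4, ?_⟩
  have hne : U ⊓ V ≠ ⊥ := by
    intro h; rw [h] at h4; simp at h4
  obtain ⟨d, hd, hd0⟩ := Submodule.exists_mem_ne_zero_of_ne_bot hne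
  exact ⟨d, hd.1, hd.2, hd0⟩

theorem even_flats (h5 : finrank (ZMod 2) E = 5) (U V : Submodule (ZMod 2) E)
    (hU : finrank (ZMod 2) U = 3) (hV : finrank (ZMod 2) V = 3) (p q : E) :
    ∑ x : E, ind (p + x ∈ U) * ind (q + x ∈ V) = 0 := by
  obtain ⟨-, d, hdU, hdV, hd0⟩ := inf_ne_bot h5 U V hU hV
  have k1 : ∀ x, p + (x + d) ∈ U ↔ p + x ∈ U := fun x => by
    rw [← add_assoc]; exact U.add_mem_iff_left hdU
  have k2 : ∀ x, q + (x + d) ∈ V ↔ q + x ∈ V := fun x => by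
    rw [← add_assoc]; exact V.add_mem_iff_left hdV
  apply Finset.sum_involution (fun x _ => x + d)
  · intro x _
    simp only [k1, k2]
    exact h2 _
  · intro x _ _ h
    exact hd0 (by simpa using h)
  · intro x _; simp
  · intro x _; simp [add_assoc, h2]

theorem ind_mul (p q : Prop) : ind p * ind q = ind (p ∧ q) := by
  unfold ind; by_cases hp : p <;> by_cases hq : q <;> simp [hp, hq]

theorem sum_ind (s : Finset E) (p : E → Prop) :
    ∑ x ∈ s, ind (p x) = ((s.filter p).card : ZMod 2) := by
  unfold ind; simp

variable {C G : Finset E} {V : E → Submodule (ZMod 2) E}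

theorem Cfg.flat (h : Cfg C G V) {b : E} (hb : b ∈ G) {y : E} (hy : b + y ∈ V b) (hyb : y ≠ b) :
    y ∈ C := by
  have := h.cov b hb (b + y) hy (fun h0 => hyb (add_eq_zero2.1 h0).symm)
  rwa [← add_assoc, h2, zero_add] at this

theorem Cfg.L1 (h : Cfg C G V) {b : E} (hb : b ∈ G) (q : E) (U : Submodule (ZMod 2) E)
    (hU : finrank (ZMod 2) U = 3) :
    ∑ y ∈ C, ind (b + y ∈ V b) * ind (q + y ∈ U) = ind (q + b ∈ U) := by
  have h1 := even_flats h.fr5 (V b) U (h.fr b hb) hU b q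
  have h3 : ∑ x : E, ind (b + x ∈ V b) * ind (q + x ∈ U) =
      ∑ x ∈ insert b C, ind (b + x ∈ V b) * ind (q + x ∈ U) := by
    symm
    apply Finset.sum_subset (subset_univ _)
    intro x _ hx
    rw [mem_insert, not_or] at hx
    have : ¬ b + x ∈ V b := fun hm => hx.2 (h.flat hb hm hx.1)
    simp [ind, this]
  rw [h3, sum_insert (h.disj b hb), h2] at h1
  have : ind ((0 : E) ∈ V b) = 1 := by simp [ind]
  rw [this, one_mul] at h1
  exact (add_eq_zero2.1 h1).symm

theorem Cfg.ortho (h : Cfg C G V) {x y : E} (hx : x ∈ C) (hy : y ∈ C) :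
    ∑ b ∈ G, ind (b + x ∈ V b) * ind (b + y ∈ V b) = ind (x = y) := by
  let M : Matrix C G (ZMod 2) := fun x b => ind ((b : E) + x ∈ V b)
  have hM : M.transpose * M = 1 := by
    ext a b
    rw [Matrix.mul_apply]
    have h1 := h.L1 b.2 (a : E) (V a) (h.fr a a.2)
    have h3 : ∑ j : C, M.transpose a j * M j b =
        ∑ y ∈ C, ind ((b : E) + y ∈ V b) * ind ((a : E) + y ∈ V a) := by
      rw [← Finset.sum_coe_sort C]
      apply Finset.sum_congr rfl
      intro j _
      rw [Matrix.transpose_apply, mul_comm]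
    rw [h3, h1, Matrix.one_apply]
    unfold ind
    congr 1
    apply propext
    constructor
    · intro hm
      by_contra hne
      exact h.disj b b.2 (h.flat a.2 hm (fun h => hne (Subtype.ext h.symm)))
    · rintro rfl; simp [h2]
  have hcard : Fintype.card C = Fintype.card G := by simp [h.card]
  have hM' := (Matrix.mul_eq_one_comm_of_card_eq G C (ZMod 2) hcard.symm).1 hM
  have h4 := congrFun (congrFun hM' ⟨x, hx⟩) ⟨y, hy⟩
  rw [Matrix.mul_apply, Matrix.one_apply] at h4
  rw [← Finset.sum_coe_sort G]
  simp only [Subtype.mk.injEq] at h4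
  exact h4

theorem Cfg.L2 (h : Cfg C G V) {x : E} (hx : x ∈ C) (q : E) (U : Submodule (ZMod 2) E)
    (hU : finrank (ZMod 2) U = 3) :
    ∑ b ∈ G, ind (b + x ∈ V b) * ind (q + b ∈ U) = ind (q + x ∈ U) := by
  calc ∑ b ∈ G, ind (b + x ∈ V b) * ind (q + b ∈ U)
      = ∑ b ∈ G, ∑ y ∈ C, ind (b + x ∈ V b) * (ind (b + y ∈ V b) * ind (q + y ∈ U)) := by
        apply Finset.sum_congr rfl
        intro b hb
        rw [← h.L1 hb q U hU, Finset.mul_sum]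
    _ = ∑ y ∈ C, (∑ b ∈ G, ind (b + x ∈ V b) * ind (b + y ∈ V b)) * ind (q + y ∈ U) := by
        rw [Finset.sum_comm]
        apply Finset.sum_congr rfl
        intro y _
        rw [Finset.sum_mul]
        apply Finset.sum_congr rfl
        intro b _
        ring
    _ = ∑ y ∈ C, ind (x = y) * ind (q + y ∈ U) := by
        apply Finset.sum_congr rfl
        intro y hy
        rw [h.ortho hx hy]
    _ = ind (q + x ∈ U) := by
        rw [Finset.sum_eq_single x]
        · simp [ind]
        · intro y _ hy; simp [ind, hy.symm]
        · intro hxn; exact absurd hx hxn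

/-- the good points whose flat passes through `x` -/
noncomputable def Nb (G : Finset E) (V : E → Submodule (ZMod 2) E) (x : E) : Finset E :=
  G.filter (fun b => b + x ∈ V b)

theorem Cfg.parity (h : Cfg C G V) {x : E} (hx : x ∈ C) (q : E) (U : Submodule (ZMod 2) E)
    (hU : finrank (ZMod 2) U = 3) :
    (((Nb G V x).filter (fun b => q + b ∈ U)).card : ZMod 2) = ind (q + x ∈ U) := by
  rw [← h.L2 hx q U hU, Nb, Finset.filter_filter]
  simp only [ind_mul]
  rw [sum_ind]
  congr

theorem Cfg.nonempty (h : Cfg C G V) {x : E} (hx : x ∈ C) : ∃ a, a ∈ Nb G V x := by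
  by_contra hne
  push Not at hne
  have h1 := h.ortho hx hx
  rw [Finset.sum_eq_zero] at h1
  · simp [ind] at h1
  · intro b hb
    have := hne b
    rw [Nb, mem_filter] at this
    have : ¬ b + x ∈ V b := fun h' => this ⟨hb, h'⟩
    simp [ind, this]

theorem hyper_inf (h5 : finrank (ZMod 2) E = 5) (H : Submodule (ZMod 2) E)
    (hH : finrank (ZMod 2) H = 4) (ψ : E →ₗ[ZMod 2] ZMod 2) {x : E} (hx : x ∈ H) (hψ : ψ x ≠ 0) :
    finrank (ZMod 2) (H ⊓ LinearMap.ker ψ : Submodule (ZMod 2) E) = 3 := by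
  have hk := finrank_ker (n := 4) h5 ψ (by rintro rfl; simp at hψ)
  have h1 := Submodule.finrank_sup_add_finrank_inf_eq H (LinearMap.ker ψ)
  have h3 := Submodule.finrank_le (H ⊔ LinearMap.ker ψ)
  have h4 : LinearMap.ker ψ < H ⊔ LinearMap.ker ψ := by
    refine lt_of_le_of_ne le_sup_right (fun he => hψ ?_)
    have : x ∈ H ⊔ LinearMap.ker ψ := Submodule.mem_sup_left hx
    rw [← he] at this
    exact this
  have h6 := Submodule.finrank_lt_finrank_of_lt h4
  omega

theorem sup_span (U : Submodule (ZMod 2) E) {d : E} (hd : d ∉ U) :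
    finrank (ZMod 2) (U ⊔ Submodule.span (ZMod 2) {d} : Submodule (ZMod 2) E) =
      finrank (ZMod 2) U + 1 ∧
    ∀ v ∈ (U ⊔ Submodule.span (ZMod 2) {d} : Submodule (ZMod 2) E), v ∈ U ∨ d + v ∈ U := by
  have hmem : ∀ v ∈ (U ⊔ Submodule.span (ZMod 2) {d} : Submodule (ZMod 2) E),
      v ∈ U ∨ d + v ∈ U := by
    intro v hv
    obtain ⟨u, hu, s, hs, rfl⟩ := Submodule.mem_sup.1 hv
    obtain ⟨c, rfl⟩ := Submodule.mem_span_singleton.1 hs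
    rcases zmod2_cases c with rfl | rfl
    · left; simpa using hu
    · right
      have : d + (u + (1 : ZMod 2) • d) = u := by rw [one_smul]; grind [h2 d]
      rwa [this]
  refine ⟨?_, hmem⟩
  have h1 := Submodule.finrank_sup_add_finrank_inf_eq U (Submodule.span (ZMod 2) {d})
  have hd0 : d ≠ 0 := by rintro rfl; exact hd U.zero_mem
  rw [finrank_span_singleton hd0] at h1
  have hb : U ⊓ Submodule.span (ZMod 2) {d} = ⊥ := by
    rw [eq_bot_iff]
    rintro v ⟨hv, hs⟩
    obtain ⟨c, rfl⟩ := Submodule.mem_span_singleton.1 hs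
    rcases zmod2_cases c with rfl | rfl
    · simp
    · exact absurd (by simpa using hv) hd
  rw [hb] at h1
  simpa using h1

theorem Cfg.coset_two (h : Cfg C G V) {x : E} (hx : x ∈ C) {a : E} (ha : a ∈ Nb G V x) {r : E}
    (hr : a + r ∉ V a) : 2 ≤ ((Nb G V x).filter (fun b => r + b ∈ V a)).card := by
  have ha' := mem_filter.1 ha
  have haC := h.disj a ha'.1
  have hfr := h.fr a ha'.1
  have hax : a + x ≠ 0 := fun h0 => haC (by rw [add_eq_zero2.1 h0]; exact hx)
  have hrx : ¬ r + x ∈ V a := by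
    intro hm
    apply hr
    have := (V a).add_mem hm ha'.2
    have e : r + x + (a + x) = a + r := by grind [h2 x]
    rwa [e] at this
  have hpar := h.parity hx r (V a) hfr
  rw [ind, if_neg hrx, ZMod.natCast_eq_zero_iff_even] at hpar
  by_contra hlt
  have h0 : ((Nb G V x).filter (fun b => r + b ∈ V a)).card = 0 := by
    obtain ⟨k, hk⟩ := hpar; omega
  rw [Finset.card_eq_zero, Finset.filter_eq_empty_iff] at h0
  obtain ⟨hH, hHm⟩ := sup_span (V a) hr
  obtain ⟨ψ, hψ, -⟩ := Submodule.exists_le_ker_of_notMem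
    (p := (⊥ : Submodule (ZMod 2) E)) (v := a + x) (by simpa using hax)
  have hU := hyper_inf h.fr5 _ (by rw [hH, hfr]) ψ (Submodule.mem_sup_left ha'.2) hψ
  have hp2 := h.parity hx a _ hU
  rw [ind, if_neg (fun hm => hψ hm.2)] at hp2
  have h1 : (Nb G V x).filter (fun b => a + b ∈ ((V a ⊔ Submodule.span (ZMod 2) {a + r}) ⊓
      LinearMap.ker ψ : Submodule (ZMod 2) E)) = {a} := by
    ext b
    rw [mem_filter, mem_singleton]
    constructor
    · rintro ⟨hb, hm⟩
      rcases hHm _ hm.1 with h' | h'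
      · by_contra hne
        exact h.disj b (mem_filter.1 hb).1 (h.flat ha'.1 h' hne)
      · exfalso
        apply h0 hb
        have e : a + r + (a + b) = r + b := by grind [h2 a]
        rwa [e] at h'
    · rintro rfl
      exact ⟨ha, by simp [h2]⟩
  rw [h1] at hp2
  simp at hp2

end LemmaA


section LemmaB

open scoped Classical

variable {E : Type} [AddCommGroup E] [Module (ZMod 2) E] [Fintype E]

variable {C G : Finset E} {V : E → Submodule (ZMod 2) E}

theorem mkQ_eq (U : Submodule (ZMod 2) E) (x y : E) : U.mkQ x = U.mkQ y ↔ x + y ∈ U := by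
  rw [Submodule.mkQ_apply, Submodule.mkQ_apply, Submodule.Quotient.eq, ZModModule.sub_eq_add]

theorem card_quot (h5 : finrank (ZMod 2) E = 5) (U : Submodule (ZMod 2) E)
    (hU : finrank (ZMod 2) U = 3) (κ : E ⧸ U) : (univ.erase κ).card = 3 := by
  have h1 := Submodule.card_eq_card_quotient_mul_card U
  rw [card_sub U hU, Nat.card_eq_fintype_card, card_E h5, Nat.card_eq_fintype_card] at h1
  rw [card_erase_of_mem (mem_univ _), Finset.card_univ]
  omega

theorem card_filter_sub (U : Submodule (ZMod 2) E) (hU : finrank (ZMod 2) U = 3) (a : E) :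
    (univ.filter (fun x => a + x ∈ U)).card = 8 := by
  have h1 := card_sub U hU
  rw [Nat.card_eq_fintype_card, Fintype.card_subtype] at h1
  rw [← show _ = 8 from h1]
  apply Finset.card_bij (fun x _ => a + x)
  · intro x hx; simpa using hx
  · intro x _ y _ hxy; simpa using hxy
  · intro y hy
    exact ⟨a + y, by simpa [← add_assoc, h2] using hy, by simp [← add_assoc, h2]⟩

theorem Cfg.seven (h : Cfg C G V) {a : E} (ha : a ∈ G) :
    (C.filter (fun x => a + x ∈ V a)).card = 7 := by
  have h1 := card_filter_sub (V a) (h.fr a ha) a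
  have : C.filter (fun x => a + x ∈ V a) = (univ.filter (fun x => a + x ∈ V a)).erase a := by
    ext x
    simp only [mem_filter, mem_erase, mem_univ, true_and]
    constructor
    · rintro ⟨hx, hm⟩
      exact ⟨by rintro rfl; exact h.disj _ ha hx, hm⟩
    · rintro ⟨hx, hm⟩
      exact ⟨h.flat ha hm hx, hm⟩
  rw [this, card_erase_of_mem (by simp [h2]), h1]

theorem Cfg.fib_ge (h : Cfg C G V) {x : E} (hx : x ∈ C) {a : E} (ha : a ∈ Nb G V x)
    {κ : E ⧸ V a} (hκ : κ ∈ univ.erase ((V a).mkQ a)) :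
    2 ≤ ((Nb G V x).filter (fun b => (V a).mkQ b = κ)).card := by
  obtain ⟨r, rfl⟩ := (V a).mkQ_surjective κ
  have hr : a + r ∉ V a := by
    intro hm
    rw [← mkQ_eq] at hm
    exact (mem_erase.1 hκ).1 hm.symm
  have h1 := h.coset_two hx ha hr
  simp only [mkQ_eq]
  simp only [add_comm r] at h1
  exact h1

theorem fib_sum {X : Finset E} (U : Submodule (ZMod 2) E) (κ : E ⧸ U) :
    X.card = (X.filter (fun b => U.mkQ b = κ)).card +
      ∑ κ' ∈ univ.erase κ, (X.filter (fun b => U.mkQ b = κ')).card := by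
  rw [Finset.add_sum_erase _ (fun κ' => (X.filter (fun b => U.mkQ b = κ')).card) (mem_univ κ)]
  exact Finset.card_eq_sum_card_fiberwise (fun _ _ => by simp)

theorem Cfg.fib_self (h : Cfg C G V) {x : E} (hx : x ∈ C) {a : E} (ha : a ∈ Nb G V x) :
    (Nb G V x).card = 1 +
      ∑ κ ∈ univ.erase ((V a).mkQ a), ((Nb G V x).filter (fun b => (V a).mkQ b = κ)).card := by
  rw [fib_sum (V a) ((V a).mkQ a)]
  congr 1
  rw [Finset.card_eq_one]
  refine ⟨a, ?_⟩
  ext b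
  rw [mem_filter, mem_singleton, mkQ_eq]
  constructor
  · rintro ⟨hb, hm⟩
    by_contra hne
    rw [add_comm] at hm
    exact h.disj b (mem_filter.1 hb).1 (h.flat (mem_filter.1 ha).1 hm hne)
  · rintro rfl
    exact ⟨ha, by simp [h2]⟩

theorem Cfg.Nb_ge (h : Cfg C G V) {x : E} (hx : x ∈ C) : 7 ≤ (Nb G V x).card := by
  obtain ⟨a, ha⟩ := h.nonempty hx
  rw [h.fib_self hx ha]
  have h1 := Finset.card_nsmul_le_sum _
    (fun κ => ((Nb G V x).filter (fun b => (V a).mkQ b = κ)).card) 2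
    (fun κ hκ => h.fib_ge hx ha hκ)
  rw [card_quot h.fr5 (V a) (h.fr a (mem_filter.1 ha).1), smul_eq_mul] at h1
  omega

theorem Cfg.Nb_eq (h : Cfg C G V) {x : E} (hx : x ∈ C) : (Nb G V x).card = 7 := by
  have h1 := Finset.sum_card_bipartiteAbove_eq_sum_card_bipartiteBelow
    (s := C) (t := G) (fun x b => b + x ∈ V b)
  have h3 : ∑ b ∈ G, (Finset.bipartiteBelow (fun x b => b + x ∈ V b) C b).card = ∑ b ∈ G, 7 :=
    Finset.sum_congr rfl (fun b hb => h.seven hb)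
  rw [h3, Finset.sum_const, h.card, ← Finset.sum_const] at h1
  exact ((Finset.sum_eq_sum_iff_of_le (fun y hy => h.Nb_ge hy)).1 h1.symm x hx).symm

theorem Cfg.fib_eq (h : Cfg C G V) {x : E} (hx : x ∈ C) {a : E} (ha : a ∈ Nb G V x)
    {κ : E ⧸ V a} (hκ : κ ∈ univ.erase ((V a).mkQ a)) :
    ((Nb G V x).filter (fun b => (V a).mkQ b = κ)).card = 2 := by
  have h1 := h.Nb_eq hx
  rw [h.fib_self hx ha] at h1
  have h3 : ∑ κ ∈ univ.erase ((V a).mkQ a), 2 = 6 := by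
    rw [Finset.sum_const, card_quot h.fr5 (V a) (h.fr a (mem_filter.1 ha).1)]; rfl
  exact ((Finset.sum_eq_sum_iff_of_le (fun κ hκ => h.fib_ge hx ha hκ)).1 (by omega) κ hκ).symm

/-- number of common points of the flats of `a` and `b` -/
noncomputable def com (C : Finset E) (V : E → Submodule (ZMod 2) E) (a b : E) : ℕ :=
  (C.filter (fun x => a + x ∈ V a ∧ b + x ∈ V b)).card

theorem Cfg.sum_com (h : Cfg C G V) {a : E} (ha : a ∈ G)
    {κ : E ⧸ V a} (hκ : κ ∈ univ.erase ((V a).mkQ a)) :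
    ∑ b ∈ G.filter (fun b => (V a).mkQ b = κ), com C V a b = 14 := by
  have h1 := Finset.sum_card_bipartiteAbove_eq_sum_card_bipartiteBelow
    (s := C.filter (fun x => a + x ∈ V a)) (t := G.filter (fun b => (V a).mkQ b = κ))
    (fun x b => b + x ∈ V b)
  have h3 : ∑ x ∈ C.filter (fun x => a + x ∈ V a), (Finset.bipartiteAbove
      (fun x b => b + x ∈ V b) (G.filter (fun b => (V a).mkQ b = κ)) x).card =
      ∑ x ∈ C.filter (fun x => a + x ∈ V a), 2 := by
    apply Finset.sum_congr rfl
    intro x hx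
    rw [mem_filter] at hx
    have h4 := h.fib_eq hx.1 (a := a) (mem_filter.2 ⟨ha, hx.2⟩) hκ
    rw [Nb, Finset.filter_comm] at h4
    exact h4
  rw [h3, Finset.sum_const, h.seven ha] at h1
  simp only [com, ← Finset.filter_filter]
  exact h1.symm

theorem Cfg.com_cases (h : Cfg C G V) {a b : E} (ha : a ∈ G) (hb : b ∈ G) (hab : a + b ∉ V a) :
    com C V a b = 0 ∨ com C V a b = 2 ∨
      (com C V a b = 4 ∧ finrank (ZMod 2) (V a ⊓ V b : Submodule (ZMod 2) E) = 2) := by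
  by_cases h0 : com C V a b = 0
  · left; exact h0
  right
  obtain ⟨x0, hx0⟩ := Finset.card_pos.1 (Nat.pos_of_ne_zero h0)
  rw [mem_filter] at hx0
  obtain ⟨hx0C, hxa, hxb⟩ := hx0
  have hne : a ≠ b := by rintro rfl; simp [h2] at hab
  have hcard : com C V a b = Nat.card (V a ⊓ V b : Submodule (ZMod 2) E) := by
    rw [Nat.card_eq_fintype_card, Fintype.card_subtype, com]
    apply Finset.card_bij (fun x _ => x + x0)
    · intro x hx
      rw [mem_filter] at hx
      rw [mem_filter]
      refine ⟨mem_univ _, ?_, ?_⟩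
      · have := (V a).add_mem hx.2.1 hxa
        have e : a + x + (a + x0) = x + x0 := by grind [h2 a]
        rwa [e] at this
      · have := (V b).add_mem hx.2.2 hxb
        have e : b + x + (b + x0) = x + x0 := by grind [h2 b]
        rwa [e] at this
    · intro x _ y _ hxy; simpa using hxy
    · intro v hv
      rw [mem_filter] at hv
      have k1 : a + (v + x0) ∈ V a := by
        have := (V a).add_mem hv.2.1 hxa
        have e : v + (a + x0) = a + (v + x0) := by abel
        rwa [e] at this
      have k2 : b + (v + x0) ∈ V b := by
        have := (V b).add_mem hv.2.2 hxb
        have e : v + (b + x0) = b + (v + x0) := by abel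
        rwa [e] at this
      refine ⟨v + x0, ?_, by grind [h2 x0]⟩
      rw [mem_filter]
      refine ⟨?_, k1, k2⟩
      by_cases he : v + x0 = a
      · exact h.flat hb k2 (by rw [he]; exact hne)
      · exact h.flat ha k1 he
  obtain ⟨hge, -⟩ := inf_ne_bot h.fr5 (V a) (V b) (h.fr a ha) (h.fr b hb)
  have hle := Submodule.finrank_mono (inf_le_left : V a ⊓ V b ≤ V a)
  rw [h.fr a ha] at hle
  have h3 : finrank (ZMod 2) (V a ⊓ V b : Submodule (ZMod 2) E) ≠ 3 := by
    intro h3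
    have e1 : V a ⊓ V b = V a := Submodule.eq_of_le_of_finrank_eq inf_le_left (by
      rw [h3, h.fr a ha])
    have e2 : V a ⊓ V b = V b := Submodule.eq_of_le_of_finrank_eq inf_le_right (by
      rw [h3, h.fr b hb])
    rw [e1] at e2
    rw [← e2] at hxb
    have := (V a).add_mem hxa hxb
    have e : a + x0 + (b + x0) = a + b := by grind [h2 x0]
    rw [e] at this
    exact hab this
  have : finrank (ZMod 2) (V a ⊓ V b : Submodule (ZMod 2) E) = 1 ∨
    finrank (ZMod 2) (V a ⊓ V b : Submodule (ZMod 2) E) = 2 := by omega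
  rcases this with h' | h'
  · left; rw [hcard, card_sub _ h']; rfl
  · right; exact ⟨by rw [hcard, card_sub _ h']; rfl, h'⟩

end LemmaB


section LemmaC

open scoped Classical

variable {E : Type} [AddCommGroup E] [Module (ZMod 2) E] [Fintype E]

variable {C G : Finset E} {V : E → Submodule (ZMod 2) E}

theorem Cfg.one_in (h : Cfg C G V) {a b : E} (hb : b ∈ G) {d : E} (hd0 : d ≠ 0)
    (hda : d ∈ V a) (hdb : d ∈ V b) :
    b + d ∈ C.filter (fun x => (V a).mkQ x = (V a).mkQ b) := by
  rw [mem_filter, mkQ_eq]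
  refine ⟨h.cov b hb d hdb hd0, ?_⟩
  have e : b + d + b = d := by grind [h2 b]
  rwa [e]

theorem Cfg.three_in (h : Cfg C G V) {a b : E} (hb : b ∈ G)
    (hf : finrank (ZMod 2) (V a ⊓ V b : Submodule (ZMod 2) E) = 2) :
    ∃ s ⊆ C.filter (fun x => (V a).mkQ x = (V a).mkQ b), s.card = 3 ∧ ∑ x ∈ s, x = b := by
  have hc := card_sub _ hf
  rw [Nat.card_eq_fintype_card, Fintype.card_subtype] at hc
  have hne : V a ⊓ V b ≠ ⊥ := by
    intro h; rw [h] at hf; simp at hf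
  obtain ⟨d, hd, hd0⟩ := Submodule.exists_mem_ne_zero_of_ne_bot hne
  obtain ⟨e, he, hne2⟩ := Finset.exists_mem_notMem_of_card_lt_card
    (s := ({0, d} : Finset E)) (t := univ.filter (fun x => x ∈ V a ⊓ V b))
    (lt_of_le_of_lt Finset.card_le_two (by omega))
  simp only [mem_insert, mem_singleton, not_or] at hne2
  simp only [mem_filter, mem_univ, true_and] at he
  have hde : d + e ≠ 0 := fun h0 => hne2.2 (add_eq_zero2.1 h0).symm
  have m1 := h.one_in (a := a) hb hd0 hd.1 hd.2
  have m2 := h.one_in (a := a) hb hne2.1 he.1 he.2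
  have m3 := h.one_in (a := a) hb hde ((V a).add_mem hd.1 he.1) ((V b).add_mem hd.2 he.2)
  have n1 : b + d ≠ b + e := fun h0 => hne2.2 (by simpa using h0.symm)
  have n2 : b + d ≠ b + (d + e) := fun h0 => hne2.1 (by simpa using h0)
  have n3 : b + e ≠ b + (d + e) := fun h0 => hd0 (by simpa using h0)
  refine ⟨{b + d, b + e, b + (d + e)}, ?_, Finset.card_eq_three.2 ⟨_, _, _, n1, n2, n3, rfl⟩, ?_⟩
  · intro x hx
    simp only [mem_insert, mem_singleton] at hx
    rcases hx with rfl | rfl | rfl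
    · exact m1
    · exact m2
    · exact m3
  · rw [sum_insert (by simp [n1, hne2.1, hd0]), sum_insert (by simp [n3, hd0]), sum_singleton]
    grind [h2 b, h2 d, h2 e]

theorem Cfg.fib_le (h : Cfg C G V) {a : E} (ha : a ∈ G) (κ : E ⧸ V a) :
    (G.filter (fun b => (V a).mkQ b = κ)).card + (C.filter (fun b => (V a).mkQ b = κ)).card ≤ 8 ∧
    ((G.filter (fun b => (V a).mkQ b = κ)).card + (C.filter (fun b => (V a).mkQ b = κ)).card = 8 →
      ∀ x, (V a).mkQ x = κ → x ∈ G ∨ x ∈ C) := by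
  obtain ⟨r, rfl⟩ := (V a).mkQ_surjective κ
  have h8 := card_filter_sub (V a) (h.fr a ha) r
  have hd : Disjoint (G.filter (fun b => (V a).mkQ b = (V a).mkQ r))
      (C.filter (fun b => (V a).mkQ b = (V a).mkQ r)) := by
    rw [Finset.disjoint_left]
    intro x hx hx'
    exact h.disj x (mem_filter.1 hx).1 (mem_filter.1 hx').1
  rw [← card_union_of_disjoint hd]
  have hs : G.filter (fun b => (V a).mkQ b = (V a).mkQ r) ∪
      C.filter (fun b => (V a).mkQ b = (V a).mkQ r) ⊆ univ.filter (fun x => r + x ∈ V a) := by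
    intro x hx
    simp only [mem_union, mem_filter, mkQ_eq, mem_univ, true_and, add_comm x r] at hx ⊢
    tauto
  refine ⟨(card_le_card hs).trans (by omega), fun h' x hx => ?_⟩
  have heq := Finset.eq_of_subset_of_card_le hs (by omega)
  have : x ∈ univ.filter (fun x => r + x ∈ V a) := by
    rw [mkQ_eq] at hx
    rw [mem_filter, add_comm r x]
    exact ⟨mem_univ _, hx⟩
  rw [← heq, mem_union, mem_filter, mem_filter] at this
  tauto

theorem Cfg.coset_type (h : Cfg C G V) {a : E} (ha : a ∈ G)
    {κ : E ⧸ V a} (hκ : κ ∈ univ.erase ((V a).mkQ a)) :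
    ((G.filter (fun b => (V a).mkQ b = κ)).card = 7 ∧
      (C.filter (fun b => (V a).mkQ b = κ)).card = 1) ∨
    ((G.filter (fun b => (V a).mkQ b = κ)).card = 4 ∧
      (C.filter (fun b => (V a).mkQ b = κ)).card = 4) := by
  set Gk := G.filter (fun b => (V a).mkQ b = κ) with hGk
  set Ck := C.filter (fun b => (V a).mkQ b = κ) with hCk
  have h8 : Gk.card + Ck.card ≤ 8 := (h.fib_le ha κ).1
  have hsum : ∑ b ∈ Gk, com C V a b = 14 := h.sum_com ha hκ
  have hG : ∀ b ∈ Gk, b ∈ G ∧ (V a).mkQ b = κ ∧ a + b ∉ V a := by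
    intro b hb
    have hb' := mem_filter.1 hb
    refine ⟨hb'.1, hb'.2, fun hm => ?_⟩
    rw [← mkQ_eq, hb'.2] at hm
    exact (mem_erase.1 hκ).1 hm.symm
  have hcases := fun b hb => h.com_cases ha (hG b hb).1 (hG b hb).2.2
  have hs2 : ∑ b ∈ Gk, com C V a b =
      4 * (Gk.filter (fun b => com C V a b = 4)).card +
      2 * (Gk.filter (fun b => com C V a b = 2)).card := by
    rw [Finset.card_filter, Finset.card_filter, Finset.mul_sum, Finset.mul_sum,
      ← Finset.sum_add_distrib]
    apply Finset.sum_congr rfl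
    intro b hb
    rcases hcases b hb with h' | h' | h'
    · simp [h']
    · simp [h']
    · simp [h'.1]
  have hle : (Gk.filter (fun b => com C V a b = 4)).card +
      (Gk.filter (fun b => com C V a b = 2)).card ≤ Gk.card := by
    rw [← card_union_of_disjoint]
    · apply Finset.card_le_card
      exact Finset.union_subset (Finset.filter_subset _ _) (Finset.filter_subset _ _)
    · rw [Finset.disjoint_left]
      intro b hb hb'
      have e1 := (mem_filter.1 hb).2
      have e3 := (mem_filter.1 hb').2
      omega
  set u := (Gk.filter (fun b => com C V a b = 4)).card with hu
  set v := (Gk.filter (fun b => com C V a b = 2)).card with hv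
  have h4 : ∀ b ∈ Gk.filter (fun b => com C V a b = 4),
      ∃ s ⊆ Ck, s.card = 3 ∧ ∑ x ∈ s, x = b := by
    intro b hb
    have hb' := mem_filter.1 hb
    have hgb := hG b hb'.1
    have hf : finrank (ZMod 2) (V a ⊓ V b : Submodule (ZMod 2) E) = 2 := by
      rcases hcases b hb'.1 with h' | h' | h'
      · omega
      · omega
      · exact h'.2
    have := h.three_in (a := a) hgb.1 hf
    rw [hgb.2.1] at this
    exact this
  have c1 : 1 ≤ Ck.card := by
    have : 0 < Gk.card := by omega
    obtain ⟨b, hb⟩ := Finset.card_pos.1 this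
    have hgb := hG b hb
    obtain ⟨-, d, hda, hdb, hd0⟩ := inf_ne_bot h.fr5 (V a) (V b) (h.fr a ha) (h.fr b hgb.1)
    have := h.one_in (a := a) hgb.1 hd0 hda hdb
    rw [hgb.2.1] at this
    exact Finset.card_pos.2 ⟨_, this⟩
  have c3 : 1 ≤ u → 3 ≤ Ck.card := by
    intro h1
    obtain ⟨b, hb⟩ := Finset.card_pos.1 (show 0 < u by omega)
    obtain ⟨s, hs, hs3, -⟩ := h4 b hb
    have := Finset.card_le_card hs
    omega
  have c4 : Ck.card = 3 → u ≤ 1 := by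
    intro h3
    rw [hu, Finset.card_le_one]
    intro b hb b' hb'
    obtain ⟨s, hs, hs3, hsb⟩ := h4 b hb
    obtain ⟨s', hs', hs3', hsb'⟩ := h4 b' hb'
    have e1 := Finset.eq_of_subset_of_card_le hs (by omega)
    have e3 := Finset.eq_of_subset_of_card_le hs' (by omega)
    rw [← hsb, ← hsb', e1, e3]
  omega

theorem Cfg.absurd (h : Cfg C G V) (hC : 0 < C.card) : False := by
  have hGpos : 0 < G.card := by rw [h.card]; exact hC
  obtain ⟨a, ha⟩ := Finset.card_pos.1 hGpos
  have hq := card_quot h.fr5 (V a) (h.fr a ha) ((V a).mkQ a)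
  have g1 := fib_sum (X := G) (V a) ((V a).mkQ a)
  have g2 := fib_sum (X := C) (V a) ((V a).mkQ a)
  have g3 : (G.filter (fun b => (V a).mkQ b = (V a).mkQ a)).card = 1 := by
    rw [Finset.card_eq_one]
    refine ⟨a, ?_⟩
    ext b
    rw [mem_filter, mem_singleton, mkQ_eq]
    constructor
    · rintro ⟨hb, hm⟩
      by_contra hne
      rw [add_comm] at hm
      exact h.disj b hb (h.flat ha hm hne)
    · rintro rfl
      exact ⟨ha, by simp [h2]⟩
  have g4 : (C.filter (fun b => (V a).mkQ b = (V a).mkQ a)).card = 7 := by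
    rw [← h.seven ha]
    simp only [mkQ_eq, add_comm a]
  rw [g3] at g1
  rw [g4] at g2
  have hcard := h.card
  -- a coset of the first type
  have t1 : ∃ κ ∈ univ.erase ((V a).mkQ a), (G.filter (fun b => (V a).mkQ b = κ)).card = 7 ∧
      (C.filter (fun b => (V a).mkQ b = κ)).card = 1 := by
    by_contra hno
    push Not at hno
    have : ∑ κ ∈ univ.erase ((V a).mkQ a), (G.filter (fun b => (V a).mkQ b = κ)).card =
        ∑ κ ∈ univ.erase ((V a).mkQ a), (C.filter (fun b => (V a).mkQ b = κ)).card := by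
      apply Finset.sum_congr rfl
      intro κ hκ
      rcases h.coset_type ha hκ with h' | h'
      · exact (hno κ hκ h'.1 h'.2).elim
      · omega
    omega
  have t2 : ∃ κ ∈ univ.erase ((V a).mkQ a), (G.filter (fun b => (V a).mkQ b = κ)).card = 4 ∧
      (C.filter (fun b => (V a).mkQ b = κ)).card = 4 := by
    by_contra hno
    push Not at hno
    have e1 : ∑ κ ∈ univ.erase ((V a).mkQ a), (G.filter (fun b => (V a).mkQ b = κ)).card =
        ∑ κ ∈ univ.erase ((V a).mkQ a), 7 := by
      apply Finset.sum_congr rfl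
      intro κ hκ
      rcases h.coset_type ha hκ with h' | h'
      · omega
      · exact (hno κ hκ h'.1 h'.2).elim
    have e3 : ∑ κ ∈ univ.erase ((V a).mkQ a), (C.filter (fun b => (V a).mkQ b = κ)).card =
        ∑ κ ∈ univ.erase ((V a).mkQ a), 1 := by
      apply Finset.sum_congr rfl
      intro κ hκ
      rcases h.coset_type ha hκ with h' | h'
      · omega
      · exact (hno κ hκ h'.1 h'.2).elim
    rw [Finset.sum_const, hq] at e1 e3
    simp only [smul_eq_mul] at e1 e3
    omega
  obtain ⟨κ, hκ, k7, k1⟩ := t1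
  obtain ⟨κ', hκ', -, k4⟩ := t2
  have hkk : κ ≠ κ' := by rintro rfl; omega
  obtain ⟨y, hy⟩ := Finset.card_eq_one.1 k1
  have hyC : y ∈ C.filter (fun b => (V a).mkQ b = κ) := by
    rw [hy]; exact mem_singleton_self y
  rw [mem_filter] at hyC
  have hall := (h.fib_le ha κ).2 (by omega)
  obtain ⟨r, hr⟩ := (V a).mkQ_surjective κ'
  set D := C.filter (fun b => (V a).mkQ b = κ') with hD
  have hsub : (univ.filter (fun d => 0 + d ∈ V a)).erase 0 ⊆
      (powersetCard 2 D).image (fun s => ∑ x ∈ s, x) := by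
    intro d hd
    simp only [mem_erase, mem_filter, mem_univ, true_and, zero_add] at hd
    obtain ⟨hd0, hda⟩ := hd
    have hmk : ∀ z, (V a).mkQ (z + d) = (V a).mkQ z := by
      intro z
      rw [mkQ_eq]
      have e : z + d + z = d := by grind [h2 z]
      rwa [e]
    have hbk : (V a).mkQ (y + d) = κ := by rw [hmk]; exact hyC.2
    have hb : y + d ∈ G := by
      rcases hall (y + d) hbk with h' | h'
      · exact h'
      · exfalso
        have : y + d ∈ C.filter (fun b => (V a).mkQ b = κ) := mem_filter.2 ⟨h', hbk⟩
        rw [hy, mem_singleton] at this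
        exact hd0 (by simpa using this)
    set b := y + d with hbdef
    have huniq : ∀ d', d' ≠ 0 → d' ∈ V a → d' ∈ V b → d' = d := by
      intro d' h0 h1 h3
      have := h.one_in (a := a) hb h0 h1 h3
      rw [hbk, hy, mem_singleton] at this
      grind [h2 y, h2 d]
    obtain ⟨-, d', hda', hdb', hd0'⟩ := inf_ne_bot h.fr5 (V a) (V b) (h.fr a ha) (h.fr b hb)
    have hdb : d ∈ V b := by rw [← huniq d' hd0' hda' hdb']; exact hdb'
    have hle1 : finrank (ZMod 2) (V a ⊓ V b : Submodule (ZMod 2) E) ≤ 1 := by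
      rw [← finrank_span_singleton (K := ZMod 2) hd0]
      apply Submodule.finrank_mono
      intro x hx
      by_cases hx0 : x = 0
      · rw [hx0]; exact Submodule.zero_mem _
      · rw [huniq x hx0 hx.1 hx.2]
        exact Submodule.mem_span_singleton_self d
    have htop : V a ⊔ V b = ⊤ := by
      apply Submodule.eq_top_of_finrank_eq
      have h1 := Submodule.finrank_sup_add_finrank_inf_eq (V a) (V b)
      have h3 := Submodule.finrank_le (V a ⊔ V b)
      rw [h.fr a ha, h.fr b hb] at h1
      rw [h.fr5] at h3 ⊢
      omega
    have hmem : r + b ∈ V a ⊔ V b := by rw [htop]; trivial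
    obtain ⟨s, hs, t, ht, hst⟩ := Submodule.mem_sup.1 hmem
    have hz : (V a).mkQ (b + t) = κ' := by
      rw [← hr, mkQ_eq]
      have e : b + t + r = s := by grind [h2 b, h2 t, h2 r, h2 s]
      rwa [e]
    have ht0 : t ≠ 0 := by
      rintro rfl
      rw [add_zero, hbk] at hz
      exact hkk hz
    have htd : t + d ≠ 0 := by
      intro h0
      rw [add_eq_zero2.1 h0, hmk, hbk] at hz
      exact hkk hz
    have m1 : b + t ∈ D := mem_filter.2 ⟨h.cov b hb t ht ht0, hz⟩
    have m2 : b + t + d ∈ D := by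
      refine mem_filter.2 ⟨?_, by rw [hmk]; exact hz⟩
      rw [add_assoc]
      exact h.cov b hb _ ((V b).add_mem ht hdb) htd
    have hne : b + t ≠ b + t + d := fun h0 => hd0 (by simpa using h0)
    rw [mem_image]
    refine ⟨{b + t, b + t + d}, ?_, ?_⟩
    · rw [mem_powersetCard]
      refine ⟨?_, Finset.card_pair hne⟩
      intro x hx
      rcases mem_insert.1 hx with rfl | hx
      · exact m1
      · rw [mem_singleton.1 hx]; exact m2
    · rw [Finset.sum_pair hne]
      grind [h2 (b + t)]
  have hc := (Finset.card_le_card hsub).trans Finset.card_image_le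
  rw [card_powersetCard, k4, card_erase_of_mem (by simp),
    card_filter_sub (V a) (h.fr a ha) 0] at hc
  norm_num [Nat.choose] at hc

theorem lemmaA (h5 : finrank (ZMod 2) E = 5) (T G : Finset E) (hGT : G ⊆ T)
    (hG : ∀ a ∈ G, Good T a) (hT : T.card < 32) : G.card + T.card < 32 := by
  have hE := card_E h5
  have hCc : (univ \ T).card = 32 - T.card := by
    rw [card_sdiff_of_subset (subset_univ _), Finset.card_univ, hE]; rfl
  by_contra hcon
  obtain ⟨G', hG', hc⟩ := Finset.exists_subset_card_eq (s := G) (n := 32 - T.card) (by omega)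
  choose! V hV3 hV using hG
  have h : Cfg (univ \ T) G' V := by
    refine ⟨h5, ?_, ?_, ?_, ?_⟩
    · intro a ha; simpa using hGT (hG' ha)
    · intro a ha; exact hV3 a (hG' ha)
    · intro a ha v hv hv0; simpa using hV a (hG' ha) v hv hv0
    · rw [hc, hCc]
  exact h.absurd (by omega)

end LemmaC


section Five

variable {E : Type} [AddCommGroup E] [Module (ZMod 2) E] [Fintype E] [DecidableEq E]

theorem func_of_sub (h5 : finrank (ZMod 2) E = 5) (W : Submodule (ZMod 2) E)
    (hW : finrank (ZMod 2) W = 4) :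
    ∃ ψ : E →ₗ[ZMod 2] ZMod 2, ψ ≠ 0 ∧ ∀ w, (ψ w = 0 ↔ w ∈ W) := by
  obtain ⟨ψ, hψ⟩ := sep_of_lt (V := W) (W := ⊤) le_top hW (by rw [finrank_top, h5])
  refine ⟨ψ, ?_, fun w => hψ w trivial⟩
  rintro rfl
  have : W = ⊤ := by
    rw [eq_top_iff]; intro w _; exact (hψ w trivial).1 rfl
  rw [this, finrank_top, h5] at hW
  omega

theorem split5 (h5 : finrank (ZMod 2) E = 5) (W : Submodule (ZMod 2) E)
    (hW : finrank (ZMod 2) W = 4) (X : Finset E)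
    (hX : ∀ Y ⊆ X, (∀ x ∈ Y, ∀ y ∈ Y, x + y ∈ W) → Y.card ≤ 5) : X.card ≤ 10 := by
  obtain ⟨ψ, -, hψ⟩ := func_of_sub h5 W hW
  have h1 := hX (X.filter (fun x => ψ x = 0)) (filter_subset _ _) (by
    intro x hx y hy
    rw [← hψ, map_add, (mem_filter.1 hx).2, (mem_filter.1 hy).2, add_zero])
  have h3 := hX (X.filter (fun x => ¬ ψ x = 0)) (filter_subset _ _) (by
    intro x hx y hy
    rw [← hψ, map_add, (zmod2_cases _).resolve_left (mem_filter.1 hx).2,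
      (zmod2_cases _).resolve_left (mem_filter.1 hy).2]
    decide)
  have := Finset.card_filter_add_card_filter_not (s := X) (fun x => ψ x = 0)
  omega

theorem caseA (h5 : finrank (ZMod 2) E = 5) {T : Finset E} {A : E → Finset E} (hV : Valid T A)
    {a : E} (ha : a ∈ T) (hw : 9 ≤ (A a).card) : ∑ a ∈ T, (A a).card ≤ 124 := by
  have hE := card_E h5
  rcases Nat.lt_or_ge T.card 2 with ht | ht
  · have := bound_le_one A (T := T) (by omega)
    omega
  by_cases hcol : ∃ a ∈ T, ∃ φ : E →ₗ[ZMod 2] ZMod 2, ∀ b ∈ T, b ≠ a → φ (b + a) = 1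
  · obtain ⟨a, ha, φ, hφ⟩ := hcol
    have := coloop_bound (n := 4) h5 hV ha ht φ hφ 42
      (fun F _ _ _ _ hF T' A' hv => bound4 hF T' A' hv)
    omega
  have hF : ∀ b ∈ T, 9 ≤ (A b).card → ¬ Plane T b ∧ Frame T b := by
    intro b hb h9
    have hp : ¬ Plane T b := fun hp => by have := w_le_plane hV hb hp; omega
    rcases tricho (by omega) hb hp with h | h
    · exact absurd ⟨b, hb, h⟩ hcol
    · exact ⟨hp, h⟩
  have hw10 : ∀ b ∈ T, (A b).card ≤ 10 := by
    intro b hb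
    rcases Nat.lt_or_ge (A b).card 9 with h9 | h9
    · omega
    · obtain ⟨hp, W, P, hW, hP, h0, hs, hPW, hPT⟩ := hF b hb h9
      exact split5 h5 W hW (A b) (fun Y hY hYW => frame_w hV hb hW hP h0 hs hPW hPT Y hY hYW)
  obtain ⟨hp, W, P, hW, hP, h0, hs, hPW, hPT⟩ := hF a ha hw
  have h10 := split5 h5 W hW (T.erase a)
    (fun Y hY hYW => frame_t hp hW hP h0 hs hPW hPT Y hY hYW)
  rw [card_erase_of_mem ha] at h10
  have := sum_const_le hw10
  omega

theorem span4 (d : Fin 4 → E) (hd : LinearIndependent (ZMod 2) d) :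
    ∃ W : Submodule (ZMod 2) E, finrank (ZMod 2) W = 4 ∧
      ∀ v ∈ W, ∃ c : Fin 4 → ZMod 2, c 0 • d 0 + c 1 • d 1 + c 2 • d 2 + c 3 • d 3 = v := by
  refine ⟨Submodule.span (ZMod 2) (Set.range d), ?_, ?_⟩
  · rw [finrank_span_eq_card hd]; simp
  · intro v hv
    rw [Submodule.mem_span_range_iff_exists_fun] at hv
    obtain ⟨c, hc⟩ := hv
    exact ⟨c, by rw [← hc, Fin.sum_univ_four]⟩

set_option maxHeartbeats 4000000 in
theorem sidon_struct (h5 : finrank (ZMod 2) E = 5) {T : Finset E} {A : E → Finset E}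
    (hV : Valid T A) {a : E} (ha : a ∈ T) (hS : Sidon (A a)) (hw : 5 ≤ (A a).card) :
    ∃ φ : E →ₗ[ZMod 2] ZMod 2, φ ≠ 0 ∧ ∃ Q : Finset E, Q.card = 6 ∧ ∑ q ∈ Q, q = 0 ∧
      T.filter (fun b => φ b = φ a) ⊆ Q := by
  obtain ⟨X, hX, hXc⟩ := Finset.exists_subset_card_eq hw
  let f : Fin 5 → E := fun i => ((X.equivFinOfCardEq hXc).symm i : E)
  have hf : Function.Injective f := fun i j h => by
    simpa using Subtype.ext h
  have hfA : ∀ i, f i ∈ A a := fun i => hX ((X.equivFinOfCardEq hXc).symm i).2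
  have hne : ∀ i j, i ≠ j → f i ≠ f j := fun i j hij h => hij (hf h)
  have hfour : ∀ i j k l, i ≠ j → k ≠ i → k ≠ j → f i + f j ≠ f k + f l := by
    intro i j k l hij hki hkj h
    rcases hS _ (hfA i) _ (hfA j) _ (hfA k) _ (hfA l) (hne i j hij) h with h' | h'
    · exact hki (hf h'.1)
    · exact hkj (hf h'.1)
  have hT2 : ∀ i j, i ≠ j → a + f i + f j ∉ T := fun i j hij =>
    hV a ha _ (hfA i) _ (hfA j) (hne i j hij)
  have n01 := hne 0 1 (by decide)
  have n02 := hne 0 2 (by decide)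
  have n03 := hne 0 3 (by decide)
  have n04 := hne 0 4 (by decide)
  have n12 := hne 1 2 (by decide)
  have n13 := hne 1 3 (by decide)
  have n14 := hne 1 4 (by decide)
  have n23 := hne 2 3 (by decide)
  have n24 := hne 2 4 (by decide)
  have n34 := hne 3 4 (by decide)
  have m0 := hfour 1 2 3 4 (by decide) (by decide) (by decide)
  have m1 := hfour 0 2 3 4 (by decide) (by decide) (by decide)
  have m2 := hfour 0 1 3 4 (by decide) (by decide) (by decide)
  have m3 := hfour 0 1 2 4 (by decide) (by decide) (by decide)
  have m4 := hfour 0 1 2 3 (by decide) (by decide) (by decide)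
  have t01 := hT2 0 1 (by decide)
  have t02 := hT2 0 2 (by decide)
  have t03 := hT2 0 3 (by decide)
  have t04 := hT2 0 4 (by decide)
  have t12 := hT2 1 2 (by decide)
  have t13 := hT2 1 3 (by decide)
  have t14 := hT2 1 4 (by decide)
  have t23 := hT2 2 3 (by decide)
  have t24 := hT2 2 4 (by decide)
  have t34 := hT2 3 4 (by decide)
  clear hT2 hfour hne
  generalize f 0 = x0 at *
  generalize f 1 = x1 at *
  generalize f 2 = x2 at *
  generalize f 3 = x3 at *
  generalize f 4 = x4 at *
  clear hf hfA
  have ea := h2 a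
  have e0 := h2 x0
  have e1 := h2 x1
  have e2 := h2 x2
  have e3 := h2 x3
  have e4 := h2 x4
  have hli : LinearIndependent (ZMod 2) ![x0 + x1, x0 + x2, x0 + x3, x0 + x4] := by
    rw [Fintype.linearIndependent_iff]
    intro g hg
    replace hg : g 0 • (x0 + x1) + g 1 • (x0 + x2) + g 2 • (x0 + x3) + g 3 • (x0 + x4) = 0 := by
      rw [← hg, Fin.sum_univ_four]; rfl
    have hh : g 0 = 0 ∧ g 1 = 0 ∧ g 2 = 0 ∧ g 3 = 0 := by
      rcases zmod2_cases (g 0) with a0 | a0 <;> rcases zmod2_cases (g 1) with a1 | a1 <;>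
        rcases zmod2_cases (g 2) with a2 | a2 <;> rcases zmod2_cases (g 3) with a3 | a3 <;>
        rw [a0, a1, a2, a3] at hg ⊢ <;>
        simp only [zero_smul, one_smul, zero_add, add_zero] at hg <;>
        first
        | simp; done
        | (exfalso; grind)
    intro i; fin_cases i
    · exact hh.1
    · exact hh.2.1
    · exact hh.2.2.1
    · exact hh.2.2.2
  obtain ⟨W, hW, hWm⟩ := span4 _ hli
  obtain ⟨φ, hφ0, hφ⟩ := func_of_sub h5 W hW
  set p0 := a + (x1 + x2 + x3 + x4) with hp0
  set p1 := a + (x0 + x2 + x3 + x4) with hp1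
  set p2 := a + (x0 + x1 + x3 + x4) with hp2
  set p3 := a + (x0 + x1 + x2 + x4) with hp3
  set p4 := a + (x0 + x1 + x2 + x3) with hp4
  have q0 : a ≠ p0 := by grind
  have q1 : a ≠ p1 := by grind
  have q2 : a ≠ p2 := by grind
  have q3 : a ≠ p3 := by grind
  have q4 : a ≠ p4 := by grind
  have r01 : p0 ≠ p1 := by grind
  have r02 : p0 ≠ p2 := by grind
  have r03 : p0 ≠ p3 := by grind
  have r04 : p0 ≠ p4 := by grind
  have r12 : p1 ≠ p2 := by grind
  have r13 : p1 ≠ p3 := by grind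
  have r14 : p1 ≠ p4 := by grind
  have r23 : p2 ≠ p3 := by grind
  have r24 : p2 ≠ p4 := by grind
  have r34 : p3 ≠ p4 := by grind
  have k1 : p3 ∉ ({p4} : Finset E) := by rw [mem_singleton]; exact r34
  have k2 : p2 ∉ ({p3, p4} : Finset E) := by
    simp only [mem_insert, mem_singleton, not_or]; exact ⟨r23, r24⟩
  have k3 : p1 ∉ ({p2, p3, p4} : Finset E) := by
    simp only [mem_insert, mem_singleton, not_or]; exact ⟨r12, r13, r14⟩
  have k4 : p0 ∉ ({p1, p2, p3, p4} : Finset E) := by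
    simp only [mem_insert, mem_singleton, not_or]; exact ⟨r01, r02, r03, r04⟩
  have k5 : a ∉ ({p0, p1, p2, p3, p4} : Finset E) := by
    simp only [mem_insert, mem_singleton, not_or]; exact ⟨q0, q1, q2, q3, q4⟩
  refine ⟨φ, hφ0, {a, p0, p1, p2, p3, p4}, ?_, ?_, ?_⟩
  · rw [card_insert_of_notMem k5, card_insert_of_notMem k4, card_insert_of_notMem k3,
      card_insert_of_notMem k2, card_insert_of_notMem k1, card_singleton]
  · rw [sum_insert k5, sum_insert k4, sum_insert k3, sum_insert k2, sum_insert k1, sum_singleton]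
    grind
  · intro b hb
    rw [mem_filter] at hb
    have hbW : b + a ∈ W := by rw [← hφ, map_add, hb.2, h2]
    obtain ⟨c, hc⟩ := hWm _ hbW
    have hbT := hb.1
    have eb := h2 b
    clear hb hbW hWm hφ k1 k2 k3 k4 k5
    simp only [mem_insert, mem_singleton]
    replace hc : c 0 • (x0 + x1) + c 1 • (x0 + x2) + c 2 • (x0 + x3) + c 3 • (x0 + x4) = b + a :=
      hc
    replace hc : b = a + (c 0 • (x0 + x1) + c 1 • (x0 + x2) + c 2 • (x0 + x3) + c 3 • (x0 + x4)) := by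
      rw [hc]; grind
    subst hc
    clear eb
    rcases zmod2_cases (c 0) with a0 | a0 <;> rcases zmod2_cases (c 1) with a1 | a1 <;>
      rcases zmod2_cases (c 2) with a2 | a2 <;> rcases zmod2_cases (c 3) with a3 | a3 <;>
      rw [a0, a1, a2, a3] at hbT ⊢ <;>
      simp only [zero_smul, one_smul, zero_add, add_zero] at hbT ⊢ <;>
      grind

end Five


section Final

open scoped Classical

variable {E : Type} [AddCommGroup E] [Module (ZMod 2) E] [Fintype E]

theorem card_filter_sub' (U : Submodule (ZMod 2) E) {k : ℕ} (hU : finrank (ZMod 2) U = k) (a : E) :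
    (univ.filter (fun x => a + x ∈ U)).card = 2 ^ k := by
  have h1 := card_sub U hU
  rw [Nat.card_eq_fintype_card, Fintype.card_subtype] at h1
  rw [← h1]
  apply Finset.card_bij (fun x _ => a + x)
  · intro x hx; simpa using hx
  · intro x _ y _ hxy; simpa using hxy
  · intro y hy
    exact ⟨a + y, by simpa [← add_assoc, h2] using hy, by simp [← add_assoc, h2]⟩

theorem hyper_inf3 (h5 : finrank (ZMod 2) E = 5) (H : Submodule (ZMod 2) E)
    (hH : finrank (ZMod 2) H = 3) (ψ : E →ₗ[ZMod 2] ZMod 2) {x : E} (hx : x ∈ H) (hψ : ψ x ≠ 0) :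
    finrank (ZMod 2) (H ⊓ LinearMap.ker ψ : Submodule (ZMod 2) E) = 2 := by
  have hk := finrank_ker (n := 4) h5 ψ (by rintro rfl; simp at hψ)
  have h1 := Submodule.finrank_sup_add_finrank_inf_eq H (LinearMap.ker ψ)
  have h3 := Submodule.finrank_le (H ⊔ LinearMap.ker ψ)
  have h4 : LinearMap.ker ψ < H ⊔ LinearMap.ker ψ := by
    refine lt_of_le_of_ne le_sup_right (fun he => hψ ?_)
    have : x ∈ H ⊔ LinearMap.ker ψ := Submodule.mem_sup_left hx
    rw [← he] at this
    exact this
  have h6 := Submodule.finrank_lt_finrank_of_lt h4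
  omega

theorem key (h5 : finrank (ZMod 2) E = 5) {T : Finset E} {A : E → Finset E} (hV : Valid T A)
    (hw8 : ∀ b ∈ T, (A b).card ≤ 8) (φ : E →ₗ[ZMod 2] ZMod 2) (hφ : φ ≠ 0)
    (V : Submodule (ZMod 2) E) (hV3 : finrank (ZMod 2) V = 3) (hVφ : ∀ v ∈ V, φ v = 0)
    (q : E) (hq : ∀ x, x ∉ T → φ x = φ q → q + x ∈ V) :
    ∑ b ∈ T, (A b).card + 32 ≤ 8 * T.card := by
  have hE := card_E h5
  have hk := finrank_ker (n := 4) h5 φ hφ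
  have hVk : V ≤ LinearMap.ker φ := fun v hv => hVφ v hv
  have hlt : V < LinearMap.ker φ := lt_of_le_of_ne hVk (fun h => by rw [h] at hV3; omega)
  obtain ⟨s, hs, hsV⟩ := SetLike.exists_of_lt hlt
  have hs0 : φ s = 0 := hs
  have hR : ∀ x, (q + s) + x ∈ V → x ∈ T := by
    intro x hx
    by_contra hxT
    have h1 := hVφ _ hx
    rw [map_add, map_add, hs0, add_zero] at h1
    have h3 := hq x hxT (add_eq_zero2.1 h1).symm
    apply hsV
    have := V.add_mem hx h3
    have e : q + s + x + (q + x) = s := by grind [h2 q, h2 x]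
    rwa [e] at this
  have hRT : univ.filter (fun x => (q + s) + x ∈ V) ⊆ T := fun x hx => hR x (mem_filter.1 hx).2
  have hRc := card_filter_sub V hV3 (q + s)
  have hR4 : ∀ b ∈ univ.filter (fun x => (q + s) + x ∈ V), (A b).card ≤ 4 := by
    intro b hb
    have := w_le_sub hV (hRT hb) V (by
      intro v hv
      apply hR
      rw [← add_assoc]
      exact V.add_mem (mem_filter.1 hb).2 hv)
    rw [card_sub V hV3, hE] at this
    omega
  rw [← Finset.sum_sdiff hRT]
  have b1 := sum_const_le hR4
  have b2 := sum_const_le (T := T \ univ.filter (fun x => (q + s) + x ∈ V)) (A := A) (k := 8)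
    (fun b hb => hw8 b (mem_sdiff.1 hb).1)
  rw [card_sdiff_of_subset hRT] at b2
  have := card_le_card hRT
  omega

/-- good points on the small side -/
theorem good_small (h5 : finrank (ZMod 2) E = 5) {T : Finset E} (φ : E →ₗ[ZMod 2] ZMod 2)
    (hφ : φ ≠ 0) {a : E}
    (h6 : (T.filter (fun b => φ b = φ a)).card = 6)
    (hs : ∑ b ∈ T.filter (fun b => φ b = φ a), b = 0) {b : E} (hb : b ∈ T) (hba : φ b = φ a)
    (hg : Good T b) :
    ∃ (P : Submodule (ZMod 2) E) (q : E), finrank (ZMod 2) P = 2 ∧ (∀ v ∈ P, φ v = 0) ∧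
      φ q = φ a + 1 ∧ (∀ x, q + x ∈ P → x ∉ T) ∧ ∀ v ∈ P, v ≠ 0 → b + v ∉ T := by
  obtain ⟨V, hV3, hV⟩ := hg
  have hex : ∃ p ∈ V, φ p = 1 := by
    by_contra hno
    push Not at hno
    have hle : V ≤ LinearMap.ker φ := fun v hv => (zmod2_cases _).resolve_right (hno v hv)
    obtain ⟨ψ, hψ⟩ := sep_of_lt hle hV3 (finrank_ker (n := 4) h5 φ hφ)
    have hmem : b ∈ T.filter (fun b => φ b = φ a) := mem_filter.2 ⟨hb, hba⟩
    have h1 : ∀ c ∈ (T.filter (fun b => φ b = φ a)).erase b, ψ c + ψ b = 1 := by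
      intro c hc
      rw [mem_erase, mem_filter] at hc
      rw [← map_add]
      refine (zmod2_cases _).resolve_left (fun h0 => ?_)
      have hk : c + b ∈ LinearMap.ker φ := by
        rw [LinearMap.mem_ker, map_add, hc.2.2, hba, h2]
      have := hV _ ((hψ _ hk).1 h0) (fun h => hc.1 (add_eq_zero2.1 h))
      apply this
      have e : b + (c + b) = c := by grind [h2 b]
      rw [e]; exact hc.2.1
    have h3 := Finset.sum_congr rfl h1
    rw [Finset.sum_add_distrib, Finset.sum_const, Finset.sum_const, card_erase_of_mem hmem, h6]
      at h3
    rw [← Finset.add_sum_erase _ _ hmem] at hs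
    have h4 := congrArg ψ hs
    rw [map_add, map_sum, map_zero] at h4
    have h7 := add_eq_zero2.1 h4
    rw [← h7] at h3
    rcases zmod2_cases (ψ b) with h' | h' <;> rw [h'] at h3 <;> exact absurd h3 (by decide)
  obtain ⟨p, hp, hp1⟩ := hex
  refine ⟨V ⊓ LinearMap.ker φ, b + p, hyper_inf3 h5 V hV3 φ hp (by rw [hp1]; decide),
    fun v hv => hv.2, by rw [map_add, hba, hp1], ?_, fun v hv hv0 => hV v hv.1 hv0⟩
  intro x hx
  have h1 : φ (b + p + x) = 0 := hx.2
  have h3 : b + x ∈ V := by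
    have := V.add_mem hx.1 hp
    have e : b + p + x + p = b + x := by grind [h2 p]
    rwa [e] at this
  have h4 : b + x ≠ 0 := by
    intro h0
    have e : b + p + x = p := by grind
    rw [e, hp1] at h1
    exact absurd h1 (by decide)
  have := hV _ h3 h4
  have e : b + (b + x) = x := by grind [h2 b]
  rwa [e] at this

theorem caseC2 (h5 : finrank (ZMod 2) E = 5) {T : Finset E} {A : E → Finset E} (hV : Valid T A)
    (hw8 : ∀ b ∈ T, (A b).card ≤ 8) (ht : 16 ≤ T.card) {a : E} (ha : a ∈ T)
    (hg : ¬ Good T a) (hw : 5 ≤ (A a).card) : ∑ a ∈ T, (A a).card ≤ 124 := by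
  have hE := card_E h5
  have hw6 : ∀ b ∈ T, ¬ Good T b → (A b).card ≤ 6 := by
    intro b hb hgb
    by_contra h
    have hS := not_good_sidon hV hb hgb (by omega)
    have h1 := not_good_count hV hb hS
    have h3 : 7 ≤ (A b).card := by omega
    have h4 := hw8 b hb
    generalize (A b).card = w at *
    interval_cases w <;> omega
  obtain ⟨φ, hφ, Q, hQ6, hQ0, hTQ⟩ := sidon_struct h5 hV ha (not_good_sidon hV ha hg hw) hw
  obtain ⟨e, he⟩ : ∃ e, φ e = 1 := LinearMap.surjective hφ 1
  have hT1 : T.filter (fun b => ¬ φ b = φ a) = T.filter (fun b => φ b = φ (a + e)) := by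
    apply Finset.filter_congr
    intro b _
    rw [map_add, he]
    rcases zmod2_cases (φ b) with h | h <;> rcases zmod2_cases (φ a) with h' | h' <;>
      rw [h, h'] <;> decide
  have hsum := Finset.sum_filter_add_sum_filter_not T (fun b => φ b = φ a) (fun b => (A b).card)
  have hcard := Finset.card_filter_add_card_filter_not (s := T) (fun b => φ b = φ a)
  rw [hT1] at hsum hcard
  set T0 := T.filter (fun b => φ b = φ a) with hT0d
  set T1 := T.filter (fun b => φ b = φ (a + e)) with hT1d
  have hk := finrank_ker (n := 4) h5 φ hφ
  have ht0 : T0.card ≤ 6 := hQ6 ▸ card_le_card hTQ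
  have hs1 : ∑ b ∈ T1, (A b).card ≤ 2 * 42 :=
    half hV φ hφ (a + e) 42 (fun T' A' hv _ => bound4 hk T' A' hv)
  have hs0 := sum_const_le (T := T0) (A := A) (k := 8) (fun b hb => hw8 b (mem_filter.1 hb).1)
  by_cases h12 : 12 ≤ T1.card
  · have : ∑ b ∈ T1, (A b).card ≤ 2 * 32 :=
      half hV φ hφ (a + e) 32 (fun T' A' hv hc => bound4_big hk T' A' hv (by
        rw [hc]; exact h12))
    omega
  by_cases h5' : T0.card ≤ 5
  · omega
  have h6 : T0.card = 6 := by omega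
  have hT0Q : T0 = Q := Finset.eq_of_subset_of_card_le hTQ (by omega)
  have hT0s : ∑ b ∈ T0, b = 0 := by rw [hT0Q]; exact hQ0
  have hgs := fun b (hb : b ∈ T0) (hgb : Good T b) =>
    good_small h5 φ hφ h6 hT0s (mem_filter.1 hb).1 (mem_filter.1 hb).2 hgb
  -- the complement on the other side
  set C1 := univ.filter (fun x => φ x = φ (a + e) ∧ x ∉ T) with hC1d
  have hC1 : C1.card + T1.card = 16 := by
    have h1 : (univ.filter (fun x => (a + e) + x ∈ LinearMap.ker φ)).card = 2 ^ 4 :=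
      card_filter_sub' _ hk _
    have h3 := Finset.card_filter_add_card_filter_not
      (s := univ.filter (fun x => (a + e) + x ∈ LinearMap.ker φ)) (fun x => x ∈ T)
    rw [h1, Finset.filter_filter, Finset.filter_filter] at h3
    have e1 : univ.filter (fun x => (a + e) + x ∈ LinearMap.ker φ ∧ x ∈ T) = T1 := by
      ext x
      simp only [hT1d, mem_filter, mem_univ, true_and, LinearMap.mem_ker]
      rw [map_add, add_eq_zero2, eq_comm, and_comm]
    have e3 : univ.filter (fun x => (a + e) + x ∈ LinearMap.ker φ ∧ ¬ x ∈ T) = C1 := by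
      ext x
      simp only [hC1d, mem_filter, mem_univ, true_and, LinearMap.mem_ker]
      rw [map_add, add_eq_zero2, eq_comm]
    rw [e1, e3] at h3
    omega
  have hφe : φ (a + e) = φ a + 1 := by rw [map_add, he]
  have hsubC : ∀ (P : Submodule (ZMod 2) E) (q : E), (∀ v ∈ P, φ v = 0) → φ q = φ a + 1 →
      (∀ x, q + x ∈ P → x ∉ T) → univ.filter (fun x => q + x ∈ P) ⊆ C1 := by
    intro P q h1 h3 h4 x hx
    rw [mem_filter] at hx
    refine mem_filter.2 ⟨mem_univ _, ?_, h4 x hx.2⟩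
    have := h1 _ hx.2
    rw [map_add] at this
    rw [← add_eq_zero2.1 this, h3, hφe]
  have hmain : ∀ (V : Submodule (ZMod 2) E) (z : E), finrank (ZMod 2) V = 3 →
      (∀ v ∈ V, φ v = 0) → z ∈ C1 → (∀ x ∈ C1, z + x ∈ V) → ∑ b ∈ T, (A b).card ≤ 124 := by
    intro V z h1 h3 hz h4
    have hz' := (mem_filter.1 hz).2.1
    have := key h5 hV hw8 φ hφ V h1 h3 z (fun x hx hxz => h4 x (mem_filter.2 ⟨mem_univ _,
      hxz.trans hz', hx⟩))
    omega
  by_cases hex : ∃ b ∈ T0, Good T b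
  swap
  · push Not at hex
    have := sum_const_le (T := T0) (A := A) (k := 6)
      (fun b hb => hw6 b (mem_filter.1 hb).1 (hex b hb))
    omega
  have h1011 : T1.card = 11 ∨ T1.card = 10 := by omega
  rcases h1011 with h11 | h10
  · obtain ⟨b, hb, hgb⟩ := hex
    obtain ⟨P, q, hP2, hPφ, hq, hqT, -⟩ := hgs b hb hgb
    have hsub := hsubC P q hPφ hq hqT
    have hc4 := card_filter_sub' P hP2 q
    have hc1 : (C1 \ univ.filter (fun x => q + x ∈ P)).card = 1 := by
      rw [card_sdiff_of_subset hsub, hc4]; omega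
    obtain ⟨r, hr⟩ := Finset.card_eq_one.1 hc1
    have hrm : r ∈ C1 \ univ.filter (fun x => q + x ∈ P) := by rw [hr]; exact mem_singleton_self r
    simp only [mem_sdiff, mem_filter, mem_univ, true_and] at hrm
    have hqC : q ∈ C1 := hsub (by simp [h2])
    have hrC := (mem_filter.1 hrm.1).2.1
    obtain ⟨hf, hm⟩ := sup_span P hrm.2
    refine hmain (P ⊔ Submodule.span (ZMod 2) {q + r}) q (by omega) ?_ hqC ?_
    · intro v hv
      rcases hm v hv with h | h
      · exact hPφ v h
      · have := hPφ _ h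
        rwa [map_add, map_add, hq, hrC, hφe, h2, zero_add] at this
    · intro x hx
      by_cases hxP : q + x ∈ P
      · exact Submodule.mem_sup_left hxP
      · have : x ∈ C1 \ univ.filter (fun x => q + x ∈ P) := by
          simp only [mem_sdiff, mem_filter, mem_univ, true_and]
          exact ⟨hx, hxP⟩
        rw [hr, mem_singleton] at this
        rw [this]
        exact Submodule.mem_sup_right (Submodule.mem_span_singleton_self _)
  · choose! P q hP2 hPφ hq hqT hbT using hgs
    by_cases hall : ∀ b ∈ T0, Good T b → ∀ b' ∈ T0, Good T b' → P b = P b'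
    · obtain ⟨b0, hb0, hgb0⟩ := hex
      have hG4 : (T0.filter (Good T)).card ≤ 4 := by
        have hinj : (T0.filter (Good T) ×ˢ univ.filter (fun v => 0 + v ∈ P b0)).card ≤
            (univ.filter (fun x => a + x ∈ LinearMap.ker φ)).card := by
          apply Finset.card_le_card_of_injOn (fun p => p.1 + p.2)
          · rintro ⟨b, v⟩ hp
            simp only [coe_product, Set.mem_prod, mem_coe, mem_filter, mem_univ, true_and,
              zero_add] at hp
            simp only [coe_filter, mem_univ, true_and, Set.mem_setOf_eq, LinearMap.mem_ker]
            rw [map_add, map_add, hPφ b0 hb0 hgb0 v hp.2, add_zero, (mem_filter.1 hp.1.1).2, h2]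
          · rintro ⟨b, v⟩ hp ⟨b', v'⟩ hp' heq
            simp only [coe_product, Set.mem_prod, mem_coe, mem_filter, mem_univ, true_and,
              zero_add] at hp hp' heq
            by_cases hbb : b = b'
            · subst hbb
              simpa using heq
            · exfalso
              have hm : v + v' ∈ P b := by
                rw [hall b hp.1.1 hp.1.2 b0 hb0 hgb0]
                exact (P b0).add_mem hp.2 hp'.2
              have hv0 : v + v' ≠ 0 := by
                intro h0
                rw [add_eq_zero2.1 h0] at heq
                exact hbb (add_right_cancel heq)
              have := hbT b hp.1.1 hp.1.2 _ hm hv0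
              have e1 : b + (v + v') = b' := by grind [h2 v']
              rw [e1] at this
              exact this (mem_filter.1 hp'.1.1).1
        rw [card_product, card_filter_sub' _ (hP2 b0 hb0 hgb0), card_filter_sub' _ hk] at hinj
        omega
      have b1 := sum_two_level (T := T0) (A := A) 6 2 (Good T)
        (fun b hb => hw8 b (mem_filter.1 hb).1)
        (fun b hb hgb => hw6 b (mem_filter.1 hb).1 hgb)
      have b2 := sum_const_le (T := T1) (A := A) (k := 8) (fun b hb => hw8 b (mem_filter.1 hb).1)
      omega
    · push Not at hall
      obtain ⟨b, hb, hgb, b', hb', hgb', hPP⟩ := hall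
      have f1 := hP2 b hb hgb
      have f2 := hP2 b' hb' hgb'
      have s1 := hsubC _ _ (hPφ b hb hgb) (hq b hb hgb) (hqT b hb hgb)
      have s2 := hsubC _ _ (hPφ b' hb' hgb') (hq b' hb' hgb') (hqT b' hb' hgb')
      have c1 := card_filter_sub' _ f1 (q b)
      have c2 := card_filter_sub' _ f2 (q b')
      have pφ := hPφ b hb hgb
      have pφ' := hPφ b' hb' hgb'
      generalize P b = P1 at *
      generalize P b' = P2 at *
      generalize q b = q1 at *
      generalize q b' = q2 at *
      set Q1 := univ.filter (fun x => q1 + x ∈ P1) with hQ1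
      set Q2 := univ.filter (fun x => q2 + x ∈ P2) with hQ2
      have hui := Finset.card_union_add_card_inter Q1 Q2
      have hsu : Q1 ∪ Q2 ⊆ C1 := Finset.union_subset s1 s2
      have hcu := card_le_card hsu
      have hi2 : 1 < (Q1 ∩ Q2).card := by omega
      obtain ⟨z, hz, y, hy, hzy⟩ := Finset.one_lt_card.1 hi2
      simp only [hQ1, hQ2, mem_inter, mem_filter, mem_univ, true_and] at hz hy
      have hP1 : ∀ x, q1 + x ∈ P1 → z + x ∈ P1 := fun x hx => by
        have := P1.add_mem hz.1 hx
        have e1 : q1 + z + (q1 + x) = z + x := by grind [h2 q1]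
        rwa [e1] at this
      have hP2 : ∀ x, q2 + x ∈ P2 → z + x ∈ P2 := fun x hx => by
        have := P2.add_mem hz.2 hx
        have e1 : q2 + z + (q2 + x) = z + x := by grind [h2 q2]
        rwa [e1] at this
      have hzy0 : z + y ≠ 0 := fun h0 => hzy (add_eq_zero2.1 h0)
      have hge : 1 ≤ finrank (ZMod 2) (P1 ⊓ P2 : Submodule (ZMod 2) E) := by
        rw [Submodule.one_le_finrank_iff]
        intro hbot
        have : z + y ∈ P1 ⊓ P2 := ⟨hP1 y hy.1, hP2 y hy.2⟩
        rw [hbot] at this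
        exact hzy0 (by simpa using this)
      have hlt : finrank (ZMod 2) (P1 ⊓ P2 : Submodule (ZMod 2) E) < 2 := by
        by_contra hcon
        have e1 : P1 ⊓ P2 = P1 := Submodule.eq_of_le_of_finrank_le inf_le_left (by omega)
        have e2 : P1 ⊓ P2 = P2 := Submodule.eq_of_le_of_finrank_le inf_le_right (by omega)
        exact hPP (e1.symm.trans e2)
      have hone : finrank (ZMod 2) (P1 ⊓ P2 : Submodule (ZMod 2) E) = 1 := by omega
      have hsup := Submodule.finrank_sup_add_finrank_inf_eq P1 P2
      have hinter : Q1 ∩ Q2 ⊆ univ.filter (fun x => z + x ∈ P1 ⊓ P2) := by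
        intro x hx
        simp only [hQ1, hQ2, mem_inter, mem_filter, mem_univ, true_and] at hx ⊢
        exact ⟨hP1 x hx.1, hP2 x hx.2⟩
      have hci := card_le_card hinter
      rw [card_filter_sub' _ hone] at hci
      have hCeq : Q1 ∪ Q2 = C1 := Finset.eq_of_subset_of_card_le hsu (by omega)
      refine hmain (P1 ⊔ P2) z (by omega) ?_ ?_ ?_
      · intro v hv
        obtain ⟨u, hu, w, hw, rfl⟩ := Submodule.mem_sup.1 hv
        rw [map_add, pφ u hu, pφ' w hw, add_zero]
      · apply s1
        simp [hQ1, hz.1]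
      · intro x hx
        rw [← hCeq, mem_union] at hx
        simp only [hQ1, hQ2, mem_filter, mem_univ, true_and] at hx
        rcases hx with hx | hx
        · exact Submodule.mem_sup_left (hP1 x hx)
        · exact Submodule.mem_sup_right (hP2 x hx)

theorem bound5 (h5 : finrank (ZMod 2) E = 5) (T : Finset E) (A : E → Finset E) (hV : Valid T A) :
    ∑ a ∈ T, (A a).card ≤ 124 := by
  have hE := card_E h5
  have htE := Finset.card_le_univ T
  by_cases hA : ∃ a ∈ T, 9 ≤ (A a).card
  · obtain ⟨a, ha, h9⟩ := hA
    exact caseA h5 hV ha h9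
  have hw8 : ∀ b ∈ T, (A b).card ≤ 8 := by
    intro b hb
    by_contra h
    exact hA ⟨b, hb, by omega⟩
  by_cases ht : 16 ≤ T.card
  swap
  · have := sum_const_le hw8
    omega
  by_cases hC : ∃ a ∈ T, ¬ Good T a ∧ 5 ≤ (A a).card
  · obtain ⟨a, ha, hg, hw⟩ := hC
    exact caseC2 h5 hV hw8 ht ha hg hw
  · by_cases hu : T.card = 32
    · have := bound_univ hV (by omega)
      omega
    · have h1 := lemmaA h5 T (T.filter (Good T)) (filter_subset _ _)
        (fun a ha => (mem_filter.1 ha).2) (by omega)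
      have h3 := sum_two_level (T := T) (A := A) 4 4 (Good T) hw8 (by
        intro a ha hg
        by_contra h
        exact hC ⟨a, ha, hg, by omega⟩)
      omega

end Final

section Reduction

def lo4 (s : ZMod 4) : ZMod 2 := ((s.val % 2 : ℕ) : ZMod 2)
def hi4 (s : ZMod 4) : ZMod 2 := ((s.val / 2 : ℕ) : ZMod 2)
def emb4 (a u : ZMod 2) : ZMod 4 := ((a.val + 2 * u.val : ℕ) : ZMod 4)

theorem emb4_lo_hi : ∀ s, emb4 (lo4 s) (hi4 s) = s := by decide
theorem lo4_emb : ∀ a u, lo4 (emb4 a u) = a := by decide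
theorem hi4_emb : ∀ a u, hi4 (emb4 a u) = u := by decide
theorem emb4_prog : ∀ a u v w : ZMod 2,
    emb4 a u + 2 • (emb4 (a + u + v) w - emb4 a u) = emb4 a v := by decide
theorem lo4_add : ∀ x d, lo4 (x + d) = lo4 x + lo4 d := by decide
theorem lo4_add2 : ∀ x d : ZMod 4, lo4 (x + 2 • d) = lo4 x := by decide
theorem hi4_add2 : ∀ x d : ZMod 4, hi4 (x + 2 • d) = hi4 x + lo4 d := by decide
theorem add2_of_lo : ∀ x d : ZMod 4, lo4 d = 0 → x + 2 • d = x := by decide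

variable {n : ℕ}

def lo (s : Fin n → ZMod 4) : Fin n → ZMod 2 := fun i => lo4 (s i)
def hi (s : Fin n → ZMod 4) : Fin n → ZMod 2 := fun i => hi4 (s i)
def emb (a u : Fin n → ZMod 2) : Fin n → ZMod 4 := fun i => emb4 (a i) (u i)

theorem emb_lo_hi (s : Fin n → ZMod 4) : emb (lo s) (hi s) = s :=
  funext fun _ => emb4_lo_hi _
theorem lo_emb (a u : Fin n → ZMod 2) : lo (emb a u) = a := funext fun _ => lo4_emb _ _
theorem hi_emb (a u : Fin n → ZMod 2) : hi (emb a u) = u := funext fun _ => hi4_emb _ _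
theorem emb_prog (a u v w : Fin n → ZMod 2) :
    emb a u + 2 • (emb (a + u + v) w - emb a u) = emb a v :=
  funext fun _ => emb4_prog _ _ _ _
theorem lo_add (x d : Fin n → ZMod 4) : lo (x + d) = lo x + lo d := funext fun _ => lo4_add _ _
theorem lo_add2 (x d : Fin n → ZMod 4) : lo (x + 2 • d) = lo x := funext fun _ => lo4_add2 _ _
theorem hi_add2 (x d : Fin n → ZMod 4) : hi (x + 2 • d) = hi x + lo d :=
  funext fun _ => hi4_add2 _ _
theorem add2_of_lo' (x d : Fin n → ZMod 4) (h : lo d = 0) : x + 2 • d = x :=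
  funext fun i => add2_of_lo _ _ (congrFun h i)

theorem card_formula (S : Finset (Fin n → ZMod 4)) (T : Finset (Fin n → ZMod 2))
    (A : (Fin n → ZMod 2) → Finset (Fin n → ZMod 2))
    (h : ∀ s, s ∈ S ↔ lo s ∈ T ∧ hi s ∈ A (lo s)) : S.card = ∑ a ∈ T, (A a).card := by
  rw [card_eq_sum_card_fiberwise (f := lo) (t := T) (fun s hs => ((h s).1 hs).1)]
  refine sum_congr rfl fun a ha => ?_
  refine card_bij' (fun s _ => hi s) (fun u _ => emb a u) ?_ ?_ ?_ ?_
  · intro s hs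
    rw [mem_filter] at hs
    have := ((h s).1 hs.1).2
    rwa [hs.2] at this
  · intro u hu
    rw [mem_filter, h, lo_emb, hi_emb]
    exact ⟨⟨ha, hu⟩, rfl⟩
  · intro s hs
    rw [mem_filter] at hs
    rw [← hs.2, emb_lo_hi]
  · intro u hu
    exact hi_emb _ _

theorem upper_of_valid (N : ℕ)
    (hB : ∀ (T : Finset (Fin n → ZMod 2)) (A : (Fin n → ZMod 2) → Finset (Fin n → ZMod 2)),
      Valid T A → ∑ a ∈ T, (A a).card ≤ N)
    (S : Finset (Fin n → ZMod 4)) (hS : ProgFree 4 3 S) : S.card ≤ N := by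
  classical
  have key := card_formula S (S.image lo) (fun a => univ.filter fun u => emb a u ∈ S) (by
    intro s
    constructor
    · intro hs
      refine ⟨mem_image_of_mem _ hs, ?_⟩
      rw [mem_filter, emb_lo_hi]
      exact ⟨mem_univ _, hs⟩
    · rintro ⟨-, h⟩
      rw [mem_filter, emb_lo_hi] at h
      exact h.2)
  rw [key]
  apply hB
  intro a _ u hu v hv huv hmem
  rw [mem_filter] at hu hv
  obtain ⟨s, hs, hlo⟩ := mem_image.1 hmem
  have hse : emb (a + u + v) (hi s) = s := by rw [← hlo, emb_lo_hi]
  have hp := emb_prog a u v (hi s)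
  rw [hse] at hp
  have hne : u + v ≠ 0 := fun h => huv (add_eq_zero2.1 h)
  have e0 : lo s ≠ a := by
    intro h
    rw [h, add_assoc] at hlo
    exact hne (by simpa using hlo.symm)
  have hd : ∀ i : Fin 3, emb a u + (i : ℕ) • (s - emb a u) = ![emb a u, s, emb a v] i := by
    intro i
    fin_cases i
    · simp
    · simp
    · simpa using hp
  apply hS
  refine ⟨emb a u, s - emb a u, ?_, ?_⟩
  · have n1 : emb a u ≠ s := fun h => e0 (by rw [← h, lo_emb])
    have n2 : emb a v ≠ s := fun h => e0 (by rw [← h, lo_emb])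
    have n3 : emb a u ≠ emb a v := fun h => huv (by rw [← hi_emb a u, h, hi_emb])
    intro i j hij
    simp only [hd] at hij
    fin_cases i <;> fin_cases j <;> simp_all
  · intro i
    rw [hd]
    fin_cases i
    · exact hu.2
    · exact hs
    · exact hv.2

theorem lower_of_valid (T : Finset (Fin n → ZMod 2))
    (A : (Fin n → ZMod 2) → Finset (Fin n → ZMod 2)) (hV : Valid T A) :
    ∃ S : Finset (Fin n → ZMod 4), ProgFree 4 3 S ∧ S.card = ∑ a ∈ T, (A a).card := by
  classical
  have hm : ∀ s, s ∈ (univ.filter fun s : Fin n → ZMod 4 => lo s ∈ T ∧ hi s ∈ A (lo s)) ↔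
      lo s ∈ T ∧ hi s ∈ A (lo s) := by simp
  refine ⟨_, ?_, card_formula _ T A hm⟩
  rintro ⟨x, d, hinj, hmem⟩
  have m0 := (hm _).1 (hmem 0)
  have m1 := (hm _).1 (hmem 1)
  have m2 := (hm _).1 (hmem 2)
  have v0 : ((0 : Fin 3) : ℕ) = 0 := rfl
  have v1 : ((1 : Fin 3) : ℕ) = 1 := rfl
  have v2 : ((2 : Fin 3) : ℕ) = 2 := rfl
  rw [v0, zero_smul, add_zero] at m0
  rw [v1, one_smul, lo_add] at m1
  rw [v2, lo_add2, hi_add2] at m2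
  have hd : lo d ≠ 0 := by
    intro h
    have : (0 : Fin 3) = 2 := hinj (by
      simp only [v0, v2, zero_smul, add_zero]
      exact (add2_of_lo' x d h).symm)
    exact absurd this (by decide)
  refine hV (lo x) m0.1 _ m0.2 _ m2.2 ?_ ?_
  · intro h
    exact hd (by simpa using h.symm)
  · have : lo x + hi x + (hi x + lo d) = lo x + lo d := by
      rw [add_assoc, ← add_assoc (hi x), h2, zero_add]
    rw [this]
    exact m1.1

theorem rAP_eq (N : ℕ)
    (hB : ∀ (T : Finset (Fin n → ZMod 2)) (A : (Fin n → ZMod 2) → Finset (Fin n → ZMod 2)),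
      Valid T A → ∑ a ∈ T, (A a).card ≤ N)
    (hL : ∃ (T : Finset (Fin n → ZMod 2)) (A : (Fin n → ZMod 2) → Finset (Fin n → ZMod 2)),
      Valid T A ∧ ∑ a ∈ T, (A a).card = N) : rAP 3 4 n = N := by
  obtain ⟨T, A, hV, hN⟩ := hL
  refine IsGreatest.csSup_eq ⟨?_, ?_⟩
  · obtain ⟨S, hS, hc⟩ := lower_of_valid T A hV
    exact ⟨S, hS, hc.trans hN⟩
  · rintro c ⟨S, hS, rfl⟩
    exact upper_of_valid N hB S hS

end Reduction

section Lower

variable {n : ℕ}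

def enc (a : Fin n → ZMod 2) : ℕ := ∑ i, (a i).val * 2 ^ (i : ℕ)

/-- Linear form with coefficient vector read off from bits of `c`. -/
def lform (c j : ℕ) (u : Fin n → ZMod 2) : ZMod 2 :=
  ∑ i : Fin n, if c.testBit (5 * j + i) then u i else 0

theorem lform_add (c j : ℕ) (u v : Fin n → ZMod 2) :
    lform c j (u + v) = lform c j u + lform c j v := by
  unfold lform
  rw [← sum_add_distrib]
  refine sum_congr rfl fun i _ => ?_
  split_ifs <;> simp

def famT (n mask : ℕ) : Finset (Fin n → ZMod 2) := univ.filter fun a => mask.testBit (enc a)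

def famA (n : ℕ) (tbl : List ℕ) (a : Fin n → ZMod 2) : Finset (Fin n → ZMod 2) :=
  univ.filter fun u => ∀ j : Fin 3, lform (tbl.getD (enc a) 0) j u = 0

theorem valid_fam (mask : ℕ) (tbl : List ℕ)
    (h : ∀ a ∈ famT n mask, ∀ u ∈ famA n tbl a, u ≠ 0 → a + u ∉ famT n mask) :
    Valid (famT n mask) (famA n tbl) := by
  intro a ha x hx z hz hxz
  rw [add_assoc]
  refine h a ha _ ?_ (fun e => hxz (add_eq_zero2.1 e))
  rw [famA, mem_filter] at *
  refine ⟨mem_univ _, fun j => ?_⟩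
  rw [lform_add, hx.2, hz.2, add_zero]

end Lower

theorem lower_all :
    (∃ (T : Finset (Fin 1 → ZMod 2)) (A : (Fin 1 → ZMod 2) → Finset (Fin 1 → ZMod 2)),
      Valid T A ∧ ∑ a ∈ T, (A a).card = 2) ∧
    (∃ (T : Finset (Fin 2 → ZMod 2)) (A : (Fin 2 → ZMod 2) → Finset (Fin 2 → ZMod 2)),
      Valid T A ∧ ∑ a ∈ T, (A a).card = 6) ∧
    (∃ (T : Finset (Fin 3 → ZMod 2)) (A : (Fin 3 → ZMod 2) → Finset (Fin 3 → ZMod 2)),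
      Valid T A ∧ ∑ a ∈ T, (A a).card = 16) ∧
    (∃ (T : Finset (Fin 4 → ZMod 2)) (A : (Fin 4 → ZMod 2) → Finset (Fin 4 → ZMod 2)),
      Valid T A ∧ ∑ a ∈ T, (A a).card = 42) ∧
    (∃ (T : Finset (Fin 5 → ZMod 2)) (A : (Fin 5 → ZMod 2) → Finset (Fin 5 → ZMod 2)),
      Valid T A ∧ ∑ a ∈ T, (A a).card = 124) := by
  refine ⟨⟨famT 1 1, famA 1 [0, 0], valid_fam _ _ ?_, ?_⟩,
    ⟨famT 2 13, famA 2 [2, 0, 3, 1], valid_fam _ _ ?_, ?_⟩,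
    ⟨famT 3 225, famA 3 [4, 0, 0, 0, 0, 6, 5, 7], valid_fam _ _ ?_, ?_⟩,
    ⟨famT 4 65249, famA 4 [260, 0, 0, 0, 0, 262, 261, 263, 0, 324, 292, 356, 4161, 418, 449,
      419], valid_fam _ _ ?_, ?_⟩,
    ⟨famT 5 4276623105, famA 5 [520, 0, 0, 0, 0, 0, 0, 0, 527, 513, 514, 0, 516, 0, 0, 0, 0, 0,
      0, 648, 0, 584, 552, 263, 0, 582, 549, 655, 547, 591, 559, 10433],
      valid_fam _ _ ?_, ?_⟩⟩ <;> decide +kernel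

end AP

theorem stmt0 :
    rAP 3 4 1 = 2 ∧ rAP 3 4 2 = 6 ∧ rAP 3 4 3 = 16 ∧ rAP 3 4 4 = 42 ∧
      rAP 3 4 5 = 124 := by
  obtain ⟨l1, l2, l3, l4, l5⟩ := AP.lower_all
  exact ⟨AP.rAP_eq 2 (AP.bound1 (by simp)) l1, AP.rAP_eq 6 (AP.bound2 (by simp)) l2,
    AP.rAP_eq 16 (AP.bound3 (by simp)) l3, AP.rAP_eq 42 (AP.bound4 (by simp)) l4,
    AP.rAP_eq 124 (AP.bound5 (by simp)) l5⟩
end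

section
/- The following lower bounds hold: 344 ≤ r_3(ℤ_4^6), 960 ≤ r_3(ℤ_4^7), 2832 ≤ r_3(ℤ_4^8), 7880 ≤ r_3(ℤ_4^9), and 22232 ≤ r_3(ℤ_4^{10}). -/
/-- There is a binary code of length `m`, size `c` and minimal distance at least `d`. -/
def HasCode (m d c : ℕ) : Prop :=
  ∃ g : ℕ → Fin m → Bool, ∀ i < c, ∀ j < c, i ≠ j →
    d ≤ (Finset.univ.filter fun t => g i t ≠ g j t).card

lemma HasCode.of_list (m d : ℕ) (L : List ℕ)
    (h : ∀ i < L.length, ∀ j < i,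
      d ≤ (List.finRange m).countP
        (fun t : Fin m => Nat.testBit (L.getD i 0) t != Nat.testBit (L.getD j 0) t)) :
    HasCode m d L.length := by
  have key : ∀ i < L.length, ∀ j < i, d ≤ (Finset.univ.filter fun t : Fin m =>
      Nat.testBit (L.getD i 0) t ≠ Nat.testBit (L.getD j 0) t).card := by
    intro i hi j hj
    have h1 := h i hi j hj
    rw [List.countP_eq_length_filter] at h1
    refine h1.trans ?_
    rw [← List.toFinset_card_of_nodup ((List.nodup_finRange m).filter _)]
    apply Finset.card_le_card
    intro t ht
    simpa using ht
  refine ⟨fun i t => Nat.testBit (L.getD i 0) t, ?_⟩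
  intro i hi j hj hij
  rcases lt_or_gt_of_ne hij with hlt | hlt
  · have := key j hj i hlt
    simpa only [ne_comm] using this
  · exact key i hi j hlt

/-- Codes supported on the complement of `T`. -/
lemma HasCode.compl {n d c : ℕ} (T : Finset (Fin n)) (h : HasCode (n - T.card) d c) :
    ∃ g : ℕ → Fin n → Bool, (∀ i, ∀ t ∈ T, g i t = false) ∧ ∀ i < c, ∀ j < c, i ≠ j →
      d ≤ (Finset.univ.filter fun t => g i t ≠ g j t).card := by
  obtain ⟨g, hg⟩ := h
  have hc : (Tᶜ).card = n - T.card := by simp [Finset.card_compl]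
  let e := Finset.equivFinOfCardEq hc
  refine ⟨fun i t => if h : t ∈ Tᶜ then g i (e ⟨t, h⟩) else false, ?_, ?_⟩
  · intro i t ht
    simp [ht]
  · intro i hi j hj hij
    refine (hg i hi j hj hij).trans ?_
    apply Finset.card_le_card_of_injOn (fun s => (e.symm s).1)
    · intro s hs
      have h2 : (e.symm s).1 ∈ Tᶜ := (e.symm s).2
      have hs' : g i s ≠ g j s := by simpa using hs
      simp only [Finset.coe_filter, Finset.mem_univ, true_and, Set.mem_ofPred_eq]
      rw [dif_pos h2, dif_pos h2]
      simpa using hs'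
    · intro s _ s' _ hss
      exact e.symm.injective (Subtype.ext hss)

/-- The point with ones on `T` and twos on the support of `u` off `T`. -/
def pt {n : ℕ} (T : Finset (Fin n)) (u : Fin n → Bool) : Fin n → ZMod 4 :=
  fun t => if t ∈ T then 1 else if u t then 2 else 0

lemma aux_zmod : ∀ x d : ZMod 4, (x + 2 * d = 1 ↔ x = 1) ∨ x = 3 ∨ x + 2 * d = 3 := by decide

lemma aux_same : ∀ x d : ZMod 4, x = 1 → x + 2 * d = 1 → x + d ≠ 3 → x + d = 1 := by decide

lemma aux_diff : ∀ x d : ZMod 4, x ≠ x + 2 * d → x ≠ 1 → x ≠ 3 → x + d ≠ 3 → x + d = 1 := by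
  decide

lemma pt_ne_three {n : ℕ} (T : Finset (Fin n)) (u : Fin n → Bool) (t : Fin n) :
    pt T u t ≠ 3 := by
  unfold pt
  split_ifs <;> decide

lemma pt_eq_one {n : ℕ} (T : Finset (Fin n)) (u : Fin n → Bool) (t : Fin n) :
    pt T u t = 1 ↔ t ∈ T := by
  unfold pt
  split_ifs with h1 h2
  · simp [h1]
  · simp only [h1, iff_false]; decide
  · simp only [h1, iff_false]; decide

lemma pt_ne_of_ne {n : ℕ} (T : Finset (Fin n)) (u v : Fin n → Bool) (t : Fin n)
    (ht : t ∉ T) (h : u t ≠ v t) : pt T u t ≠ pt T v t := by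
  unfold pt
  rw [if_neg ht, if_neg ht]
  cases hu : u t <;> cases hv : v t <;> simp_all <;> decide

lemma le_rAP {n : ℕ} (S : Finset (Fin n → ZMod 4)) (h : ProgFree 4 3 S) :
    S.card ≤ rAP 3 4 n := by
  apply le_csSup
  · refine ⟨Fintype.card (Fin n → ZMod 4), ?_⟩
    rintro c ⟨S, -, rfl⟩
    exact Finset.card_le_univ S
  · exact ⟨S, h, rfl⟩

lemma main_construction (n k N : ℕ) (c : ℕ → ℕ)
    (h : ∀ w ≤ k, HasCode (n - w) (k + 1 - w) (c w))
    (hN : N ≤ ∑ w ∈ Finset.range (k + 1), n.choose w * c w) : N ≤ rAP 3 4 n := by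
  classical
  have h' : ∀ T : Finset (Fin n), ∃ g : ℕ → Fin n → Bool, T.card ≤ k →
      (∀ i, ∀ t ∈ T, g i t = false) ∧ ∀ i < c T.card, ∀ j < c T.card, i ≠ j →
      k + 1 - T.card ≤ (Finset.univ.filter fun t => g i t ≠ g j t).card := by
    intro T
    by_cases hT : T.card ≤ k
    · obtain ⟨g, hg⟩ := HasCode.compl T (h _ hT)
      exact ⟨g, fun _ => hg⟩
    · exact ⟨fun _ _ => false, fun h => absurd h hT⟩
  choose g hg using h'
  let P : Finset (Finset (Fin n)) := Finset.univ.filter fun T => T.card ≤ k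
  let I : Finset ((_ : Finset (Fin n)) × ℕ) := P.sigma fun T => Finset.range (c T.card)
  let f : ((_ : Finset (Fin n)) × ℕ) → (Fin n → ZMod 4) := fun p => pt p.1 (g p.1 p.2)
  have hPm : ∀ T, T ∈ P ↔ T.card ≤ k := by intro T; simp [P]
  have hIm : ∀ p, p ∈ I ↔ p.1.card ≤ k ∧ p.2 < c p.1.card := by
    intro p; simp [I, Finset.mem_sigma, hPm]
  -- distinct words of one code differ at many places off `T`
  have hdis : ∀ T : Finset (Fin n), T.card ≤ k → ∀ i j t, g T i t ≠ g T j t → t ∉ T := by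
    intro T hT i j t hne ht
    exact hne (by rw [(hg T hT).1 i t ht, (hg T hT).1 j t ht])
  have hinj : Set.InjOn f I := by
    rintro ⟨T, i⟩ hp ⟨T', j⟩ hq hpq
    rw [Finset.mem_coe, hIm] at hp hq
    have hTT : T = T' := by
      ext t
      rw [← pt_eq_one T (g T i) t, ← pt_eq_one T' (g T' j) t]
      have := congrFun hpq t
      simp only [f] at this
      rw [this]
    subst hTT
    by_cases hij : i = j
    · rw [hij]
    · exfalso
      have h1 := (hg T hp.1).2 i hp.2 j hq.2 hij
      have hp1 := hp.1
      simp only at hp1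
      obtain ⟨t, ht⟩ := Finset.card_pos.mp (show 0 < _ from lt_of_lt_of_le (by omega) h1)
      have ht' : g T i t ≠ g T j t := by simpa using ht
      exact pt_ne_of_ne T _ _ t (hdis T hp.1 i j t ht') ht' (congrFun hpq t)
  have hfree : ProgFree 4 3 (I.image f) := by
    rintro ⟨x, d, hxi, hmem⟩
    have m0 := hmem 0
    have m1 := hmem 1
    have m2 := hmem 2
    have hne : x ≠ x + 2 * d := by
      intro he
      have : (0 : Fin 3) = 2 := hxi (by simpa [two_mul, two_nsmul] using he)
      exact absurd this (by decide)
    have e0 : x + ((0 : Fin 3) : ℕ) • d = x := by simp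
    have e1 : x + ((1 : Fin 3) : ℕ) • d = x + d := by simp
    have e2 : x + ((2 : Fin 3) : ℕ) • d = x + 2 * d := by simp
    rw [e0] at m0
    rw [e1] at m1
    rw [e2] at m2
    obtain ⟨⟨T, i⟩, hp, hx⟩ := Finset.mem_image.mp m0
    obtain ⟨⟨T1, l⟩, hr, hy⟩ := Finset.mem_image.mp m1
    obtain ⟨⟨T', j⟩, hq, hz⟩ := Finset.mem_image.mp m2
    rw [hIm] at hp hq hr
    simp only [f] at hx hy hz hp hq hr
    have hx' : ∀ t, pt T (g T i) t = x t := fun t => congrFun hx t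
    have hy' : ∀ t, pt T1 (g T1 l) t = x t + d t := fun t => congrFun hy t
    have hz' : ∀ t, pt T' (g T' j) t = x t + 2 * d t := fun t => congrFun hz t
    have hTT : T = T' := by
      ext t
      rw [← pt_eq_one T (g T i) t, ← pt_eq_one T' (g T' j) t, hx', hz']
      have a1 := pt_ne_three T (g T i) t
      have a2 := pt_ne_three T' (g T' j) t
      rw [hx'] at a1
      rw [hz'] at a2
      rcases aux_zmod (x t) (d t) with a | a | a
      · exact a.symm
      · exact absurd a a1
      · exact absurd a a2
    subst hTT
    have hij : i ≠ j := by
      rintro rfl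
      exact hne (hx.symm.trans hz)
    have h1 := (hg T hp.1).2 i hp.2 j hq.2 hij
    set D := Finset.univ.filter fun t => g T i t ≠ g T j t with hD
    have hDT : Disjoint T D := by
      rw [Finset.disjoint_right]
      intro t ht
      exact hdis T hp.1 i j t (by simpa [hD] using ht)
    have hsub : T ∪ D ⊆ T1 := by
      intro t ht
      rw [← pt_eq_one T1 (g T1 l) t, hy']
      have b3 := pt_ne_three T1 (g T1 l) t
      rw [hy'] at b3
      rcases Finset.mem_union.mp ht with ht | ht
      · refine aux_same _ _ ?_ ?_ b3
        · rw [← hx']; exact (pt_eq_one _ _ _).mpr ht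
        · rw [← hz']; exact (pt_eq_one _ _ _).mpr ht
      · have htne : g T i t ≠ g T j t := by simpa [hD] using ht
        have htT := hdis T hp.1 i j t htne
        refine aux_diff _ _ ?_ ?_ ?_ b3
        · rw [← hz', ← hx']; exact pt_ne_of_ne T _ _ t htT htne
        · rw [← hx']; exact fun hh => htT ((pt_eq_one _ _ _).mp hh)
        · rw [← hx']; exact pt_ne_three _ _ _
    have hcard := Finset.card_le_card hsub
    rw [Finset.card_union_of_disjoint hDT] at hcard
    have := hp.1
    have := hr.1
    omega
  refine le_trans ?_ (le_rAP _ hfree)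
  rw [Finset.card_image_of_injOn hinj]
  refine hN.trans (le_of_eq ?_)
  have hI : I.card = ∑ T ∈ P, c T.card := by simp [I, Finset.card_sigma]
  have hmaps : ∀ T ∈ P, T.card ∈ Finset.range (k + 1) := by
    intro T hT
    rw [hPm] at hT
    exact Finset.mem_range.mpr (by omega)
  rw [hI, ← Finset.sum_fiberwise_of_maps_to hmaps]
  refine Finset.sum_congr rfl fun w hw => ?_
  have hfib : P.filter (fun T => T.card = w) = Finset.powersetCard w Finset.univ := by
    ext T
    rw [Finset.mem_filter, hPm, Finset.mem_powersetCard]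
    have := Finset.mem_range.mp hw
    constructor
    · rintro ⟨_, h2⟩
      exact ⟨Finset.subset_univ _, h2⟩
    · rintro ⟨_, h2⟩
      exact ⟨by omega, h2⟩
  rw [Finset.sum_congr rfl (g := fun _ => c w)
    (fun T hT => by rw [(Finset.mem_filter.mp hT).2]), hfib]
  simp

lemma code_6_3 : HasCode 6 3 8 :=
  HasCode.of_list 6 3 [1, 14, 20, 27, 34, 45, 55, 56] (by decide +kernel)

lemma code_7_4 : HasCode 7 4 8 :=
  HasCode.of_list 7 4 [3, 29, 40, 54, 68, 90, 111, 113] (by decide +kernel)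

lemma code_7_3 : HasCode 7 3 16 :=
  HasCode.of_list 7 3 [1, 15, 22, 24, 36, 42, 51, 61, 66, 76, 85, 91, 103, 105, 112, 126] (by decide +kernel)

lemma code_8_4 : HasCode 8 4 16 :=
  HasCode.of_list 8 4 [3, 30, 45, 48, 72, 85, 102, 123, 132, 153, 170, 183, 207, 210, 225, 252] (by decide +kernel)

lemma code_10_5 : HasCode 10 5 12 :=
  HasCode.of_list 10 5 [95, 146, 225, 294, 313, 460, 517, 618, 700, 848, 907, 1015] (by decide +kernel)

lemma code_9_4 : HasCode 9 4 20 :=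
  HasCode.of_list 9 4 [20, 27, 66, 101, 126, 129, 166, 184, 221, 243, 306, 317, 335, 337,
    360, 396, 407, 427, 474, 500] (by decide +kernel)

lemma code_8_3 : HasCode 8 3 20 :=
  HasCode.of_list 8 3 [10, 13, 33, 50, 63, 64, 83, 92, 110, 121, 153, 158, 167, 168, 180,
    198, 203, 213, 237, 250] (by decide +kernel)

lemma code_4_1 : HasCode 4 1 16 :=
  HasCode.of_list 4 1 (List.range 16) (by decide +kernel)

lemma code_5_1 : HasCode 5 1 32 :=
  HasCode.of_list 5 1 (List.range 32) (by decide +kernel)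

lemma code_6_1 : HasCode 6 1 64 :=
  HasCode.of_list 6 1 (List.range 64) (by decide +kernel)

lemma code_5_2 : HasCode 5 2 16 :=
  HasCode.of_list 5 2 ((List.range 16).map fun i => i ^^^ (2 * i)) (by decide +kernel)

lemma code_6_2 : HasCode 6 2 32 :=
  HasCode.of_list 6 2 ((List.range 32).map fun i => i ^^^ (2 * i)) (by decide +kernel)

lemma code_7_2 : HasCode 7 2 64 :=
  HasCode.of_list 7 2 ((List.range 64).map fun i => i ^^^ (2 * i)) (by decide +kernel)

theorem stmt3 :
    344 ≤ rAP 3 4 6 ∧ 960 ≤ rAP 3 4 7 ∧ 2832 ≤ rAP 3 4 8 ∧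
      7880 ≤ rAP 3 4 9 ∧ 22232 ≤ rAP 3 4 10 := by
  refine ⟨?_, ?_, ?_, ?_, ?_⟩
  · refine main_construction 6 2 344 (fun w => [8, 16, 16].getD w 0) ?_ (by decide)
    intro w hw
    interval_cases w
    · exact code_6_3
    · exact code_5_2
    · exact code_4_1
  · refine main_construction 7 3 960 (fun w => [8, 8, 16, 16].getD w 0) ?_ (by decide)
    intro w hw
    interval_cases w
    · exact code_7_4
    · exact code_6_3
    · exact code_5_2
    · exact code_4_1
  · refine main_construction 8 3 2832 (fun w => [16, 16, 32, 32].getD w 0) ?_ (by decide)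
    intro w hw
    interval_cases w
    · exact code_8_4
    · exact code_7_3
    · exact code_6_2
    · exact code_5_1
  · refine main_construction 9 3 7880 (fun w => [20, 20, 64, 64].getD w 0) ?_ (by decide)
    intro w hw
    interval_cases w
    · exact code_9_4
    · exact code_8_3
    · exact code_7_2
    · exact code_6_1
  · refine main_construction 10 4 22232 (fun w => [12, 20, 20, 64, 64].getD w 0) ?_ (by decide)
    intro w hw
    interval_cases w
    · exact code_10_5
    · exact code_9_4
    · exact code_8_3
    · exact code_7_2
    · exact code_6_1
end

section
/- For sets without a proper arithmetic progression of length 4 in (ℤ/4ℤ)^n the following exact values hold: r_4(ℤ_4^1) = 3, r_4(ℤ_4^2) = 10, r_4(ℤ_4^3) = 36, and r_4(ℤ_4^4) = 128. -/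
/-! ### A verified backtracking search -/

/-- Bit `p` of `oddMask v` is the parity of `p &&& v`. -/
def oddMask (v : ℕ) : ℕ :=
  (43690 * (v % 2)) ^^^ (52428 * (v / 2 % 2)) ^^^ (61680 * (v / 4 % 2)) ^^^
    (65280 * (v / 8 % 2))

structure Item where
  v : ℕ
  o : ℕ
  z : ℕ
  d : ℕ

def updItem (p z : ℕ) (i : Item) : Item :=
  ⟨i.v, i.o, i.z, bif i.o.testBit p then i.d &&& z else i.d⟩

def dead : List Item → ℕ → Bool
  | [], _ => false
  | i :: l, k => bif i.d.beq 0 then (match k with | 0 => true | k+1 => dead l k) else dead l k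

def search : ℕ → List Item → ℕ → Bool
  | 0, _, _ => true
  | _+1, [], _ => true
  | f+1, i :: l, k =>
    bif dead (i::l) k then false else
    (match k with | 0 => false | k+1 => search f l k) ||
    (List.range 16).any fun p => i.d.testBit p && search f (l.map (updItem p i.z)) k

def startOrder : List ℕ := [3, 5, 9, 15, 7, 11, 13, 2, 4, 8, 14, 6, 10, 12]

def mkItem (v : ℕ) : Item :=
  ⟨v, oddMask v, 65535 ^^^ oddMask v,
    bif v.testBit 0 then oddMask v &&& (65535 ^^^ oddMask 1) else oddMask v⟩

theorem search_start : search 20 (startOrder.map mkItem) 3 = false := by decide +kernel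

theorem dead_sound (bad : ℕ → Bool) (g : ℕ → ℕ) : ∀ (l : List Item) (k : ℕ),
    (∀ i ∈ l, bad i.v = false → i.d.testBit (g i.v) = true) →
    l.countP (fun i => bad i.v) ≤ k → dead l k = false := by
  intro l
  induction l with
  | nil => intro k _ _; rfl
  | cons i l ih =>
    intro k h1 h2
    have h1' : ∀ j ∈ l, bad j.v = false → j.d.testBit (g j.v) = true :=
      fun j hj => h1 j (List.mem_cons_of_mem _ hj)
    rw [List.countP_cons] at h2
    unfold dead
    by_cases hd : i.d = 0
    · have hb : bad i.v = true := by
        by_contra hb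
        have := h1 i List.mem_cons_self (by simpa using hb)
        simp [hd] at this
      rw [if_pos hb] at h2
      have : i.d.beq 0 = true := by simp [hd]
      rw [this]
      cases k with
      | zero => omega
      | succ k => exact ih k h1' (by omega)
    · have : i.d.beq 0 = false := by
        cases h : i.d.beq 0
        · rfl
        · exact absurd (Nat.eq_of_beq_eq_true h) hd
      rw [this]
      exact ih k h1' (by omega)

theorem search_sound (bad : ℕ → Bool) (g : ℕ → ℕ) (hg : ∀ v, g v < 16) :
    ∀ (f : ℕ) (l : List Item) (k : ℕ),
    (∀ i ∈ l, bad i.v = false → i.d.testBit (g i.v) = true) →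
    (∀ i ∈ l, ∀ j ∈ l, bad i.v = false → bad j.v = false → i.v ≠ j.v →
      j.o.testBit (g i.v) = true → i.z.testBit (g j.v) = true) →
    (l.map Item.v).Nodup →
    l.countP (fun i => bad i.v) ≤ k → search f l k = true := by
  intro f
  induction f with
  | zero => intros; rfl
  | succ f ih =>
    intro l k h1 h2 h3 h4
    cases l with
    | nil => rfl
    | cons i l =>
      unfold search
      rw [dead_sound bad g _ _ h1 h4, cond_false, Bool.or_eq_true]
      rw [List.countP_cons] at h4
      rw [List.map_cons, List.nodup_cons] at h3
      cases hb : bad i.v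
      · right
        rw [List.any_eq_true]
        refine ⟨g i.v, List.mem_range.2 (hg _), ?_⟩
        rw [Bool.and_eq_true]
        refine ⟨h1 i List.mem_cons_self hb, ?_⟩
        apply ih
        · intro j hj hbj
          rw [List.mem_map] at hj
          obtain ⟨j, hj, rfl⟩ := hj
          have hbj' : bad j.v = false := hbj
          have hne : i.v ≠ j.v := by
            intro h; apply h3.1; rw [h]; exact List.mem_map_of_mem hj
          have hd := h1 j (List.mem_cons_of_mem _ hj) hbj'
          change (bif j.o.testBit (g i.v) then j.d &&& i.z else j.d).testBit (g j.v) = true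
          cases ho : j.o.testBit (g i.v)
          · simpa using hd
          · have := h2 i List.mem_cons_self j (List.mem_cons_of_mem _ hj) hb hbj' hne ho
            simp [hd, this]
        · intro a ha b hb'
          rw [List.mem_map] at ha hb'
          obtain ⟨a, ha, rfl⟩ := ha
          obtain ⟨b, hb', rfl⟩ := hb'
          exact h2 a (List.mem_cons_of_mem _ ha) b (List.mem_cons_of_mem _ hb')
        · rw [List.map_map]; exact h3.2
        · rw [List.countP_map]
          change l.countP (fun i => bad i.v) ≤ k
          omega
      · left
        rw [if_pos hb] at h4
        cases k with
        | zero => omega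
        | succ k =>
          exact ih l k (fun j hj => h1 j (List.mem_cons_of_mem _ hj))
            (fun a ha b hb => h2 a (List.mem_cons_of_mem _ ha) b (List.mem_cons_of_mem _ hb))
            h3.2 (by omega)

/-! ### Linear functionals -/

abbrev V (n : ℕ) := Fin n → ZMod 2

def decV (w : ℕ) : V 4 := fun i => if w.testBit i then 1 else 0

def encC (c : V 4) : ℕ := (c 0).val + 2 * (c 1).val + 4 * (c 2).val + 8 * (c 3).val

theorem encC_lt (c : V 4) : encC c < 16 := by
  have h : ∀ a : ZMod 2, a.val < 2 := fun a => ZMod.val_lt a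
  have := h (c 0); have := h (c 1); have := h (c 2); have := h (c 3)
  unfold encC; omega

theorem odd_enc : ∀ c : V 4, ∀ w ∈ List.range 16,
    (oddMask w).testBit (encC c) = decide (∑ i, decV w i * c i = 1) := by
  decide +kernel

theorem odd_compl : ∀ w ∈ List.range 16, ∀ p ∈ List.range 16,
    (65535 ^^^ oddMask w).testBit p = !(oddMask w).testBit p := by
  decide +kernel

theorem dual_apply (φ : V 4 →ₗ[ZMod 2] ZMod 2) (x : V 4) :
    φ x = ∑ i, x i * φ (Pi.single i 1) := by
  conv_lhs => rw [pi_eq_sum_univ' x]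
  simp

def encD (φ : V 4 →ₗ[ZMod 2] ZMod 2) : ℕ := encC fun i => φ (Pi.single i 1)

theorem encD_lt (φ : V 4 →ₗ[ZMod 2] ZMod 2) : encD φ < 16 := encC_lt _

theorem odd_dual (φ : V 4 →ₗ[ZMod 2] ZMod 2) (w : ℕ) (hw : w < 16) :
    (oddMask w).testBit (encD φ) = decide (φ (decV w) = 1) := by
  rw [encD, odd_enc _ w (List.mem_range.2 hw), dual_apply φ]

theorem z2 : ∀ a : ZMod 2, a = 0 ∨ a = 1 := by decide

theorem decV_inj : ∀ v ∈ List.range 16, ∀ w ∈ List.range 16, decV v = decV w → v = w := by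
  decide +kernel

/-- normalised system is impossible -/
theorem no_system_norm (B : Finset (V 4)) (hB : B.card ≤ 3)
    (φ : V 4 → V 4 →ₗ[ZMod 2] ZMod 2)
    (h1 : ∀ v, v ∉ B → v ≠ 0 → φ v v = 1)
    (h2 : ∀ v w, v ∉ B → w ∉ B → v ≠ 0 → w ≠ 0 → v ≠ w → φ v w = 0 ∨ φ w v = 0)
    (h3 : decV 1 ∉ B) (h4 : ∀ x, φ (decV 1) x = x 0) : False := by
  have key : search 20 (startOrder.map mkItem) 3 = true := by
    have hlt : ∀ v ∈ startOrder, v < 16 := by decide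
    have hne0 : ∀ v ∈ startOrder, decV v ≠ 0 := by decide
    have hne1 : ∀ v ∈ startOrder, decV v ≠ decV 1 := by decide
    have h01 : decV 1 ≠ 0 := by decide
    apply search_sound (fun v => decide (decV v ∈ B)) (fun v => encD (φ (decV v)))
      (fun v => encC_lt _)
    · intro i hi hb
      rw [List.mem_map] at hi
      obtain ⟨v, hv, rfl⟩ := hi
      have hb' : decV v ∉ B := by simpa [mkItem] using hb
      have e1 : (oddMask v).testBit (encD (φ (decV v))) = true := by
        rw [odd_dual _ _ (hlt v hv)]
        simpa using h1 _ hb' (hne0 v hv)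
      change (bif v.testBit 0 then oddMask v &&& (65535 ^^^ oddMask 1) else oddMask v).testBit
        (encD (φ (decV v))) = true
      cases hv0 : v.testBit 0
      · simpa using e1
      · have e2 : (65535 ^^^ oddMask 1).testBit (encD (φ (decV v))) = true := by
          rw [odd_compl 1 (by decide) _ (List.mem_range.2 (encD_lt _)),
            odd_dual _ _ (by norm_num)]
          have h5 := h2 _ _ hb' h3 (hne0 v hv) h01 (hne1 v hv)
          rw [h4] at h5
          have h6 : decV v 0 = 1 := by simp [decV, hv0]
          rw [h6] at h5
          simp at h5
          simp [h5]
        rw [cond_true, Nat.testBit_and, e1, e2]; rfl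
    · intro i hi j hj hbi hbj hne ho
      rw [List.mem_map] at hi hj
      obtain ⟨v, hv, rfl⟩ := hi
      obtain ⟨w, hw, rfl⟩ := hj
      have hbi' : decV v ∉ B := by simpa [mkItem] using hbi
      have hbj' : decV w ∉ B := by simpa [mkItem] using hbj
      change (oddMask w).testBit (encD (φ (decV v))) = true at ho
      change (65535 ^^^ oddMask v).testBit (encD (φ (decV w))) = true
      have hne' : v ≠ w := hne
      rw [odd_dual _ _ (hlt w hw)] at ho
      rw [odd_compl v (List.mem_range.2 (hlt v hv)) _ (List.mem_range.2 (encD_lt _)),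
        odd_dual _ _ (hlt v hv)]
      have h5 := h2 _ _ hbi' hbj' (hne0 v hv) (hne0 w hw)
        (fun h => hne' (decV_inj v (List.mem_range.2 (hlt v hv)) w
          (List.mem_range.2 (hlt w hw)) h))
      have ho' : φ (decV v) (decV w) = 1 := by simpa using ho
      rw [ho'] at h5
      simp at h5
      simp [h5]
    · decide
    · rw [List.countP_map]
      change startOrder.countP (fun v => decide (decV v ∈ B)) ≤ 3
      refine le_trans ?_ hB
      have hnd : (startOrder.map decV).Nodup := by decide
      rw [List.countP_eq_length_filter]
      have hnd2 : ((startOrder.filter (fun v => decide (decV v ∈ B))).map decV).Nodup :=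
        hnd.sublist (List.Sublist.map _ List.filter_sublist)
      have := List.toFinset_card_of_nodup hnd2
      rw [List.length_map] at this
      rw [← this]
      apply Finset.card_le_card
      intro x hx
      simp only [List.mem_toFinset, List.mem_map, List.mem_filter, decide_eq_true_eq] at hx
      obtain ⟨v, ⟨_, hv⟩, rfl⟩ := hx
      exact hv
  rw [search_start] at key
  exact Bool.noConfusion key

theorem exists_equiv (v : V 4) (φ : V 4 →ₗ[ZMod 2] ZMod 2) (h : φ v = 1) :
    ∃ L : V 4 ≃ₗ[ZMod 2] V 4, L (decV 1) = v ∧ ∀ x, φ (L x) = x 0 := by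
  have hsurj : LinearMap.range φ = ⊤ := by
    rw [LinearMap.range_eq_top]
    intro a
    exact ⟨a • v, by simp [h]⟩
  have hr : Module.finrank (ZMod 2) (LinearMap.ker φ) = 3 := by
    have := LinearMap.finrank_range_add_finrank_ker φ
    rw [hsurj] at this
    simp at this
    omega
  let b := Module.finBasisOfFinrankEq (ZMod 2) (LinearMap.ker φ) hr
  let L0 : V 4 →ₗ[ZMod 2] V 4 :=
    { toFun := fun x => x 0 • v + ∑ i : Fin 3, x i.succ • (b i : V 4)
      map_add' := by
        intro x y
        simp only [Pi.add_apply, add_smul, Finset.sum_add_distrib]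
        abel
      map_smul' := by
        intro c x
        simp only [Pi.smul_apply, smul_eq_mul, mul_smul, Finset.smul_sum, smul_add,
          RingHom.id_apply] }
  have hφ : ∀ x, φ (L0 x) = x 0 := by
    intro x
    change φ (x 0 • v + ∑ i : Fin 3, x i.succ • (b i : V 4)) = x 0
    have hk : ∀ i, φ (b i : V 4) = 0 := fun i => (b i).2
    simp [h, hk]
  have hinj : Function.Injective L0 := by
    rw [← LinearMap.ker_eq_bot, LinearMap.ker_eq_bot']
    intro x hx
    have h0 : x 0 = 0 := (hφ x).symm.trans (by rw [hx, map_zero])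
    have hs : ∑ i : Fin 3, x i.succ • b i = 0 := by
      apply Subtype.ext
      have : x 0 • v + ∑ i : Fin 3, x i.succ • (b i : V 4) = 0 := hx
      rw [h0, zero_smul, zero_add] at this
      simpa using this
    have := (Fintype.linearIndependent_iff.1 b.linearIndependent) (fun i => x i.succ) hs
    funext i
    refine Fin.cases h0 (fun i => this i) i
  refine ⟨LinearEquiv.ofInjectiveEndo L0 hinj, ?_, ?_⟩
  · rw [LinearEquiv.coe_ofInjectiveEndo]
    change decV 1 0 • v + ∑ i : Fin 3, decV 1 i.succ • (b i : V 4) = v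
    have e0 : decV 1 0 = 1 := by decide
    have e1 : ∀ i : Fin 3, decV 1 i.succ = 0 := by decide
    simp [e0, e1]
  · intro x
    rw [LinearEquiv.coe_ofInjectiveEndo]
    exact hφ x

theorem no_system (B : Finset (V 4)) (hB : B.card ≤ 3)
    (φ : V 4 → V 4 →ₗ[ZMod 2] ZMod 2)
    (h1 : ∀ v, v ∉ B → v ≠ 0 → φ v v = 1)
    (h2 : ∀ v w, v ∉ B → w ∉ B → v ≠ 0 → w ≠ 0 → v ≠ w → φ v w = 0 ∨ φ w v = 0) :
    False := by
  obtain ⟨v, hv⟩ : ∃ v, v ∉ insert (0 : V 4) B := by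
    by_contra hcon
    push Not at hcon
    have : (insert (0 : V 4) B) = Finset.univ := Finset.eq_univ_iff_forall.2 hcon
    have h := Finset.card_insert_le (0 : V 4) B
    rw [this] at h
    simp at h
    omega
  rw [Finset.mem_insert, not_or] at hv
  obtain ⟨L, hL1, hL2⟩ := exists_equiv v (φ v) (h1 v hv.2 hv.1)
  have hne : ∀ x, x ≠ 0 → L x ≠ 0 := fun x hx h => hx (by simpa using h)
  refine no_system_norm (B.map L.symm.toEquiv.toEmbedding) (by simpa using hB)
    (fun w => (φ (L w)).comp L.toLinearMap) ?_ ?_ ?_ ?_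
  · intro w hw hw0
    have : L w ∉ B := by
      intro hc; apply hw; rw [Finset.mem_map]; exact ⟨L w, hc, by simp⟩
    exact h1 _ this (hne _ hw0)
  · intro w w2 hw hw' h0 h0' hww
    have a : L w ∉ B := by
      intro hc; apply hw; rw [Finset.mem_map]; exact ⟨L w, hc, by simp⟩
    have a2 : L w2 ∉ B := by
      intro hc; apply hw'; rw [Finset.mem_map]; exact ⟨L w2, hc, by simp⟩
    exact h2 _ _ a a2 (hne _ h0) (hne _ h0') (fun h => hww (L.injective h))
  · rw [Finset.mem_map]
    rintro ⟨x, hx, hx2⟩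
    have : L (L.symm x) = L (decV 1) := congrArg L hx2
    rw [L.apply_symm_apply, hL1] at this
    exact hv.2 (this ▸ hx)
  · intro x
    change φ (L (decV 1)) (L x) = x 0
    rw [hL1, hL2]

/-! ### Sets avoiding differences -/

theorem V_add_self {n : ℕ} (x : V n) : x + x = 0 := by
  funext i
  have : ∀ a : ZMod 2, a + a = 0 := by decide
  exact this _

theorem half_bound {n : ℕ} (T : Finset (V n)) (e : V n)
    (h : ∀ y, y ∈ T → y + e ∉ T) : 2 * T.card ≤ 2 ^ n := by
  have hd : Disjoint T (T.image (· + e)) := by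
    rw [Finset.disjoint_left]
    intro y hy hy2
    rw [Finset.mem_image] at hy2
    obtain ⟨z, hz, rfl⟩ := hy2
    exact h z hz hy
  have hc : (T.image (· + e)).card = T.card :=
    Finset.card_image_of_injective _ (add_left_injective e)
  have := Finset.card_le_univ (T ∪ T.image (· + e))
  rw [Finset.card_union_of_disjoint hd, hc] at this
  simp at this
  omega

theorem five_bound (T : Finset (V 4)) (a b c d e : V 4)
    (ha : ∀ y, y ∈ T → y + a ∉ T) (hb : ∀ y, y ∈ T → y + b ∉ T)
    (hc : ∀ y, y ∈ T → y + c ∉ T) (hd : ∀ y, y ∈ T → y + d ∉ T)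
    (he : ∀ y, y ∈ T → y + e ∉ T) (hs : a + b + c + d + e = 0) : T.card ≤ 6 := by
  have hsum : ∀ s : V 4, ∑ x : V 4, (if x + s ∈ T then 1 else 0) = T.card := by
    intro s
    rw [← Equiv.sum_comp (Equiv.addRight s).symm]
    simp
  have hpt : ∀ x : V 4, (if x + 0 ∈ T then 1 else 0) + (if x + a ∈ T then 1 else 0)
      + (if x + (a + b) ∈ T then 1 else 0) + (if x + (a + b + c) ∈ T then 1 else 0)
      + (if x + (a + b + c + d) ∈ T then 1 else 0) ≤ 2 := by
    intro x
    have h1 := ha x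
    have h2 := hb (x + a)
    have h3 := hc (x + (a + b))
    have h4 := hd (x + (a + b + c))
    have h5 := he (x + (a + b + c + d))
    rw [show x + a + b = x + (a + b) by abel] at h2
    rw [show x + (a + b) + c = x + (a + b + c) by abel] at h3
    rw [show x + (a + b + c) + d = x + (a + b + c + d) by abel] at h4
    rw [show x + (a + b + c + d) + e = x by rw [add_assoc, hs, add_zero]] at h5
    rw [add_zero]
    split_ifs <;> simp_all
  have := Finset.sum_le_sum (fun x (_ : x ∈ (Finset.univ : Finset (V 4))) => hpt x)
  simp only [Finset.sum_add_distrib, hsum] at this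
  simp at this
  omega

theorem exists_functional (T : Finset (V 4)) (hT : 7 ≤ T.card) :
    ∃ φ : V 4 →ₗ[ZMod 2] ZMod 2, ∀ e, (∀ y, y ∈ T → y + e ∉ T) → φ e = 1 := by
  by_cases hN : ∃ a, (∀ y, y ∈ T → y + a ∉ T)
  swap
  · push Not at hN
    refine ⟨0, fun e he => ?_⟩
    obtain ⟨y, hy, hy2⟩ := hN e
    exact absurd hy2 (he y hy)
  obtain ⟨a, ha⟩ := hN
  let s : Set (V 4) := {x | ∃ b, (∀ y, y ∈ T → y + b ∉ T) ∧ x = a + b}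
  by_cases hmem : a ∈ Submodule.span (ZMod 2) s
  · exfalso
    obtain ⟨f, hf1, hf2, -⟩ := Submodule.exists_fun_fin_finrank_span_eq (ZMod 2) s
    have hk : Module.finrank (ZMod 2) (Submodule.span (ZMod 2) s) ≤ 4 := by
      have := Submodule.finrank_le (Submodule.span (ZMod 2) s)
      simpa using this
    rw [← hf2, Submodule.mem_span_range_iff_exists_fun] at hmem
    obtain ⟨c, hc⟩ := hmem
    generalize Module.finrank (ZMod 2) (Submodule.span (ZMod 2) s) = k at *
    -- five elements
    have hx : ∀ i, ∀ y, y ∈ T → y + (a + c i • f i) ∉ T := by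
      intro i
      obtain ⟨b, hb, hfb⟩ := hf1 i
      rcases z2 (c i) with h | h
      · rw [h]; simpa using ha
      · rw [h, hfb, one_smul, ← add_assoc, V_add_self, zero_add]; exact hb
    let g : ℕ → V 4 := fun j => if h : j < k then c ⟨j, h⟩ • f ⟨j, h⟩ else 0
    have hg : ∀ j, ∀ y, y ∈ T → y + (a + g j) ∉ T := by
      intro j
      by_cases h : j < k
      · simp only [g, dif_pos h]; exact hx _
      · simp only [g, dif_neg h]; simpa using ha
    have hgs : g 0 + g 1 + g 2 + g 3 = a := by
      have e1 : ∑ j ∈ Finset.range 4, g j = ∑ j ∈ Finset.range k, g j := by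
        symm
        apply Finset.sum_subset
        · intro x; simp; omega
        · intro x _ hx
          simp only [Finset.mem_range] at hx
          simp only [g, dif_neg hx]
      have e2 : ∑ j ∈ Finset.range k, g j = a := by
        rw [Finset.sum_range, ← hc]
        apply Finset.sum_congr rfl
        intro i _
        simp [g]
      rw [← e2, ← e1]
      simp [Finset.sum_range_succ]
    have := five_bound T a (a + g 0) (a + g 1) (a + g 2) (a + g 3) ha (hg 0) (hg 1) (hg 2)
      (hg 3) (by
        have : a + (a + g 0) + (a + g 1) + (a + g 2) + (a + g 3)
          = (a + a) + (a + a) + (a + (g 0 + g 1 + g 2 + g 3)) := by abel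
        rw [this, hgs]; simp only [V_add_self, add_zero])
    omega
  · obtain ⟨φ, h1, h2⟩ := Submodule.exists_dual_map_eq_bot_of_notMem hmem inferInstance
    refine ⟨φ, fun e he => ?_⟩
    have h3 : φ (a + e) = 0 := by
      have : φ (a + e) ∈ (Submodule.span (ZMod 2) s).map φ :=
        Submodule.mem_map_of_mem (Submodule.subset_span ⟨e, he, rfl⟩)
      rw [h2] at this
      simpa using this
    rw [map_add] at h3
    have h4 : φ a = 1 := (z2 _).resolve_left h1
    rw [h4] at h3
    have : ∀ t : ZMod 2, 1 + t = 0 → t = 1 := by decide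
    exact this _ h3

/-! ### The combinatorial condition -/

def Cond {n : ℕ} (T : V n → Finset (V n)) : Prop :=
  ∀ u v, u ≠ v → (∀ y, y ∈ T u → y + (u + v) ∉ T u) ∨ (∀ z, z ∈ T v → z + (u + v) ∉ T v)

theorem cond_big {n : ℕ} {T : V n → Finset (V n)} (h : Cond T) {u : V n}
    (hu : 2 ^ n < 2 * (T u).card) {v : V n} (hv : v ≠ u) :
    ∀ z, z ∈ T v → z + (u + v) ∉ T v := by
  rcases h u v hv.symm with h | h
  · have := half_bound _ _ h; omega
  · exact h

theorem cond_bound {n : ℕ} {T : V n → Finset (V n)} (h : Cond T) :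
    2 * ∑ u, (T u).card ≤ 2 ^ n * (2 ^ n + 1) := by
  rw [Finset.mul_sum]
  by_cases hb : ∃ u, 2 ^ n < 2 * (T u).card
  · obtain ⟨u, hu⟩ := hb
    rw [← Finset.add_sum_erase _ _ (Finset.mem_univ u)]
    have h1 : 2 * (T u).card ≤ 2 * 2 ^ n := by
      have := Finset.card_le_univ (T u)
      simp at this; omega
    have h2 : ∑ v ∈ Finset.univ.erase u, 2 * (T v).card ≤ (2 ^ n - 1) * 2 ^ n := by
      have := Finset.sum_le_card_nsmul (Finset.univ.erase u) (fun v => 2 * (T v).card) (2 ^ n)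
        (fun v hv => half_bound _ _ (cond_big h hu (Finset.ne_of_mem_erase hv)))
      rw [Finset.card_erase_of_mem (Finset.mem_univ u)] at this
      simpa using this
    have hp : 1 ≤ 2 ^ n := Nat.one_le_two_pow
    obtain ⟨m, hm⟩ : ∃ m, 2 ^ n = m + 1 := ⟨2 ^ n - 1, by omega⟩
    rw [hm] at h1 h2 ⊢
    rw [Nat.add_sub_cancel] at h2
    nlinarith
  · push Not at hb
    have := Finset.sum_le_card_nsmul Finset.univ (fun v => 2 * (T v).card) (2 ^ n)
      (fun v _ => hb v)
    simp at this
    nlinarith [Nat.zero_le (2 ^ n)]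

theorem cond_bound4 {T : V 4 → Finset (V 4)} (h : Cond T) : ∑ u, (T u).card ≤ 128 := by
  by_contra hlt
  push Not at hlt
  have hb : ∃ u, 2 ^ 4 < 2 * (T u).card := by
    by_contra hb
    push Not at hb
    have := Finset.sum_le_card_nsmul Finset.univ (fun v => (T v).card) 8
      (fun v _ => by have := hb v; omega)
    simp at this
    omega
  obtain ⟨u, hu⟩ := hb
  choose φ hφ using fun v : V 4 =>
    (show ∃ φ : V 4 →ₗ[ZMod 2] ZMod 2, 7 ≤ (T v).card →
        ∀ e, (∀ y, y ∈ T v → y + e ∉ T v) → φ e = 1 by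
      by_cases hv : 7 ≤ (T v).card
      · obtain ⟨φ, h⟩ := exists_functional (T v) hv
        exact ⟨φ, fun _ => h⟩
      · exact ⟨0, fun h => absurd h hv⟩)
  have huu : ∀ v, u + (u + v) = v := fun v => by rw [← add_assoc, V_add_self, zero_add]
  let B : Finset (V 4) := Finset.univ.filter fun v => (T (u + v)).card < 7
  refine no_system B ?_ (fun v => φ (u + v)) ?_ ?_
  · have e1 : ∑ v, (T (u + v)).card = ∑ v, (T v).card :=
      Equiv.sum_comp (Equiv.addLeft u) (fun v => (T v).card)
    have e2 : ∀ v : V 4, (T (u + v)).card + (if (T (u + v)).card < 7 then 2 else 0)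
        ≤ 8 + (if v = 0 then 8 else 0) := by
      intro v
      by_cases hv : v = 0
      · subst hv
        have := Finset.card_le_univ (T (u + 0))
        simp at this hu
        simp only [add_zero]
        split_ifs <;> simp at * <;> omega
      · have := half_bound _ _ (cond_big h hu (v := u + v) (by simpa using hv))
        rw [if_neg hv]
        split_ifs <;> omega
    have e3 := Finset.sum_le_sum (fun v (_ : v ∈ (Finset.univ : Finset (V 4))) => e2 v)
    rw [Finset.sum_add_distrib, Finset.sum_add_distrib, e1, ← Finset.sum_filter,
      Finset.sum_const] at e3
    simp at e3
    change _ + B.card * 2 ≤ _ at e3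
    omega
  · intro v hv hv0
    have hv' : 7 ≤ (T (u + v)).card := by simpa [B] using hv
    have := cond_big h hu (v := u + v) (by simpa using hv0)
    rw [huu] at this
    exact hφ _ hv' _ this
  · intro v w hv hw hv0 hw0 hvw
    have hv' : 7 ≤ (T (u + v)).card := by simpa [B] using hv
    have hw' : 7 ≤ (T (u + w)).card := by simpa [B] using hw
    have a1 := cond_big h hu (v := u + v) (by simpa using hv0)
    have a2 := cond_big h hu (v := u + w) (by simpa using hw0)
    rw [huu] at a1 a2
    have b1 := hφ _ hv' _ a1
    have b2 := hφ _ hw' _ a2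
    have hs : u + v + (u + w) = v + w := by
      rw [show u + v + (u + w) = (u + u) + (v + w) by abel, V_add_self, zero_add]
    have ht : ∀ s t : ZMod 2, s + t = 1 → s = 1 → t = 0 := by decide
    rcases h (u + v) (u + w) (by simpa using hvw) with h | h
    · left
      rw [hs] at h
      have := hφ _ hv' _ h
      rw [map_add] at this
      exact ht _ _ this b1
    · right
      rw [hs] at h
      have := hφ _ hw' _ h
      rw [map_add, add_comm] at this
      exact ht _ _ this b2

/-! ### Translation to `ZMod 4` -/

def mk4 (a b : ZMod 2) : ZMod 4 := (a.val : ZMod 4) + 2 * (b.val : ZMod 4)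

def mkG {n : ℕ} (u y : V n) : Fin n → ZMod 4 := fun i => mk4 (u i) (y i)

theorem mk4_bij : (∀ a b a2 b2, mk4 a b = mk4 a2 b2 → a = a2 ∧ b = b2) ∧
    ∀ x, ∃ a b, mk4 a b = x := by decide

theorem mk4_two : ∀ a b a2 b2, mk4 a b + 2 * (mk4 a2 b2 - mk4 a b) = mk4 a (b + (a + a2)) := by
  decide

theorem mk4_three : ∀ a b a2 b2,
    mk4 a b + 3 * (mk4 a2 b2 - mk4 a b) = mk4 a2 (b2 + (a + a2)) := by
  decide

theorem mkG_inj {n : ℕ} {u y u2 y2 : V n} (h : mkG u y = mkG u2 y2) : u = u2 ∧ y = y2 :=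
  ⟨funext fun i => (mk4_bij.1 _ _ _ _ (congrFun h i)).1,
    funext fun i => (mk4_bij.1 _ _ _ _ (congrFun h i)).2⟩

theorem mkG_surj {n : ℕ} (x : Fin n → ZMod 4) : ∃ u y, mkG u y = x := by
  choose a b h using fun i => mk4_bij.2 (x i)
  exact ⟨a, b, funext h⟩

theorem mkG_two {n : ℕ} (u y v z : V n) :
    mkG u y + 2 • (mkG v z - mkG u y) = mkG u (y + (u + v)) := by
  funext i
  have := mk4_two (u i) (y i) (v i) (z i)
  simpa [mkG] using this

theorem mkG_three {n : ℕ} (u y v z : V n) :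
    mkG u y + 3 • (mkG v z - mkG u y) = mkG v (z + (u + v)) := by
  funext i
  have := mk4_three (u i) (y i) (v i) (z i)
  simpa [mkG] using this

noncomputable def mkE (n : ℕ) : V n × V n ≃ (Fin n → ZMod 4) :=
  Equiv.ofBijective (fun p => mkG p.1 p.2)
    ⟨fun p q h => Prod.ext (mkG_inj h).1 (mkG_inj h).2,
      fun x => by obtain ⟨u, y, h⟩ := mkG_surj x; exact ⟨(u, y), h⟩⟩

def fib {n : ℕ} (S : Finset (Fin n → ZMod 4)) (u : V n) : Finset (V n) :=
  Finset.univ.filter fun y => mkG u y ∈ S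

theorem card_fib {n : ℕ} (S : Finset (Fin n → ZMod 4)) : S.card = ∑ u, (fib S u).card := by
  have h1 : S.card = ∑ x : Fin n → ZMod 4, if x ∈ S then 1 else 0 := by simp
  rw [h1, ← Equiv.sum_comp (mkE n), Fintype.sum_prod_type]
  apply Finset.sum_congr rfl
  intro u _
  rw [fib, Finset.card_filter]
  rfl

theorem V_add_ne {n : ℕ} {u v : V n} (h : u ≠ v) : u + v ≠ 0 := by
  intro hc
  apply h
  have : u + v + v = v := by rw [hc, zero_add]
  rwa [add_assoc, V_add_self, add_zero] at this

theorem progFree_iff {n : ℕ} (S : Finset (Fin n → ZMod 4)) :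
    ProgFree 4 4 S ↔ Cond (fib S) := by
  constructor
  · intro h u v huv
    by_contra hc
    push Not at hc
    obtain ⟨⟨y, hy, hy2⟩, ⟨z, hz, hz2⟩⟩ := hc
    simp only [fib, Finset.mem_filter, Finset.mem_univ, true_and] at hy hy2 hz hz2
    have huv' := V_add_ne huv
    apply h
    have t0 : mkG u y + 0 • (mkG v z - mkG u y) = mkG u y := by simp
    have t1 : mkG u y + 1 • (mkG v z - mkG u y) = mkG v z := by simp
    refine ⟨mkG u y, mkG v z - mkG u y, ?_, ?_⟩
    · intro i j hij
      have n1 : mkG u y ≠ mkG v z := fun h => huv (mkG_inj h).1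
      have n2 : mkG u y ≠ mkG u (y + (u + v)) := fun h => huv' (by simpa using (mkG_inj h).2)
      have n3 : mkG u y ≠ mkG v (z + (u + v)) := fun h => huv (mkG_inj h).1
      have n4 : mkG v z ≠ mkG u (y + (u + v)) := fun h => huv (mkG_inj h).1.symm
      have n5 : mkG v z ≠ mkG v (z + (u + v)) := fun h => huv' (by simpa using (mkG_inj h).2)
      have n6 : mkG u (y + (u + v)) ≠ mkG v (z + (u + v)) := fun h => huv (mkG_inj h).1
      fin_cases i <;> fin_cases j <;> first | rfl | skip
      all_goals
        exfalso
        change mkG u y + _ • (mkG v z - mkG u y) = mkG u y + _ • (mkG v z - mkG u y) at hij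
        simp only [t0, t1, mkG_two, mkG_three] at hij
        first
          | exact n1 hij | exact n2 hij | exact n3 hij | exact n4 hij | exact n5 hij
          | exact n6 hij | exact n1 hij.symm | exact n2 hij.symm | exact n3 hij.symm
          | exact n4 hij.symm | exact n5 hij.symm | exact n6 hij.symm
    · intro i
      fin_cases i
      · change mkG u y + 0 • _ ∈ S
        rw [t0]; exact hy
      · change mkG u y + 1 • _ ∈ S
        rw [t1]; exact hz
      · change mkG u y + 2 • _ ∈ S
        rw [mkG_two]; exact hy2
      · change mkG u y + 3 • _ ∈ S
        rw [mkG_three]; exact hz2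
  · rintro h ⟨x, d, hinj, hmem⟩
    obtain ⟨u, y, rfl⟩ := mkG_surj x
    obtain ⟨v, z, hvz⟩ := mkG_surj (mkG u y + d)
    have hd : d = mkG v z - mkG u y := by rw [hvz]; abel
    subst hd
    have m0 : mkG u y + 0 • (mkG v z - mkG u y) ∈ S := hmem 0
    have m1 : mkG u y + 1 • (mkG v z - mkG u y) ∈ S := hmem 1
    have m2 : mkG u y + 2 • (mkG v z - mkG u y) ∈ S := hmem 2
    have m3 : mkG u y + 3 • (mkG v z - mkG u y) ∈ S := hmem 3
    rw [zero_smul, add_zero] at m0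
    rw [one_smul, add_sub_cancel] at m1
    rw [mkG_two] at m2
    rw [mkG_three] at m3
    have huv : u ≠ v := by
      rintro rfl
      have : (0 : Fin 4) = 2 := by
        apply hinj
        change mkG u y + 0 • (mkG u z - mkG u y) = mkG u y + 2 • (mkG u z - mkG u y)
        rw [mkG_two, V_add_self, add_zero, zero_smul, add_zero]
      exact absurd this (by decide)
    rcases h u v huv with h | h
    · exact h y (by simpa [fib] using m0) (by simpa [fib] using m2)
    · exact h z (by simpa [fib] using m1) (by simpa [fib] using m3)

/-! ### Constructions -/

def linT {n : ℕ} (c : V n → V n) (u : V n) : Finset (V n) :=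
  Finset.univ.filter fun y => ∑ i, y i * c u i = 0

theorem linT_cond {n : ℕ} (c : V n → V n)
    (h : ∀ u v, u ≠ v → ∑ i, (u + v) i * c u i ≠ 0 ∨ ∑ i, (u + v) i * c v i ≠ 0) :
    Cond (linT c) := by
  have key : ∀ (u e : V n), ∑ i, e i * c u i ≠ 0 → ∀ y, y ∈ linT c u → y + e ∉ linT c u := by
    intro u e he y hy hy2
    simp only [linT, Finset.mem_filter, Finset.mem_univ, true_and, Pi.add_apply, add_mul,
      Finset.sum_add_distrib] at hy hy2
    rw [hy, zero_add] at hy2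
    exact he hy2
  intro u v huv
  rcases h u v huv with h | h
  · exact Or.inl (key _ _ h)
  · exact Or.inr (key _ _ h)

theorem exists_of_cond {n : ℕ} (T : V n → Finset (V n)) (h : Cond T) :
    ∃ S : Finset (Fin n → ZMod 4), ProgFree 4 4 S ∧ S.card = ∑ u, (T u).card := by
  let S : Finset (Fin n → ZMod 4) :=
    (Finset.univ.filter fun p : V n × V n => p.2 ∈ T p.1).map (mkE n).toEmbedding
  have hf : fib S = T := by
    funext u
    ext y
    simp only [fib, Finset.mem_filter, Finset.mem_univ, true_and, S, Finset.mem_map]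
    constructor
    · rintro ⟨p, hp, hp2⟩
      have := mkG_inj (u := p.1) (y := p.2) hp2
      rw [← this.1, ← this.2]; exact hp
    · intro hy
      exact ⟨(u, y), hy, rfl⟩
  refine ⟨S, ?_, ?_⟩
  · rw [progFree_iff, hf]; exact h
  · rw [card_fib, hf]

def encN {n : ℕ} (u : V n) : ℕ := ∑ i : Fin n, 2 ^ (i : ℕ) * (u i).val

def tabC (n : ℕ) (l : List ℕ) (u : V n) : V n :=
  fun i => if (l.getD (encN u) 0).testBit i then 1 else 0

theorem rAP_eq {n c : ℕ} (hub : ∀ T : V n → Finset (V n), Cond T → ∑ u, (T u).card ≤ c)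
    (l : List ℕ)
    (h1 : ∀ u v : V n, u ≠ v →
      ∑ i, (u + v) i * tabC n l u i ≠ 0 ∨ ∑ i, (u + v) i * tabC n l v i ≠ 0)
    (h2 : ∑ u, (linT (tabC n l) u).card = c) : rAP 4 4 n = c := by
  apply IsGreatest.csSup_eq
  constructor
  · obtain ⟨S, hS, hc⟩ := exists_of_cond _ (linT_cond _ h1)
    exact ⟨S, hS, hc.trans h2⟩
  · rintro _ ⟨S, hS, rfl⟩
    rw [card_fib]
    exact hub _ ((progFree_iff S).1 hS)

theorem stmt4 :
    rAP 4 4 1 = 3 ∧ rAP 4 4 2 = 10 ∧ rAP 4 4 3 = 36 ∧ rAP 4 4 4 = 128 := by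
  refine ⟨?_, ?_, ?_, ?_⟩
  · exact rAP_eq (fun T hT => by have := cond_bound hT; omega) [0, 1]
      (by decide +kernel) (by decide +kernel)
  · exact rAP_eq (fun T hT => by have := cond_bound hT; omega) [0, 3, 2, 1]
      (by decide +kernel) (by decide +kernel)
  · exact rAP_eq (fun T hT => by have := cond_bound hT; omega) [0, 7, 6, 5, 4, 1, 3, 2]
      (by decide +kernel) (by decide +kernel)
  · exact rAP_eq (fun T hT => cond_bound4 hT)
      [8, 7, 2, 1, 14, 11, 13, 4, 4, 13, 11, 14, 1, 2, 7, 8]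
      (by decide +kernel) (by decide +kernel)
end

section
/- Let p be a prime, s ≥ 3 an integer, m = p^s and k = p^{s−2} + 1. Then there exist constants C > 0 and c with 0 < c ≤ m/2 such that for all n ≥ 1: r_k(ℤ_m^n) ≥ C · (m − 2p² + 2p)^n / n^c. -/
/-- Integers whose residue modulo `p^(t+1)` is an allowed digit. -/
def GoodZ (p t : ℕ) (z : ℤ) : Prop :=
  (∀ v : ℤ, 1 ≤ v → v < p → ¬ ((p : ℤ) ^ (t + 1) ∣ z - v)) ∧
  ((p : ℤ) ^ t ∣ z → (p : ℤ) ^ (t + 1) ∣ z)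

lemma goodZ_congr {p t : ℕ} {y z : ℤ} (h : (p : ℤ) ^ (t + 1) ∣ y - z) (hy : GoodZ p t y) :
    GoodZ p t z := by
  refine ⟨fun v h1 h2 h3 => hy.1 v h1 h2 ?_, fun h3 => ?_⟩
  · have := dvd_add h h3
    simpa using this
  · have h4 : (p : ℤ) ^ t ∣ y - z := (pow_dvd_pow _ (Nat.le_succ t)).trans h
    have h5 : (p : ℤ) ^ t ∣ y := by simpa using dvd_add h4 h3
    have := dvd_sub (hy.2 h5) h
    simpa using this

/-- A unit difference reaches every residue class. -/
lemma exists_hit {p : ℕ} (hp : p.Prime) (t : ℕ) (X E : ℤ) (hE : ¬ (p : ℤ) ∣ E) :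
    ∃ i : ℕ, i < p ^ t ∧ (p : ℤ) ^ t ∣ X + i * E := by
  have hpz : Prime (p : ℤ) := Nat.prime_iff_prime_int.mp hp
  have hco : IsCoprime ((p : ℤ) ^ t) E :=
    IsCoprime.pow_left ((Prime.coprime_iff_not_dvd hpz).2 hE)
  obtain ⟨a, b, hab⟩ := hco
  have hpos : (0 : ℤ) < (p : ℤ) ^ t := by have := hp.pos; positivity
  have h0 := Int.emod_nonneg (-X * b) hpos.ne'
  have h1 := Int.emod_lt_of_pos (-X * b) hpos
  refine ⟨((-X * b) % (p : ℤ) ^ t).toNat, ?_, ?_⟩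
  · zify
    rw [Int.toNat_of_nonneg h0]; exact h1
  · rw [Int.toNat_of_nonneg h0, Int.emod_def]
    refine ⟨a * X - (-X * b / (p : ℤ) ^ t) * E, ?_⟩
    linear_combination (-X) * hab

lemma case_unit {p : ℕ} (hp : p.Prime) (t : ℕ) (X E : ℤ)
    (hg : ∀ i : ℕ, i ≤ p ^ t → GoodZ p t (X + i * E)) (hE : ¬ (p : ℤ) ∣ E) :
    (¬ (p : ℤ) ^ (t + 1) ∣ X) ∧ ∃ i : ℕ, i ≤ p ^ t ∧ (p : ℤ) ^ (t + 1) ∣ X + i * E := by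
  have hp0 : (p : ℤ) ≠ 0 := by exact_mod_cast hp.ne_zero
  constructor
  · intro h
    have h1 : (p : ℤ) ^ t ∣ X := (pow_dvd_pow _ (Nat.le_succ t)).trans h
    have h2 := (hg (p ^ t) le_rfl).2 (dvd_add h1 (by push_cast; exact dvd_mul_right _ _))
    have h3 : (p : ℤ) ^ (t + 1) ∣ (p : ℤ) ^ t * E := by
      have := dvd_sub h2 h
      push_cast at this
      simpa using this
    rw [pow_succ] at h3
    exact hE ((mul_dvd_mul_iff_left (pow_ne_zero _ hp0)).1 h3)
  · obtain ⟨i, hi, h⟩ := exists_hit hp t X E hE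
    exact ⟨i, hi.le, (hg i hi.le).2 h⟩

lemma case_mid {p : ℕ} (hp : p.Prime) (t : ℕ) (ht : 1 ≤ t) (X E : ℤ)
    (hg : ∀ i : ℕ, i ≤ p ^ t → GoodZ p t (X + i * E)) (hE : (p : ℤ) ∣ E) :
    (p : ℤ) ^ 2 ∣ E := by
  have hp0 : (p : ℤ) ≠ 0 := by exact_mod_cast hp.ne_zero
  have hpp : (0 : ℤ) < p := by exact_mod_cast hp.pos
  obtain ⟨u, rfl⟩ := hE
  by_contra hcon
  have hu : ¬ (p : ℤ) ∣ u := by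
    intro h; apply hcon; rw [pow_two]; exact mul_dvd_mul_left _ h
  by_cases hX : (p : ℤ) ∣ X
  · obtain ⟨Y, rfl⟩ := hX
    obtain ⟨r, rfl⟩ : ∃ r, t = r + 1 := ⟨t - 1, by omega⟩
    obtain ⟨i, hi, w, h⟩ := exists_hit hp (r + 1) (Y - (p : ℤ) ^ r) u hu
    have e : (p : ℤ) * Y + i * (p * u) = (p : ℤ) ^ (r + 1) + (p : ℤ) ^ (r + 1 + 1) * w := by
      linear_combination (p : ℤ) * h
    have h2 := (hg i hi.le).2
    rw [e] at h2
    have h3 := h2 ⟨1 + p * w, by ring⟩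
    have h4 : (p : ℤ) ^ (r + 1 + 1) ∣ (p : ℤ) ^ (r + 1) * 1 := by
      simpa using (dvd_add_left (Dvd.intro _ rfl)).1 h3
    rw [pow_succ _ (r + 1)] at h4
    have h5 := (mul_dvd_mul_iff_left (pow_ne_zero _ hp0)).1 h4
    exact (Nat.prime_iff_prime_int.mp hp).not_isUnit (isUnit_of_dvd_one h5)
  · have hv0 := Int.emod_nonneg X hpp.ne'
    have hv1 := Int.emod_lt_of_pos X hpp
    have hv2 : X % p ≠ 0 := fun h => hX (Int.dvd_of_emod_eq_zero h)
    obtain ⟨i, hi, w, h⟩ := exists_hit hp t (X / p) u hu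
    refine (hg i hi.le).1 (X % p) (by omega) hv1 ⟨w, ?_⟩
    have := Int.mul_ediv_add_emod X p
    linear_combination (p : ℤ) * h - this

lemma case_zero {p : ℕ} (hp : p.Prime) (t : ℕ) (ht : 1 ≤ t) (X E : ℤ)
    (hg : ∀ i : ℕ, i ≤ p ^ t → GoodZ p t (X + i * E)) (hX : (p : ℤ) ^ (t + 1) ∣ X) :
    (p : ℤ) ^ (t + 1) ∣ E := by
  have hp0 : (p : ℤ) ≠ 0 := by exact_mod_cast hp.ne_zero
  have hE : (p : ℤ) ∣ E := by
    by_contra h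
    exact (case_unit hp t X E hg h).1 hX
  have hE2 := case_mid hp t ht X E hg hE
  have key : ∀ l : ℕ, ∀ j : ℕ, j + l + 1 = t → (p : ℤ) ^ (t + 1) ∣ (p : ℤ) ^ j * E := by
    intro l
    induction l with
    | zero =>
      rintro j rfl
      have : (p : ℤ) ^ (j + 0 + 1 + 1) = (p : ℤ) ^ j * (p : ℤ) ^ 2 := by ring
      rw [this]
      exact mul_dvd_mul_left _ hE2
    | succ l ih =>
      intro j hj
      have h1 := ih (j + 1) (by omega)
      have h2 : (p : ℤ) ^ t ∣ (p : ℤ) ^ j * E := by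
        have e1 : (p : ℤ) ^ (t + 1) = p * (p : ℤ) ^ t := by ring
        have e2 : (p : ℤ) ^ (j + 1) * E = p * ((p : ℤ) ^ j * E) := by ring
        rw [e1, e2] at h1
        exact (mul_dvd_mul_iff_left hp0).1 h1
      have hle : p ^ j ≤ p ^ t := Nat.pow_le_pow_right hp.pos (by omega)
      have h3 := (hg (p ^ j) hle).2 (dvd_add ((pow_dvd_pow _ (Nat.le_succ t)).trans hX)
        (by push_cast; exact h2))
      have := (dvd_add_right hX).1 h3
      push_cast at this
      exact this
  simpa using key (t - 1) 0 (by omega)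

/-- The representative of `a + i d` agrees with the integer progression modulo `p^(t+1)`. -/
lemma val_congr (p t : ℕ) (hp : p.Prime) (a d : ZMod (p ^ (t + 2))) (i : ℕ) :
    (p : ℤ) ^ (t + 1) ∣ (((a + i • d).val : ℕ) : ℤ) - ((a.val : ℤ) + i * (d.val : ℤ)) := by
  have : NeZero (p ^ (t + 2)) := ⟨pow_ne_zero _ hp.ne_zero⟩
  have h : ((p ^ (t + 2) : ℕ) : ℤ) ∣
      (((a + i • d).val : ℕ) : ℤ) - ((a.val : ℤ) + i * (d.val : ℤ)) := by
    rw [← ZMod.intCast_zmod_eq_zero_iff_dvd]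
    push_cast
    simp
  refine dvd_trans ?_ h
  push_cast
  exact pow_dvd_pow _ (by omega)

open Classical in
/-- The allowed digits. -/
noncomputable def digitSet (p t : ℕ) [NeZero (p ^ (t + 2))] : Finset (ZMod (p ^ (t + 2))) :=
  Finset.univ.filter fun a => GoodZ p t (a.val : ℤ)

open Classical in
/-- The vectors with allowed digits and exactly `N` digits divisible by `p^(t+1)`. -/
noncomputable def layer (p t n N : ℕ) [NeZero (p ^ (t + 2))] :
    Finset (Fin n → ZMod (p ^ (t + 2))) :=
  (Fintype.piFinset fun _ => digitSet p t).filter fun x =>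
    (Finset.univ.filter fun j => (p : ℤ) ^ (t + 1) ∣ ((x j).val : ℤ)).card = N

lemma layer_free (p t n N : ℕ) [NeZero (p ^ (t + 2))] (hp : p.Prime) (ht : 1 ≤ t) :
    ProgFree (p ^ (t + 2)) (p ^ t + 1) (layer p t n N) := by
  classical
  rintro ⟨x, d, hinj, hmem⟩
  have hmem' : ∀ i : ℕ, i ≤ p ^ t → x + i • d ∈ layer p t n N := fun i hi =>
    hmem ⟨i, by omega⟩
  have hg : ∀ j, ∀ i : ℕ, i ≤ p ^ t → GoodZ p t (((x j).val : ℤ) + i * ((d j).val : ℤ)) := by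
    intro j i hi
    have h := hmem' i hi
    simp only [layer, digitSet, Finset.mem_filter, Fintype.mem_piFinset] at h
    exact goodZ_congr (val_congr p t hp (x j) (d j) i) (h.1 j).2
  set Z : ℕ → Finset (Fin n) := fun i =>
    Finset.univ.filter fun j => (p : ℤ) ^ (t + 1) ∣ ((x j).val : ℤ) + i * ((d j).val : ℤ) with hZ
  have hcard : ∀ i : ℕ, i ≤ p ^ t → (Z i).card = N := by
    intro i hi
    have h := hmem' i hi
    simp only [layer, Finset.mem_filter] at h
    rw [← h.2]
    congr 1
    ext j
    simp only [hZ, Finset.mem_filter, Finset.mem_univ, true_and]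
    have hc := val_congr p t hp (x j) (d j) i
    exact ((dvd_iff_dvd_of_dvd_sub hc)).symm
  have hsub : ∀ i : ℕ, i ≤ p ^ t → Z 0 ⊆ Z i := by
    intro i hi j hj
    simp only [hZ, Finset.mem_filter, Finset.mem_univ, true_and, Nat.cast_zero, zero_mul,
      add_zero] at hj ⊢
    exact dvd_add hj (Dvd.dvd.mul_left (case_zero hp t ht _ _ (hg j) hj) _)
  have heq : ∀ i : ℕ, i ≤ p ^ t → Z 0 = Z i := fun i hi =>
    Finset.eq_of_subset_of_card_le (hsub i hi) (by rw [hcard i hi, hcard 0 (Nat.zero_le _)])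
  have hsq : ∀ j, (p : ℤ) ^ 2 ∣ ((d j).val : ℤ) := by
    intro j
    apply case_mid hp t ht _ _ (hg j)
    by_contra hcon
    obtain ⟨h1, i, hi, h2⟩ := case_unit hp t _ _ (hg j) hcon
    have h3 : j ∈ Z i := Finset.mem_filter.2 ⟨Finset.mem_univ _, h2⟩
    rw [← heq i hi] at h3
    have h4 := (Finset.mem_filter.1 h3).2
    rw [Nat.cast_zero, zero_mul, add_zero] at h4
    exact h1 h4
  have hz : (p ^ t) • d = 0 := by
    funext j
    have h1 : p ^ 2 ∣ (d j).val := by exact_mod_cast hsq j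
    have h2 : p ^ (t + 2) ∣ p ^ t * (d j).val := by
      exact (pow_add p t 2).dvd.trans (mul_dvd_mul_left _ h1)
    have h3 := (ZMod.natCast_eq_zero_iff _ _).2 h2
    simp only [Nat.cast_mul, ZMod.natCast_val, ZMod.cast_id', id_eq] at h3
    simpa [nsmul_eq_mul] using h3
  have h0 := @hinj ⟨0, by omega⟩ ⟨p ^ t, by omega⟩ (by simp [hz])
  have := congrArg Fin.val h0
  have hpos : 0 < p ^ t := pow_pos hp.pos _
  simp at this
  omega

lemma digitSet_card (p t : ℕ) [NeZero (p ^ (t + 2))] (hp : p.Prime) :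
    p ^ (t + 2) ≤ (digitSet p t).card + p * ((p - 1) + (p - 1)) := by
  classical
  set B : Finset ℕ := Finset.Ico 1 p ∪ (Finset.Ico 1 p).image (fun e => p ^ t * e) with hB
  set W : Finset (ZMod (p ^ (t + 2))) := (Finset.range p ×ˢ B).image
    (fun uv => ((uv.1 * p ^ (t + 1) + uv.2 : ℕ) : ZMod (p ^ (t + 2)))) with hW
  have hpos : 0 < p ^ (t + 1) := pow_pos hp.pos _
  have hWc : W.card ≤ p * ((p - 1) + (p - 1)) := by
    refine Finset.card_image_le.trans ?_
    rw [Finset.card_product, Finset.card_range]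
    refine Nat.mul_le_mul_left _ ((Finset.card_union_le _ _).trans ?_)
    refine add_le_add (by simp) (Finset.card_image_le.trans (by simp))
  have hcov : (Finset.univ : Finset (ZMod (p ^ (t + 2)))) ⊆ digitSet p t ∪ W := by
    intro a _
    rw [Finset.mem_union]
    by_contra hcon
    push Not at hcon
    obtain ⟨h1, h2⟩ := hcon
    have hnB : a.val % p ^ (t + 1) ∉ B := by
      intro h
      apply h2
      rw [hW, Finset.mem_image]
      refine ⟨(a.val / p ^ (t + 1), a.val % p ^ (t + 1)), ?_, ?_⟩
      · rw [Finset.mem_product]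
        refine ⟨Finset.mem_range.2 ?_, h⟩
        rw [Nat.div_lt_iff_lt_mul hpos]
        have := ZMod.val_lt a
        calc _ < _ := this
          _ = _ := by ring
      · have := Nat.div_add_mod' a.val (p ^ (t + 1))
        simp only [this]
        simp
    apply h1
    simp only [digitSet, Finset.mem_filter, Finset.mem_univ, true_and]
    constructor
    · intro v hv1 hv2 hd
      apply hnB
      obtain ⟨w, rfl⟩ := Int.eq_ofNat_of_zero_le (by omega : 0 ≤ v)
      have hw : w < p := by exact_mod_cast hv2
      have hw1 : 1 ≤ w := by exact_mod_cast hv1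
      have hm : a.val ≡ w [MOD p ^ (t + 1)] := by
        have := (Nat.modEq_iff_dvd (n := p ^ (t + 1)) (a := w) (b := a.val)).2
          (by push_cast; exact hd)
        exact this.symm
      have hlt : w < p ^ (t + 1) := hw.trans_le (Nat.le_self_pow (by omega) p)
      have : a.val % p ^ (t + 1) = w := by
        rw [hm, Nat.mod_eq_of_lt hlt]
      rw [this, hB]
      exact Finset.mem_union_left _ (Finset.mem_Ico.2 ⟨hw1, hw⟩)
    · intro hd
      by_contra hnd
      apply hnB
      have hd' : p ^ t ∣ a.val := by exact_mod_cast hd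
      have hnd' : ¬ p ^ (t + 1) ∣ a.val := by
        intro h; apply hnd; exact_mod_cast h
      obtain ⟨w, hw⟩ := hd'
      rw [hw, pow_succ, Nat.mul_mod_mul_left, hB]
      refine Finset.mem_union_right _ (Finset.mem_image.2 ⟨w % p, Finset.mem_Ico.2 ⟨?_, ?_⟩, rfl⟩)
      · rw [Nat.one_le_iff_ne_zero]
        intro h
        apply hnd'
        rw [hw, pow_succ]
        exact mul_dvd_mul_left _ (Nat.dvd_of_mod_eq_zero h)
      · exact Nat.mod_lt _ hp.pos
  have := Finset.card_le_card hcov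
  rw [Finset.card_univ, ZMod.card] at this
  have h3 := Finset.card_union_le (digitSet p t) W
  omega

lemma card_pow_le (p t n : ℕ) [NeZero (p ^ (t + 2))] (hp : p.Prime) (ht : 1 ≤ t) :
    (digitSet p t).card ^ n ≤ (n + 1) * rAP (p ^ t + 1) (p ^ (t + 2)) n := by
  classical
  have hle : ∀ N, (layer p t n N).card ≤ rAP (p ^ t + 1) (p ^ (t + 2)) n := by
    intro N
    refine le_csSup ⟨Fintype.card (Fin n → ZMod (p ^ (t + 2))), ?_⟩
      ⟨layer p t n N, layer_free p t n N hp ht, rfl⟩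
    rintro c ⟨S, _, rfl⟩
    exact Finset.card_le_univ S
  have h1 : (Fintype.piFinset fun _ : Fin n => digitSet p t).card = (digitSet p t).card ^ n := by
    simp [Fintype.card_piFinset]
  have h2 := Finset.card_eq_sum_card_fiberwise
    (s := Fintype.piFinset fun _ : Fin n => digitSet p t) (t := Finset.range (n + 1))
    (f := fun x => (Finset.univ.filter fun j => (p : ℤ) ^ (t + 1) ∣ ((x j).val : ℤ)).card)
    (by
      intro x _
      simp only [Finset.coe_range, Set.mem_Iio]
      have := Finset.card_le_univ
        (Finset.univ.filter fun j => (p : ℤ) ^ (t + 1) ∣ ((x j).val : ℤ))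
      simp only [Fintype.card_fin] at this
      omega)
  rw [← h1, h2]
  refine (Finset.sum_le_card_nsmul _ _ (rAP (p ^ t + 1) (p ^ (t + 2)) n) ?_).trans (by simp)
  intro N _
  refine le_trans (le_of_eq ?_) (hle N)
  unfold layer
  congr!

theorem stmt12 (p s m k : ℕ) (hp : p.Prime) (hs : 3 ≤ s)
    (hm : m = p ^ s) (hk : k = p ^ (s - 2) + 1) :
    ∃ C c : ℝ, 0 < C ∧ 0 < c ∧ c ≤ (m : ℝ) / 2 ∧ ∀ n : ℕ, 1 ≤ n →
      C * ((m : ℝ) - 2 * (p : ℝ) ^ 2 + 2 * (p : ℝ)) ^ n / (n : ℝ) ^ c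
        ≤ (rAP k m n : ℝ) := by
  obtain ⟨t, rfl⟩ : ∃ t, s = t + 2 := ⟨s - 2, by omega⟩
  have ht : 1 ≤ t := by omega
  subst hm
  rw [Nat.add_sub_cancel] at hk
  subst hk
  have : NeZero (p ^ (t + 2)) := ⟨pow_ne_zero _ hp.ne_zero⟩
  have hp2 : (2 : ℝ) ≤ p := by exact_mod_cast hp.two_le
  have hp3 : (p : ℝ) ^ 3 ≤ (p : ℝ) ^ (t + 2) := pow_le_pow_right₀ (by linarith) (by omega)
  have hpq : 2 * (p : ℝ) ^ 2 ≤ (p : ℝ) ^ 3 := by nlinarith [sq_nonneg (p : ℝ)]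
  refine ⟨1 / 2, 1, by norm_num, one_pos, ?_, ?_⟩
  · push_cast
    nlinarith
  · intro n hn
    have hn' : (1 : ℝ) ≤ n := by exact_mod_cast hn
    have hD : ((p ^ (t + 2) : ℕ) : ℝ) - 2 * (p : ℝ) ^ 2 + 2 * p ≤ ((digitSet p t).card : ℝ) := by
      have h := digitSet_card p t hp
      have h' : ((p ^ (t + 2) : ℕ) : ℝ) ≤
          (((digitSet p t).card + p * ((p - 1) + (p - 1)) : ℕ) : ℝ) := by exact_mod_cast h
      rw [Nat.cast_add, Nat.cast_mul, Nat.cast_add, Nat.cast_sub hp.one_le] at h'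
      push_cast at h' ⊢
      linarith
    have h0 : 0 ≤ ((p ^ (t + 2) : ℕ) : ℝ) - 2 * (p : ℝ) ^ 2 + 2 * p := by
      push_cast; linarith
    have h1 := pow_le_pow_left₀ h0 hD n
    have h2 : ((digitSet p t).card : ℝ) ^ n ≤
        (n + 1) * (rAP (p ^ t + 1) (p ^ (t + 2)) n : ℝ) := by
      exact_mod_cast card_pow_le p t n hp ht
    rw [Real.rpow_one, div_le_iff₀ (by linarith)]
    have hr : (0 : ℝ) ≤ (rAP (p ^ t + 1) (p ^ (t + 2)) n : ℝ) := Nat.cast_nonneg _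
    nlinarith
end
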